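/- arXiv:1409.3892 — 6 statements merged into one kernel-verified Lean document; each statement's English description precedes it below -/
import Mathlib

section
/- Let G be a connected swm-graph and let G^Δ be its thickening. Then G^Δ is finitely Helly: every finite family of pairwise intersecting balls of G^Δ has a common vertex. Moreover, if G is locally finite, then G^Δ is Helly: every (possibly infinite) family of pairwise intersecting balls of G^Δ has a common vertex. -/
variable {V : Type*}

/-- Triangle condition (TC). -/
def TriangleCondition (G : SimpleGraph V) : Prop :=
  ∀ u v w : V, G.Adj v w → G.dist u v = G.dist u w → 1 ≤ G.dist u v →
    ∃ x : V, G.Adj v x ∧ G.Adj w x ∧ G.dist u x + 1 = G.dist u v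

/-- Quadrangle condition (QC). -/
def QuadrangleCondition (G : SimpleGraph V) : Prop :=
  ∀ u v w z : V, G.Adj z v → G.Adj z w → G.dist v w = 2 →
    G.dist u v = G.dist u w → G.dist u z = G.dist u v + 1 →
    ∃ x : V, G.Adj v x ∧ G.Adj w x ∧ G.dist u x + 1 = G.dist u v

def WeaklyModular (G : SimpleGraph V) : Prop :=
  TriangleCondition G ∧ QuadrangleCondition G

/-- The metric interval `I(u,v)`. -/
def gInterval (G : SimpleGraph V) (u v : V) : Set V :=
  {x : V | G.dist u x + G.dist x v = G.dist u v}

/-- `G` contains an induced `K₄` minus an edge. -/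
def HasInducedK4minus (G : SimpleGraph V) : Prop :=
  ∃ a b c d : V, G.Adj a b ∧ G.Adj a c ∧ G.Adj a d ∧ G.Adj b c ∧ G.Adj b d ∧
    c ≠ d ∧ ¬ G.Adj c d

/-- `G` contains an isometric `K₃,₃` minus an edge. -/
def HasIsometricK33minus (G : SimpleGraph V) : Prop :=
  ∃ a₁ a₂ a₃ b₁ b₂ b₃ : V,
    G.Adj a₁ b₁ ∧ G.Adj a₁ b₂ ∧ G.Adj a₁ b₃ ∧
    G.Adj a₂ b₁ ∧ G.Adj a₂ b₂ ∧ G.Adj a₂ b₃ ∧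
    G.Adj a₃ b₁ ∧ G.Adj a₃ b₂ ∧
    G.dist a₁ a₂ = 2 ∧ G.dist a₁ a₃ = 2 ∧ G.dist a₂ a₃ = 2 ∧
    G.dist b₁ b₂ = 2 ∧ G.dist b₁ b₃ = 2 ∧ G.dist b₂ b₃ = 2 ∧
    G.dist a₃ b₃ = 3

/-- `(p,q)` is a Boolean pair: with `k = d(p,q)`, there is an isometrically
embedded `k`-cube inside the interval `I(p,q)`. -/
def BooleanPair (G : SimpleGraph V) (p q : V) : Prop :=
  ∃ f : (Fin (G.dist p q) → Bool) → V,
    (∀ A, f A ∈ gInterval G p q) ∧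
    ∀ A B, G.dist (f A) (f B) = (Finset.univ.filter fun i => A i ≠ B i).card

/-- The thickening `G^Δ`: two distinct vertices are adjacent iff they form
a Boolean pair of `G`. -/
def thickening (G : SimpleGraph V) : SimpleGraph V :=
  SimpleGraph.fromRel fun p q => BooleanPair G p q

universe u

/-- The swm-graph axioms, bundled. -/
structure IsSwm (G : SimpleGraph V) : Prop where
  conn : G.Connected
  tc : TriangleCondition G
  qc : QuadrangleCondition G
  k4 : ¬ HasInducedK4minus G
  k33 : ¬ HasIsometricK33minus G

/-- `x` lies on a geodesic between `p` and `q`. -/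
def OnGeod (G : SimpleGraph V) (p q x : V) : Prop :=
  G.dist p x + G.dist q x = G.dist p q

/-- Every interval of length two inside the interval of `p` and `q` has at least two midpoints. -/
def RelCompl (G : SimpleGraph V) (p q : V) : Prop :=
  ∀ a b, G.dist a b = 2 → G.dist p a + 2 + G.dist q b = G.dist p q →
    ∃ x y, x ≠ y ∧ G.Adj a x ∧ G.Adj b x ∧ G.Adj a y ∧ G.Adj b y

lemma dist_swap (G : SimpleGraph V) (a b : V) : G.dist a b = G.dist b a :=
  SimpleGraph.dist_comm

namespace IsSwm

variable {G : SimpleGraph V}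

lemma tri (h : IsSwm G) (a b c : V) : G.dist a c ≤ G.dist a b + G.dist b c :=
  h.conn.dist_triangle

lemma le_succ (h : IsSwm G) (u : V) {v w : V} (e : G.Adj v w) :
    G.dist u v ≤ G.dist u w + 1 := by
  have := h.tri u w v
  rwa [SimpleGraph.dist_eq_one_iff_adj.2 e.symm] at this

lemma eq_of_dist (h : IsSwm G) {a b : V} (e : G.dist a b = 0) : a = b :=
  h.conn.dist_eq_zero_iff.1 e

lemma two_of (h : IsSwm G) {a b : V} (h1 : a ≠ b) (h2 : ¬ G.Adj a b) (h3 : G.dist a b ≤ 2) :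
    G.dist a b = 2 := by
  have h4 : G.dist a b ≠ 0 := fun e => h1 (h.eq_of_dist e)
  have h5 : G.dist a b ≠ 1 := fun e => h2 (SimpleGraph.dist_eq_one_iff_adj.1 e)
  omega

lemma dist_le_two (h : IsSwm G) {a b c : V} (h1 : G.Adj a b) (h2 : G.Adj b c) :
    G.dist a c ≤ 2 := by
  have := h.le_succ a h2.symm
  rwa [SimpleGraph.dist_eq_one_iff_adj.2 h1] at this

lemma exists_pred (h : IsSwm G) {p q : V} {n : ℕ} (e : G.dist p q = n + 1) :
    ∃ y, G.Adj q y ∧ G.dist p y = n := by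
  obtain ⟨w, hw⟩ := h.conn.exists_walk_length_eq_dist q p
  cases w with
  | nil => simp at e
  | @cons _ y _ a w =>
    refine ⟨y, a, ?_⟩
    have h1 := SimpleGraph.dist_le w
    have h2 := h.le_succ p a
    rw [SimpleGraph.Walk.length_cons, SimpleGraph.dist_comm, e] at hw
    rw [SimpleGraph.dist_comm] at h1
    omega

lemma not_adj_of_pred (h : IsSwm G) {p x y z : V} (zx : G.Adj z x) (zy : G.Adj z y)
    (e : G.dist p x = G.dist p y) (ez : G.dist p z = G.dist p x + 1) : ¬ G.Adj x y := by
  intro xy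
  have h1 : 1 ≤ G.dist p x := by
    by_contra h0
    have h2 := h.eq_of_dist (a := p) (b := x) (by omega)
    have h3 := h.eq_of_dist (a := p) (b := y) (by omega)
    exact xy.ne (h2.symm.trans h3)
  obtain ⟨w, xw, yw, ew⟩ := h.tc p x y xy e h1
  refine h.k4 ⟨x, y, w, z, xy, xw, zx.symm, yw, zy.symm, ?_, ?_⟩
  · rintro rfl; omega
  · intro wz
    have := h.le_succ p wz.symm
    omega

lemma exists_meet (h : IsSwm G) {p x y z : V} (zx : G.Adj z x) (zy : G.Adj z y) (ne : x ≠ y)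
    (e : G.dist p x = G.dist p y) (ez : G.dist p z = G.dist p x + 1) :
    ∃ w, G.Adj x w ∧ G.Adj y w ∧ G.dist p w + 1 = G.dist p x :=
  h.qc p x y z zx zy
    (h.two_of ne (h.not_adj_of_pred zx zy e ez) (h.dist_le_two zx.symm zy)) e ez

lemma meet_unique (h : IsSwm G) {p x y z w w' : V} (zx : G.Adj z x) (zy : G.Adj z y)
    (ne : x ≠ y) (e : G.dist p x = G.dist p y) (ez : G.dist p z = G.dist p x + 1)
    (xw : G.Adj x w) (yw : G.Adj y w) (ew : G.dist p w + 1 = G.dist p x)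
    (xw' : G.Adj x w') (yw' : G.Adj y w') (ew' : G.dist p w' + 1 = G.dist p x) : w = w' := by
  by_contra hne
  have hn := h.not_adj_of_pred xw xw' (p := p) (by omega) (by omega)
  obtain ⟨u, wu, wu', eu⟩ := h.exists_meet xw xw' hne (p := p) (by omega) (by omega)
  have far {a b : V} (hab : G.dist p a + 2 ≤ G.dist p b) : a ≠ b ∧ ¬ G.Adj a b :=
    ⟨by rintro rfl; omega, fun ab => by have := h.le_succ p ab.symm; omega⟩
  have sym {a b : V} (hab : G.dist p a + 2 ≤ G.dist p b) (l : G.dist b a ≤ 2) :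
      G.dist b a = 2 :=
    h.two_of (far hab).1.symm (fun c => (far hab).2 c.symm) l
  refine h.k33 ⟨x, y, u, w, w', z, xw, xw', zx.symm, yw, yw', zy.symm, wu.symm, wu'.symm,
    h.two_of ne (h.not_adj_of_pred zx zy e ez) (h.dist_le_two xw yw.symm),
    sym (by omega) (h.dist_le_two xw wu), sym (by omega) (h.dist_le_two yw wu),
    h.two_of hne hn (h.dist_le_two xw.symm xw'), ?_, ?_, ?_⟩
  · rw [SimpleGraph.dist_comm]
    exact sym (by omega) (h.dist_le_two zx xw)
  · rw [SimpleGraph.dist_comm]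
    exact sym (by omega) (h.dist_le_two zx xw')
  · have h1 := h.tri p u z
    have h2 := h.le_succ u zx
    have h3 := h.dist_le_two wu.symm xw.symm
    omega

end IsSwm

namespace OnGeod

variable {G : SimpleGraph V}

lemma symm {p q x : V} (b : OnGeod G p q x) : OnGeod G q p x := by
  unfold OnGeod at *
  rw [dist_swap G q p]
  omega

lemma trans (h : IsSwm G) {p q x y : V} (b : OnGeod G p q y) (c : OnGeod G p y x) :
    OnGeod G p q x := by
  unfold OnGeod at *
  have h1 := h.tri q y x
  have h2 := h.tri p x q
  rw [dist_swap G x q] at h2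
  omega

lemma shift (h : IsSwm G) {p q x y : V} (b : OnGeod G p q y) (c : OnGeod G p y x) :
    OnGeod G x q y := by
  unfold OnGeod at *
  have h1 := h.tri x y q
  have h2 := h.tri p x q
  rw [dist_swap G y q] at h1
  rw [dist_swap G x y] at *
  omega

lemma of_adj {p x y : V} (e : G.Adj y x) (l : G.dist p y = G.dist p x + 1) : OnGeod G p y x := by
  unfold OnGeod
  rw [SimpleGraph.dist_eq_one_iff_adj.2 e, l]

end OnGeod

namespace IsSwm

variable {G : SimpleGraph V}

lemma not_adj_of_onGeod (h : IsSwm G) {p q x y : V} (bx : OnGeod G p q x) (b' : OnGeod G p q y)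
    (e : G.dist p x = G.dist p y) : ¬ G.Adj x y := by
  intro xy
  unfold OnGeod at *
  have h0 {r : V} (er : G.dist r x = G.dist r y) : 1 ≤ G.dist r x := by
    by_contra h0
    have h2 := h.eq_of_dist (a := r) (b := x) (by omega)
    have h3 := h.eq_of_dist (a := r) (b := y) (by omega)
    exact xy.ne (h2.symm.trans h3)
  obtain ⟨a, xa, ya, ea⟩ := h.tc p x y xy e (h0 e)
  obtain ⟨b, xb, yb, eb⟩ := h.tc q x y xy (by omega) (h0 (by omega))
  have h1 := h.tri p a q
  rw [dist_swap G a q] at h1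
  refine h.k4 ⟨x, y, a, b, xy, xa, xb, ya, yb, ?_, ?_⟩
  · rintro rfl; omega
  · intro ab
    have := h.le_succ q ab
    omega

lemma meet_le (h : IsSwm G) {p q y y' w z : V} (qy : G.Adj q y) (qy' : G.Adj q y')
    (ne : y ≠ y') (e : G.dist p y = G.dist p y') (eq : G.dist p q = G.dist p y + 1)
    (yw : G.Adj y w) (yw' : G.Adj y' w) (ew : G.dist p w + 1 = G.dist p y)
    (b : OnGeod G p y z) (b' : OnGeod G p y' z) : OnGeod G p w z := by
  have bq : OnGeod G p q z := (OnGeod.of_adj qy eq).trans h b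
  unfold OnGeod at *
  rw [dist_swap G y, dist_swap G y', dist_swap G q, dist_swap G w] at *
  obtain ⟨w', y1, y2, e1⟩ := h.exists_meet qy qy' ne (p := z) (by omega) (by omega)
  have h1 := h.tri p z w'
  have h2 := h.le_succ p y1
  obtain rfl := h.meet_unique qy qy' ne e eq yw yw' ew y1 y2 (by omega)
  omega

end IsSwm

namespace RelCompl

variable {G : SimpleGraph V}

lemma of_le_one {p q : V} (l : G.dist p q ≤ 1) : RelCompl G p q := by
  intro a b _ h2
  omega

lemma symm {p q : V} (r : RelCompl G p q) : RelCompl G q p := by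
  intro a b h1 h2
  obtain ⟨x, y, ne, h3, h4, h5, h6⟩ := r b a (by rwa [SimpleGraph.dist_comm])
    (by rw [dist_swap G p q]; omega)
  exact ⟨x, y, ne, h4, h3, h6, h5⟩

lemma left (h : IsSwm G) {p q y : V} (r : RelCompl G p q) (b : OnGeod G p q y) :
    RelCompl G p y := by
  intro a c h1 h2
  refine r a c h1 ?_
  unfold OnGeod at b
  have h3 := h.tri q y c
  have h4 := h.tri p a q
  have h5 := h.tri a c q
  rw [dist_swap G c q] at h5
  omega

lemma right (h : IsSwm G) {p q y : V} (r : RelCompl G p q) (b : OnGeod G p q y) :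
    RelCompl G y q :=
  (r.symm.left h b.symm).symm

lemma pred (h : IsSwm G) {p q y : V} (r : RelCompl G p q) (e : G.Adj q y)
    (l : G.dist p q = G.dist p y + 1) : RelCompl G p y :=
  r.left h (OnGeod.of_adj e l)

/-- Another midpoint of the top interval of length two. -/
lemma exists_ne (h : IsSwm G) {p q v w : V} (r : RelCompl G p q) (qw : G.Adj q w)
    (wv : G.Adj w v) (l : G.dist p q = G.dist p v + 2) :
    ∃ w', w' ≠ w ∧ G.Adj v w' ∧ G.Adj q w' ∧ G.dist p w' = G.dist p v + 1 := by
  have h1 := h.dist_le_two wv.symm qw.symm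
  have h2 := h.tri p v q
  obtain ⟨x, y, ne, h3, h4, h5, h6⟩ := r v q (by omega) (by simp; omega)
  have lev {x : V} (h3 : G.Adj v x) (h4 : G.Adj q x) : G.dist p x = G.dist p v + 1 := by
    have := h.le_succ p h3.symm
    have := h.le_succ p h4
    omega
  by_cases hx : x = w
  · exact ⟨y, fun e => ne (hx.trans e.symm), h5, h6, lev h5 h6⟩
  · exact ⟨x, hx, h3, h4, lev h3 h4⟩

end RelCompl

namespace RelCompl

variable {G : SimpleGraph V}

/-- A vertex with two distinct lower neighbours that are relatively complemented over `p` is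
itself relatively complemented over `p`. -/
theorem of_preds (h : IsSwm G) {p q y y' : V} (qy : G.Adj q y) (qy' : G.Adj q y') (ne : y ≠ y')
    (e : G.dist p q = G.dist p y + 1) (e' : G.dist p q = G.dist p y' + 1)
    (r : RelCompl G p y) (r' : RelCompl G p y') : RelCompl G p q := by
  induction hn : G.dist p q using Nat.strong_induction_on generalizing q y y' with
  | _ n ih =>
  subst hn
  have cov : ∀ y'', G.Adj q y'' → G.dist p q = G.dist p y'' + 1 → RelCompl G p y'' := by
    intro y'' qy'' e''
    by_cases h1 : y'' = y
    · exact h1 ▸ r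
    by_cases h2 : y'' = y'
    · exact h2 ▸ r'
    by_cases h3 : G.dist p y'' ≤ 1
    · exact of_le_one h3
    obtain ⟨w1, a1, b1, l1⟩ := h.exists_meet (p := p) qy'' qy h1 (by omega) (by omega)
    obtain ⟨w2, a2, b2, l2⟩ := h.exists_meet (p := p) qy'' qy' h2 (by omega) (by omega)
    by_cases hw : w1 ≠ w2
    · exact ih _ (by omega) a1 a2 hw (by omega) (by omega) (r.pred h b1 (by omega))
        (r'.pred h b2 (by omega)) rfl
    rw [not_not] at hw
    subst hw
    have rw1 := r.pred h b1 (by omega)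
    obtain ⟨v, wv, lv⟩ := h.exists_pred (p := p) (q := w1) (n := G.dist p w1 - 1) (by omega)
    obtain ⟨w, nw, vw, yw, lw⟩ := r.exists_ne h b1 wv (by omega)
    obtain ⟨w', nw', vw', yw', lw'⟩ := r'.exists_ne h b2 wv (by omega)
    have nww : w ≠ w' := by
      rintro rfl
      exact nw (h.meet_unique (p := p) qy qy' ne (by omega) (by omega) yw yw' (by omega) b1 b2
        (by omega))
    have q1 := h.dist_le_two qy yw
    have q2 := h.dist_le_two qy' yw'
    have q3 := h.le_succ q vw
    have t1 := h.tri p w q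
    have t2 := h.tri p w' q
    have t3 := h.tri p v q
    rw [dist_swap G w q] at t1
    rw [dist_swap G w' q] at t2
    rw [dist_swap G v q] at t3
    obtain ⟨y3, c1, c2, l3⟩ := h.exists_meet (p := q) vw vw' nww (by omega) (by omega)
    have qy3 : G.Adj q y3 := SimpleGraph.dist_eq_one_iff_adj.1 (by omega)
    have e3 := h.le_succ p qy3
    have e3' := h.le_succ p c1.symm
    have n1 : y3 ≠ y := by
      rintro rfl
      exact nw' (h.meet_unique (p := p) qy qy' ne (by omega) (by omega) c2.symm yw' (by omega)
        b1 b2 (by omega))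
    have n2 : y3 ≠ y' := by
      rintro rfl
      exact nw (h.meet_unique (p := p) qy qy' ne (by omega) (by omega) yw c1.symm (by omega)
        b1 b2 (by omega))
    have r3 : RelCompl G p y3 := ih _ (by omega) c1.symm c2.symm nww (by omega) (by omega)
      (r.pred h yw (by omega)) (r'.pred h yw' (by omega)) rfl
    have n3 : ¬ G.Adj y3 w1 := fun c => nw
      (h.meet_unique (p := p) qy3 qy n1 (by omega) (by omega) c1.symm yw (by omega) c b1
        (by omega))
    have n4 : y'' ≠ y3 := by
      rintro rfl
      exact n3 a1
    obtain ⟨w3, a3, b3, l3⟩ := h.exists_meet (p := p) qy'' qy3 n4 (by omega) (by omega)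
    exact ih _ (by omega) a1 a3 (by rintro rfl; exact n3 b3) (by omega) (by omega) rw1
      (r3.pred h b3 (by omega)) rfl
  intro a b hab hl
  by_cases hb : G.dist q b = 0
  · obtain rfl := h.eq_of_dist hb
    obtain ⟨x, qx, lx⟩ := h.exists_pred hab
    rw [SimpleGraph.dist_eq_one_iff_adj] at lx
    have ex : G.dist p q = G.dist p x + 1 := by
      have := h.le_succ p qx
      have := h.le_succ p lx.symm
      omega
    have key : ∀ Y, G.Adj q Y → G.dist p q = G.dist p Y + 1 → RelCompl G p Y → ¬ G.Adj a Y →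
        ∃ x y, x ≠ y ∧ G.Adj a x ∧ G.Adj q x ∧ G.Adj a y ∧ G.Adj q y := by
      intro Y qY eY rY aY
      have nx : x ≠ Y := by
        rintro rfl
        exact aY lx
      obtain ⟨w, xw, Yw, lw⟩ := h.exists_meet (p := p) qx qY nx (by omega) (by omega)
      have naw : a ≠ w := by
        rintro rfl
        exact aY Yw.symm
      obtain ⟨v, av, wv, lv⟩ := h.exists_meet (p := p) lx.symm xw naw (by omega) (by omega)
      obtain ⟨w', nw', vw', Yw', lw'⟩ := rY.exists_ne h Yw wv (by omega)
      have nxw : ¬ G.Adj x w' := fun c => nw'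
        (h.meet_unique (p := p) qx qY nx (by omega) (by omega) c Yw' (by omega) xw Yw (by omega))
      have q1 := h.dist_le_two qx lx.symm
      have q2 := h.dist_le_two qY Yw'
      have q3 := h.le_succ q vw'
      have t1 := h.tri p a q
      have t2 := h.tri p w' q
      have t3 := h.tri p v q
      rw [dist_swap G a q] at t1
      rw [dist_swap G w' q] at t2
      rw [dist_swap G v q] at t3
      obtain ⟨x', c1, c2, l3⟩ := h.exists_meet (p := q) av.symm vw'
        (by rintro rfl; exact aY Yw'.symm) (by omega) (by omega)
      exact ⟨x, x', by rintro rfl; exact nxw c2.symm, lx, qx, c1,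
        SimpleGraph.dist_eq_one_iff_adj.1 (by omega)⟩
    by_cases h1 : G.Adj a y
    · by_cases h2 : G.Adj a y'
      · exact ⟨y, y', ne, h1, qy, h2, qy'⟩
      · exact key y' qy' e' r' h2
    · exact key y qy e r h1
  · rw [dist_swap G q b] at hb hl
    obtain ⟨y'', qy'', l''⟩ := h.exists_pred (p := b) (q := q) (n := G.dist b q - 1) (by omega)
    have t1 := h.tri p a y''
    have t2 := h.tri a b y''
    have t3 := h.le_succ p qy''
    refine cov y'' qy'' (by omega) a b hab ?_
    rw [dist_swap G y'']
    omega

lemma of_adj_same (h : IsSwm G) {p y z : V} (yz : G.Adj y z) (e : G.dist p y = G.dist p z)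
    (r : RelCompl G p y) : RelCompl G p z := by
  induction hn : G.dist p y using Nat.strong_induction_on generalizing y z with
  | _ n ih =>
  subst hn
  by_cases h3 : G.dist p z ≤ 1
  · exact of_le_one h3
  obtain ⟨x, yx, zx, lx⟩ := h.tc p y z yz e (by omega)
  obtain ⟨w, xw, lw⟩ := h.exists_pred (p := p) (q := x) (n := G.dist p x - 1) (by omega)
  obtain ⟨x', nx', wx', yx', lx'⟩ := r.exists_ne h yx xw (by omega)
  have nxx : ¬ G.Adj x x' := h.not_adj_of_pred (p := p) yx yx' (by omega) (by omega)
  have zw : G.dist z w = 2 := by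
    have := h.dist_le_two zx xw
    have := h.tri p w z
    rw [dist_swap G w z] at this
    omega
  have zx' : G.dist z x' = 2 := by
    refine h.two_of (by rintro rfl; omega) (fun c => ?_) (h.dist_le_two yz.symm yx')
    exact h.k4 ⟨y, z, x, x', yz, yx, yx', zx, c, nx'.symm, nxx⟩
  obtain ⟨t, wt, x't, lt⟩ := h.tc z w x' wx' (by omega) (by omega)
  have zt : G.Adj z t := SimpleGraph.dist_eq_one_iff_adj.1 (by omega)
  have h1 := h.le_succ p wt.symm
  have h2 := h.le_succ p zt
  have rt : RelCompl G p t := ih (G.dist p x') (by omega) x't (by omega)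
    (r.pred h yx' (by omega)) rfl
  exact of_preds h zx zt (by rintro rfl; exact nxx x't.symm) (by omega) (by omega)
    (r.pred h yx (by omega)) rt

lemma of_rectangle (h : IsSwm G) {p q p' q' : V} (pp : G.Adj p p') (qq : G.Adj q' q)
    (e1 : G.dist p' q' = G.dist p q) (e2 : G.dist p q' = G.dist p q + 1)
    (e3 : G.dist p' q = G.dist p q + 1) (r : RelCompl G p' q') : RelCompl G p q := by
  induction hn : G.dist p q using Nat.strong_induction_on generalizing q q' with
  | _ n ih =>
  subst hn
  by_cases h3 : G.dist p q ≤ 1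
  · exact of_le_one h3
  have pl (x : V) : G.dist p x ≤ G.dist p' x + 1 := by
    rw [dist_swap G p, dist_swap G p']
    exact h.le_succ x pp
  have pl' (x : V) : G.dist p' x ≤ G.dist p x + 1 := by
    rw [dist_swap G p, dist_swap G p']
    exact h.le_succ x pp.symm
  obtain ⟨x, qx, lx⟩ := h.exists_pred (p := p') (q := q') (n := G.dist p q - 1) (by omega)
  obtain ⟨c, xc, lc⟩ := h.exists_pred (p := p') (q := x) (n := G.dist p q - 2) (by omega)
  obtain ⟨x', nx, cx', qx', lx'⟩ := r.exists_ne h qx xc (by omega)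
  have step : ∀ x, G.Adj q' x → G.dist p' x = G.dist p q - 1 →
      G.dist p x = G.dist p q ∧
      ∃ y, G.Adj q y ∧ G.Adj x y ∧ G.dist p y + 1 = G.dist p q ∧ RelCompl G p y ∧
        G.dist p' y = G.dist p q := by
    intro x qx lx
    have h1 := h.le_succ p qx
    have h2 := pl x
    obtain ⟨y, qy, xy, ly⟩ := h.exists_meet (p := p) (z := q') qq qx
      (by rintro rfl; omega) (by omega) (by omega)
    have h4 := h.le_succ p' qy
    have h5 := pl' y
    exact ⟨by omega, y, qy, xy, ly, ih (G.dist p y) (by omega) xy (by omega) (by omega) (by omega)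
      (r.pred h qx (by omega)) rfl, by omega⟩
  obtain ⟨f1, y1, a1, b1, l1, r1, d1⟩ := step x qx lx
  obtain ⟨f2, y2, a2, b2, l2, r2, d2⟩ := step x' qx' (by omega)
  refine of_preds h a1 a2 ?_ (by omega) (by omega) r1 r2
  rintro rfl
  have h6 := h.le_succ p xc
  have h7 := pl c
  obtain rfl := h.meet_unique (p := p) qx qx' nx.symm (by omega) (by omega) b1 b2 (by omega)
    xc cx'.symm (by omega)
  omega

end RelCompl

/-- A rank-preserving nondegenerate map from the subsets of `range n` to the interval of
`p` and `q`. -/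
structure IsLatticeCube (G : SimpleGraph V) (p q : V) (n : ℕ) (f : Finset ℕ → V) : Prop where
  mem : ∀ A ⊆ Finset.range n, OnGeod G p q (f A)
  rank : ∀ A ⊆ Finset.range n, G.dist p (f A) = A.card
  adj : ∀ A ⊆ Finset.range n, ∀ i < n, i ∉ A → G.Adj (f A) (f (insert i A))
  ne : ∀ A ⊆ Finset.range n, ∀ i < n, ∀ j < n, i ≠ j → i ∉ A → j ∉ A →
    f (insert i A) ≠ f (insert j A)

namespace IsSwm

variable {G : SimpleGraph V}

/-- Elements of an interval with trivial meet are as far apart as possible. -/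
lemma dist_of_meet_eq (h : IsSwm G) {p q x u : V} (bx : OnGeod G p q x) (bu : OnGeod G p q u)
    (hm : ∀ z, OnGeod G p x z → OnGeod G p u z → z = p) :
    G.dist x u = G.dist p x + G.dist p u := by
  induction hn : G.dist p u using Nat.strong_induction_on generalizing u with
  | _ n ih =>
  subst hn
  have sub : ∀ c, G.Adj u c → G.dist p u = G.dist p c + 1 →
      OnGeod G p u c ∧ OnGeod G p q c ∧ ∀ z, OnGeod G p x z → OnGeod G p c z → z = p :=
    fun c uc lc => ⟨OnGeod.of_adj uc lc, bu.trans h (OnGeod.of_adj uc lc),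
      fun z h1 h2 => hm z h1 ((OnGeod.of_adj uc lc).trans h h2)⟩
  have t1 := h.tri x p u
  rw [dist_swap G x p] at t1
  by_cases h0 : G.dist p u = 0
  · have := h.eq_of_dist h0
    subst this
    rw [dist_swap G x p, h0, Nat.add_zero]
  obtain ⟨c, uc, lc⟩ := h.exists_pred (p := p) (q := u) (n := G.dist p u - 1) (by omega)
  obtain ⟨bc, bqc, mc⟩ := sub c uc (by omega)
  have ec := ih _ (by omega) bqc mc rfl
  have a1 := h.le_succ x uc
  have a2 := h.le_succ x uc.symm
  by_contra hne
  by_cases h1 : G.dist p u = 1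
  · obtain rfl : p = c := h.eq_of_dist (by omega)
    have h2 : G.dist x u + 1 ≠ G.dist p x := by
      intro e
      have := hm u (by
        unfold OnGeod
        omega) (by
        unfold OnGeod
        simp)
      subst this
      simp at h1
    obtain ⟨v, pv, uv, lv⟩ := h.tc x p u uc.symm (by omega) (by
      by_contra h3
      have h4 := h.eq_of_dist (a := x) (b := p) (by omega)
      have h5 := h.eq_of_dist (a := x) (b := u) (by omega)
      exact uc.ne (h5.symm.trans h4))
    have bv : OnGeod G p x v := by
      unfold OnGeod
      rw [dist_swap G p x, SimpleGraph.dist_eq_one_iff_adj.2 pv]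
      omega
    exact h.not_adj_of_onGeod (bx.trans h bv) bu
      (by rw [h1, SimpleGraph.dist_eq_one_iff_adj.2 pv]) uv.symm
  obtain ⟨c', cc, lc'⟩ := h.exists_pred (p := p) (q := c) (n := G.dist p c - 1) (by omega)
  have bc' : OnGeod G p c c' := OnGeod.of_adj cc (by omega)
  have ec' := ih (G.dist p c') (by omega) (bqc.trans h bc') (fun z h1 h2 =>
    mc z h1 (bc'.trans h h2)) rfl
  have uc' : G.dist u c' = 2 := by
    have h2 := h.dist_le_two uc cc
    have h3 := h.tri p c' u
    rw [dist_swap G c' u] at h3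
    omega
  have last : ∀ u', G.Adj u u' → G.Adj c' u' →
      G.dist x u' + 2 ≤ G.dist p x + G.dist p u → False := by
    intro u' uu' cu' l
    have l1 := h.le_succ p cu'.symm
    have l2 := h.le_succ p uu'
    obtain ⟨-, b1, b2⟩ := sub u' uu' (by omega)
    have := ih (G.dist p u') (by omega) b1 b2 rfl
    omega
  by_cases h2 : G.dist x u + 2 = G.dist p x + G.dist p u
  · obtain ⟨w, uw, cw, lw⟩ := h.exists_meet (p := x) uc.symm cc (by
      rintro rfl
      simp at uc') (by omega) (by omega)
    exact last w uw cw (by omega)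
  · obtain ⟨v, cv, uv, lv⟩ := h.tc x c u uc.symm (by omega) (by omega)
    have ncv : ¬ G.Adj c' v := fun a => h.k4 ⟨c, v, u, c', cv, uc.symm, cc, uv.symm, a.symm,
      by rintro rfl; simp at uc', fun b => by
        rw [SimpleGraph.dist_eq_one_iff_adj.2 b] at uc'; omega⟩
    have nc : c' ≠ v := by
      rintro rfl
      rw [SimpleGraph.dist_eq_one_iff_adj.2 uv] at uc'
      omega
    obtain ⟨w, cw, vw, lw⟩ := h.qc x c' v c cc cv (h.two_of nc ncv (h.dist_le_two cc.symm cv))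
      (by omega) (by omega)
    have uw : G.dist u w = 2 := by
      have h2 := h.dist_le_two uv vw
      have h3 := h.tri x w u
      rw [dist_swap G w u] at h3
      omega
    obtain ⟨u', wu', cu', lu'⟩ := h.tc u w c' cw.symm (by omega) (by omega)
    have l1 := h.le_succ x wu'.symm
    exact last u' (SimpleGraph.dist_eq_one_iff_adj.1 (by omega)) cu' (by omega)

end IsSwm

namespace IsLatticeCube

variable {G : SimpleGraph V} {p q : V} {n : ℕ} {f : Finset ℕ → V}

lemma onGeod_insert (c : IsLatticeCube G p q n f) {A : Finset ℕ}
    (hA : A ⊆ Finset.range n) {i : ℕ} (hi : i < n) (hiA : i ∉ A) :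
    OnGeod G p (f (insert i A)) (f A) := by
  refine OnGeod.of_adj (c.adj A hA i hi hiA).symm ?_
  rw [c.rank A hA, c.rank _ (Finset.insert_subset (Finset.mem_range.2 hi) hA),
    Finset.card_insert_of_notMem hiA]

lemma onGeod_of_subset (h : IsSwm G) (c : IsLatticeCube G p q n f) {A B : Finset ℕ}
    (hAB : A ⊆ B) (hB : B ⊆ Finset.range n) : OnGeod G p (f B) (f A) := by
  induction hk : (B \ A).card generalizing A with
  | zero =>
    rw [Finset.card_eq_zero, Finset.sdiff_eq_empty_iff_subset] at hk
    rw [hAB.antisymm hk]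
    unfold OnGeod
    simp
  | succ k ih =>
    obtain ⟨i, hi⟩ : (B \ A).Nonempty := Finset.card_pos.1 (by omega)
    obtain ⟨hiB, hiA⟩ := Finset.mem_sdiff.1 hi
    refine OnGeod.trans h (ih (Finset.insert_subset hiB hAB) ?_)
      (c.onGeod_insert (hAB.trans hB) (Finset.mem_range.1 (hB hiB)) hiA)
    rw [Finset.sdiff_insert, Finset.card_erase_of_mem hi, hk, Nat.add_sub_cancel]

lemma onGeod_of_insert (h : IsSwm G) (c : IsLatticeCube G p q n f) {A : Finset ℕ}
    (hA : A ⊆ Finset.range n) {i j : ℕ} (hi : i < n) (hj : j < n) (hij : i ≠ j) (hiA : i ∉ A)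
    (hjA : j ∉ A) {z : V} (bi : OnGeod G p (f (insert i A)) z)
    (bj : OnGeod G p (f (insert j A)) z) : OnGeod G p (f A) z := by
  have hi' := Finset.mem_range.2 hi
  have hj' := Finset.mem_range.2 hj
  have ri := c.rank _ (Finset.insert_subset hi' hA)
  have rj := c.rank _ (Finset.insert_subset hj' hA)
  have rij := c.rank _ (Finset.insert_subset hj' (Finset.insert_subset hi' hA))
  have hji : j ∉ insert i A := by simp [hjA, Ne.symm hij]
  have hij' : i ∉ insert j A := by simp [hiA, hij]
  rw [Finset.card_insert_of_notMem hiA] at ri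
  rw [Finset.card_insert_of_notMem hjA] at rj
  rw [Finset.card_insert_of_notMem hji, Finset.card_insert_of_notMem hiA] at rij
  refine h.meet_le (c.adj _ (Finset.insert_subset hi' hA) j hj hji).symm ?_
    (c.ne A hA i hi j hj hij hiA hjA) (by omega) (by omega) (c.adj A hA i hi hiA).symm
    (c.adj A hA j hj hjA).symm (by rw [c.rank A hA]; omega) bi bj
  rw [Finset.insert_comm]
  exact (c.adj _ (Finset.insert_subset hj' hA) i hi hij').symm

lemma onGeod_inter (h : IsSwm G) (c : IsLatticeCube G p q n f) {A B : Finset ℕ}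
    (hA : A ⊆ Finset.range n) (hB : B ⊆ Finset.range n) {z : V} (bA : OnGeod G p (f A) z)
    (bB : OnGeod G p (f B) z) : OnGeod G p (f (A ∩ B)) z := by
  have one : ∀ B ⊆ Finset.range n, OnGeod G p (f B) z → ∀ k, ∀ C ⊆ B,
      ∀ i < n, i ∉ B → (B \ C).card = k → OnGeod G p (f (insert i C)) z → OnGeod G p (f C) z := by
    intro B hB bB k
    induction k with
    | zero =>
      intro C hC i _ _ hk _
      rw [Finset.card_eq_zero, Finset.sdiff_eq_empty_iff_subset] at hk
      rwa [hC.antisymm hk]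
    | succ k ih =>
      intro C hC i hi hiB hk bi
      obtain ⟨j, hj⟩ : (B \ C).Nonempty := Finset.card_pos.1 (by omega)
      obtain ⟨hjB, hjC⟩ := Finset.mem_sdiff.1 hj
      have hjn := Finset.mem_range.1 (hB hjB)
      have hij : i ≠ j := by rintro rfl; exact hiB hjB
      have hiC : i ∉ C := fun a => hiB (hC a)
      refine c.onGeod_of_insert h (hC.trans hB) hi hjn hij hiC hjC bi
        (ih _ (Finset.insert_subset hjB hC) i hi hiB ?_ ?_)
      · rw [Finset.sdiff_insert, Finset.card_erase_of_mem hj, hk, Nat.add_sub_cancel]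
      · rw [Finset.insert_comm]
        refine OnGeod.trans h (c.onGeod_insert (Finset.insert_subset (Finset.mem_range.2 hi)
          (hC.trans hB)) hjn (by simp [hjC, hij.symm])) bi
  induction hk : (A \ B).card generalizing B with
  | zero =>
    rw [Finset.card_eq_zero, Finset.sdiff_eq_empty_iff_subset] at hk
    rwa [Finset.inter_eq_left.2 hk]
  | succ k ih =>
    obtain ⟨i, hi⟩ : (A \ B).Nonempty := Finset.card_pos.1 (by omega)
    obtain ⟨hiA, hiB⟩ := Finset.mem_sdiff.1 hi
    have hin := Finset.mem_range.1 (hA hiA)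
    have hB' := Finset.insert_subset (hA hiA) hB
    have bi : OnGeod G p (f (A ∩ insert i B)) z :=
      ih hB' (OnGeod.trans h (c.onGeod_insert hB hin hiB) bB)
        (by rw [Finset.sdiff_insert, Finset.card_erase_of_mem hi, hk, Nat.add_sub_cancel])
    rw [Finset.inter_insert_of_mem hiA] at bi
    exact one B hB bB _ _ Finset.inter_subset_right i hin hiB rfl bi

lemma dist_eq (h : IsSwm G) (c : IsLatticeCube G p q n f) {A B : Finset ℕ}
    (hA : A ⊆ Finset.range n) (hB : B ⊆ Finset.range n) :
    G.dist (f A) (f B) = (A \ B).card + (B \ A).card := by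
  have hm : A ∩ B ⊆ Finset.range n := Finset.inter_subset_left.trans hA
  have sA := c.onGeod_of_subset h (Finset.inter_subset_left (s₁ := A) (s₂ := B)) hA
  have sB := c.onGeod_of_subset h (Finset.inter_subset_right (s₁ := A) (s₂ := B)) hB
  have ra := c.rank A hA
  have rb := c.rank B hB
  have rm := c.rank _ hm
  have key := h.dist_of_meet_eq ((c.mem A hA).shift h sA) ((c.mem B hB).shift h sB) (by
    intro z h1 h2
    have up {C : Finset ℕ} (sC : OnGeod G p (f C) (f (A ∩ B)))
        (hz : OnGeod G (f (A ∩ B)) (f C) z) :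
        OnGeod G p (f C) z ∧ G.dist p (f (A ∩ B)) + G.dist (f (A ∩ B)) z = G.dist p z := by
      have := h.tri p (f (A ∩ B)) z
      have := h.tri p z (f C)
      unfold OnGeod at *
      rw [dist_swap G z] at *
      rw [dist_swap G (f C) (f (A ∩ B))] at *
      omega
    obtain ⟨zA, e⟩ := up sA h1
    have zm := c.onGeod_inter h hA hB zA (up sB h2).1
    unfold OnGeod at zm
    exact (h.eq_of_dist (by omega)).symm)
  unfold OnGeod at sA sB
  rw [dist_swap G (f A)] at sA
  rw [dist_swap G (f B)] at sB
  have c1 := Finset.card_sdiff_add_card_inter A B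
  have c2 := Finset.card_sdiff_add_card_inter B A
  rw [Finset.inter_comm B A] at c2
  omega

end IsLatticeCube

namespace SimpleGraph

lemma Reachable.exists_pred_dist {H : SimpleGraph V} {p q : V} {n : ℕ} (r : H.Reachable p q)
    (e : H.dist p q = n + 1) : ∃ y, H.Adj q y ∧ H.dist p y = n ∧ H.Reachable p y := by
  obtain ⟨w, hw⟩ := r.symm.exists_walk_length_eq_dist
  cases w with
  | nil => simp at e
  | @cons _ y _ a w =>
    refine ⟨y, a, ?_, w.reachable.symm⟩
    have h1 := dist_le w
    obtain ⟨w', hw'⟩ := w.reachable.symm.exists_walk_length_eq_dist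
    have h2 := dist_le (w'.concat a.symm)
    rw [Walk.length_concat] at h2
    rw [Walk.length_cons, dist_comm, e] at hw
    rw [dist_comm] at h1
    omega

lemma Reachable.dist_le_succ {H : SimpleGraph V} {p y q : V} (r : H.Reachable p y)
    (a : H.Adj y q) : H.dist p q ≤ H.dist p y + 1 := by
  obtain ⟨w, hw⟩ := r.exists_walk_length_eq_dist
  have h2 := dist_le (w.concat a)
  rw [Walk.length_concat] at h2
  omega

/-- The edges of `G` with both ends in `T`. -/
def inside (G : SimpleGraph V) (T : Set V) : SimpleGraph V where
  Adj a b := G.Adj a b ∧ a ∈ T ∧ b ∈ T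
  symm := ⟨fun _ _ e => ⟨e.1.symm, e.2.2, e.2.1⟩⟩
  loopless := ⟨fun _ e => e.1.ne rfl⟩

end SimpleGraph

/-- Every vertex has a gate in `S`. -/
def IsGated (G : SimpleGraph V) (S : Set V) : Prop :=
  ∀ x, ∃ g ∈ S, ∀ y ∈ S, G.dist x y = G.dist x g + G.dist g y

namespace IsGated

variable {G : SimpleGraph V}

lemma singleton (x : V) : IsGated G {x} := fun y => ⟨x, rfl, by rintro _ rfl; simp⟩

lemma univ : IsGated G Set.univ := fun x => ⟨x, trivial, by simp⟩

lemma mem_of_onGeod (hc : G.Connected) {S : Set V} (hS : IsGated G S) {s t v : V} (hs : s ∈ S)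
    (ht : t ∈ S) (b : OnGeod G s t v) : v ∈ S := by
  obtain ⟨g, hg, e⟩ := hS v
  unfold OnGeod at b
  have h1 := e s hs
  have h2 := e t ht
  have h3 : G.dist s t ≤ G.dist s g + G.dist g t := hc.dist_triangle
  rw [dist_swap G s v, dist_swap G t v] at b
  rw [dist_swap G s g] at h3
  have h4 : G.dist v g = 0 := by omega
  rwa [hc.dist_eq_zero_iff.1 h4]

lemma inter (hc : G.Connected) {S T : Set V} (hS : IsGated G S) (hT : IsGated G T)
    (ne : (S ∩ T).Nonempty) : IsGated G (S ∩ T) := by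
  intro x
  obtain ⟨z, zS, zT⟩ := ne
  obtain ⟨g, hg, e⟩ := hS x
  obtain ⟨k, hk, f⟩ := hT g
  have kS : k ∈ S := by
    refine hS.mem_of_onGeod hc hg zS ?_
    have := f z zT
    unfold OnGeod
    rw [dist_swap G z k]
    omega
  refine ⟨k, ⟨kS, hk⟩, fun y hy => ?_⟩
  have h1 := e y hy.1
  have h2 := f y hy.2
  have h3 := e k kS
  omega

lemma inter_three (hc : G.Connected) {S T U : Set V} (hS : IsGated G S) (hT : IsGated G T)
    (hU : IsGated G U) (h1 : (S ∩ T).Nonempty) (h2 : (S ∩ U).Nonempty)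
    (h3 : (T ∩ U).Nonempty) : ((S ∩ T) ∩ U).Nonempty := by
  obtain ⟨x, xS, xT⟩ := h1
  obtain ⟨y, yS, yU⟩ := h2
  obtain ⟨z, zT, zU⟩ := h3
  obtain ⟨g, hg, e⟩ := hU x
  have key {t : V} (tU : t ∈ U) : OnGeod G x t g := by
    have := e t tU
    unfold OnGeod
    rw [dist_swap G t g]
    omega
  exact ⟨g, ⟨hS.mem_of_onGeod hc xS yS (key yU), hT.mem_of_onGeod hc xT zT (key zU)⟩, hg⟩

lemma helly (hc : G.Connected) {ι : Type*} (S : ι → Set V) (hS : ∀ i, IsGated G (S i))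
    (s : Finset ι) (hp : ∀ i ∈ s, ∀ j ∈ s, (S i ∩ S j).Nonempty) :
    ∀ C, IsGated G C → (∀ i ∈ s, (C ∩ S i).Nonempty) → ∃ x ∈ C, ∀ i ∈ s, x ∈ S i := by
  classical
  induction s using Finset.induction_on with
  | empty =>
    intro C hC _
    obtain ⟨v⟩ := hc.nonempty
    obtain ⟨g, hg, _⟩ := hC v
    exact ⟨g, hg, by simp⟩
  | insert i s _ ih =>
    intro C hC hm
    have mi := Finset.mem_insert_self i s
    have ms {j} (hj : j ∈ s) : j ∈ insert i s := Finset.mem_insert_of_mem hj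
    obtain ⟨x, hx, hxs⟩ := ih (fun a ha b hb => hp a (ms ha) b (ms hb)) (C ∩ S i)
      (hC.inter hc (hS i) (hm i mi)) (fun j hj => inter_three hc hC (hS i) (hS j) (hm i mi)
        (hm j (ms hj)) (hp i mi j (ms hj)))
    refine ⟨x, hx.1, fun j hj => ?_⟩
    rcases Finset.mem_insert.1 hj with rfl | hj
    · exact hx.2
    · exact hxs j hj

/-- A connected set containing every vertex with two neighbours in the set is gated. -/
lemma of_closed (h : IsSwm G) {T : Set V} {s : V} (hs : s ∈ T)
    (hconn : ∀ y ∈ T, (G.inside T).Reachable s y)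
    (hcl : ∀ z y y', y ∈ T → y' ∈ T → y ≠ y' → G.Adj z y → G.Adj z y' → z ∈ T) :
    IsGated G T := by
  intro x
  obtain ⟨g, hg, hmin⟩ : ∃ g ∈ T, ∀ y ∈ T, G.dist x g ≤ G.dist x y := by
    have := WellFounded.has_min (InvImage.wf (G.dist x) (Nat.lt_wfRel.wf)) T ⟨s, hs⟩
    obtain ⟨g, hg, hm⟩ := this
    exact ⟨g, hg, fun y hy => not_lt.1 (hm y hy)⟩
  have reach : ∀ y ∈ T, (G.inside T).Reachable g y :=
    fun y hy => (hconn g hg).symm.trans (hconn y hy)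
  have key : ∀ n, ∀ y ∈ T, (G.inside T).dist g y = n → G.dist x y = G.dist x g + n := by
    intro n
    induction n using Nat.strong_induction_on with
    | _ n ih =>
    intro y hy e
    obtain _ | _ | n := n
    · rw [(reach y hy).dist_eq_zero_iff] at e
      simp [e]
    · have gy : G.Adj g y := (SimpleGraph.dist_eq_one_iff_adj.1 e).1
      have h1 := hmin y hy
      have h2 := h.le_succ x gy.symm
      by_contra hne
      have h3 : 1 ≤ G.dist x g := by
        by_contra h0
        exact gy.ne ((h.eq_of_dist (a := x) (by omega)).symm.trans
          (h.eq_of_dist (a := x) (by omega)))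
      obtain ⟨z, gz, yz, lz⟩ := h.tc x g y gy (by omega) h3
      have := hmin z (hcl z g y hg hy gy.ne gz.symm yz.symm)
      omega
    · obtain ⟨y', yy', e', r'⟩ := (reach y hy).exists_pred_dist e
      obtain ⟨y'', yy'', e'', r''⟩ := r'.exists_pred_dist e'
      have l' := ih _ (by omega) y' yy'.2.2 e'
      have l'' := ih _ (by omega) y'' yy''.2.2 e''
      have sub : ∀ z ∈ T, G.Adj y' z → G.dist x z = G.dist x g + n →
          (G.inside T).dist g z ≠ n + 2 := by
        intro z hz yz lz ez
        obtain ⟨w, zw, yw, lw⟩ := h.exists_meet (p := x) yz yy''.1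
          (by rintro rfl; omega) (by omega) (by omega)
        have hw : w ∈ T := hcl w z y'' hz yy''.2.2 (by rintro rfl; omega) zw.symm yw.symm
        have h1 := (reach w hw).dist_le_succ (q := z) ⟨zw.symm, hw, hz⟩
        have h2 := r''.dist_le_succ (q := w) ⟨yw, yy''.2.2, hw⟩
        have := ih (n + 1) (by omega) w hw (by omega)
        omega
      have h1 := h.le_succ x yy'.1
      have h2 := h.le_succ x yy'.1.symm
      have h3 : G.dist x y ≠ G.dist x g + n := fun c => sub y hy yy'.1.symm c e
      by_contra hne
      obtain ⟨z, yz, yz', lz⟩ := h.tc x y y' yy'.1 (by omega) (by omega)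
      have hz : z ∈ T := hcl z y y' hy yy'.2.2 yy'.1.ne yz.symm yz'.symm
      have h4 := r'.dist_le_succ (q := z) ⟨yz', yy'.2.2, hz⟩
      have h5 := (reach z hz).dist_le_succ (q := y) ⟨yz.symm, hz, hy⟩
      have h6 := sub z hz yz' (by omega)
      have := ih (n + 1) (by omega) z hz (by omega)
      omega
  refine ⟨g, hg, fun y hy => ?_⟩
  have h1 := key _ y hy rfl
  have h2 := h.tri x g y
  obtain ⟨w, hw⟩ := (reach y hy).exists_walk_length_eq_dist
  have h3 : G.inside T ≤ G := fun a b e => e.1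
  have h4 := SimpleGraph.dist_le (w.mapLe h3)
  simp only [SimpleGraph.Walk.length_map] at h4
  omega

/-- The relatively complemented neighbourhood of a gated set is gated. -/
lemma relCompl_nhd (h : IsSwm G) {S : Set V} (hS : IsGated G S) :
    IsGated G {z | ∃ g ∈ S, RelCompl G g z} := by
  set T := {z | ∃ g ∈ S, RelCompl G g z} with hT
  have hST : S ⊆ T := fun s hs => ⟨s, hs, RelCompl.of_le_one (by simp)⟩
  obtain ⟨v⟩ := h.conn.nonempty
  obtain ⟨s, hs, -⟩ := hS v
  refine of_closed h (hST hs) ?_ ?_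
  · have h1 : ∀ n, ∀ y ∈ S, G.dist s y = n → (G.inside T).Reachable s y := by
      intro n
      induction n with
      | zero => intro y _ e; rw [h.eq_of_dist e]
      | succ n ih =>
        intro y hy e
        obtain ⟨x, yx, lx⟩ := h.exists_pred e
        have hx : x ∈ S := hS.mem_of_onGeod h.conn hs hy (OnGeod.of_adj yx (by omega))
        exact (ih x hx lx).trans
          (SimpleGraph.Adj.reachable (⟨yx.symm, hST hx, hST hy⟩ : (G.inside T).Adj x y))
    have h2 : ∀ n, ∀ g ∈ S, ∀ z, RelCompl G g z → G.dist g z = n →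
        (G.inside T).Reachable g z := by
      intro n
      induction n with
      | zero => intro g _ z _ e; rw [h.eq_of_dist e]
      | succ n ih =>
        intro g hg z r e
        obtain ⟨x, zx, lx⟩ := h.exists_pred e
        have rx := r.pred h zx (by omega)
        exact (ih g hg x rx lx).trans (SimpleGraph.Adj.reachable
          (⟨zx.symm, ⟨g, hg, rx⟩, ⟨g, hg, r⟩⟩ : (G.inside T).Adj x z))
    rintro y ⟨g, hg, r⟩
    exact (h1 _ g hg rfl).trans (h2 _ g hg y r rfl)
  · intro z y y' hy hy' ne zy zy'
    obtain ⟨g, hg, e⟩ := hS z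
    have step : ∀ y ∈ T, G.Adj z y →
        RelCompl G g z ∨ (RelCompl G g y ∧ G.dist g z = G.dist g y + 1) := by
      rintro y ⟨g₀, hg₀, r₀⟩ zy
      obtain ⟨k, hk, f⟩ := hS y
      have r : RelCompl G k y := by
        refine r₀.right h ?_
        have := f g₀ hg₀
        unfold OnGeod
        rw [dist_swap G g₀ k, dist_swap G g₀ y]
        omega
      have f1 := f g hg
      have e1 := e k hk
      have a1 := h.le_succ g zy
      have a2 := h.le_succ g zy.symm
      have a3 := h.le_succ k zy
      have a4 := h.le_succ k zy.symm
      rw [dist_swap G y, dist_swap G y, dist_swap G k g] at f1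
      rw [dist_swap G z, dist_swap G z] at e1
      by_cases hgk : G.dist g k = 0
      · obtain rfl := h.eq_of_dist hgk
        rcases lt_trichotomy (G.dist g y) (G.dist g z) with lt | eq | gt
        · exact Or.inr ⟨r, by omega⟩
        · exact Or.inl (r.of_adj_same h zy.symm eq)
        · exact Or.inl (r.pred h zy.symm (by omega))
      · have gk : G.Adj g k := SimpleGraph.dist_eq_one_iff_adj.1 (by omega)
        exact Or.inl (r.of_rectangle h gk zy.symm (by omega) (by omega) (by omega))
    rcases step y hy zy with r | ⟨r, l⟩
    · exact ⟨g, hg, r⟩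
    rcases step y' hy' zy' with r' | ⟨r', l'⟩
    · exact ⟨g, hg, r'⟩
    exact ⟨g, hg, RelCompl.of_preds h zy zy' ne l l' r r'⟩

end IsGated

/-- `t` covers `x` in the interval of `p` and `q`, and `t` is above `a`. -/
structure IsLift (G : SimpleGraph V) (p q a x t : V) : Prop where
  adj : G.Adj x t
  rank : G.dist p t = G.dist p x + 1
  mem : OnGeod G p q t
  above : OnGeod G p t a

namespace IsLift

variable {G : SimpleGraph V} {p q y a x t : V}

lemma step (h : IsSwm G) (bqy : OnGeod G p q y) (na : ¬ OnGeod G p y a)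
    (l : IsLift G p q a x t) {x' : V} (xx : G.Adj x x') (r : G.dist p x' = G.dist p x + 1)
    (b : OnGeod G p y x') : ∃ t', IsLift G p q a x' t' ∧ G.Adj t t' := by
  have bx' := bqy.trans h b
  have bx := bx'.trans h (OnGeod.of_adj xx.symm r)
  have ne : x' ≠ t := by
    rintro rfl
    exact na (b.trans h l.above)
  have l1 := l.rank
  have l2 := l.mem
  unfold OnGeod at bx bx' l2
  obtain ⟨t', a1, a2, e⟩ := h.exists_meet (p := q) xx l.adj ne (by omega) (by omega)
  have h1 := h.tri p t' q
  have h2 := h.le_succ p a1.symm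
  rw [dist_swap G t' q] at h1
  refine ⟨t', ⟨a1, by omega, ?_, ?_⟩, a2⟩
  · unfold OnGeod
    omega
  · exact (OnGeod.of_adj a2.symm (by omega)).trans h l.above

lemma exists_of_onGeod (h : IsSwm G) (bqy : OnGeod G p q y) (pa : G.Adj p a)
    (qa : OnGeod G p q a) (na : ¬ OnGeod G p y a) (b : OnGeod G p y x) :
    ∃ t, IsLift G p q a x t := by
  induction hn : G.dist p x generalizing x with
  | zero =>
    obtain rfl := h.eq_of_dist hn
    refine ⟨a, pa, ?_, qa, ?_⟩
    · rw [hn, SimpleGraph.dist_eq_one_iff_adj.2 pa]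
    · unfold OnGeod
      simp
  | succ n ih =>
    obtain ⟨w, xw, lw⟩ := h.exists_pred hn
    obtain ⟨t, ht⟩ := ih (b.trans h (OnGeod.of_adj xw (by omega))) lw
    obtain ⟨t', ht', -⟩ := ht.step h bqy na xw.symm (by omega) b
    exact ⟨t', ht'⟩

lemma eq_of_isLift (h : IsSwm G) (na : ¬ OnGeod G p y a) (b : OnGeod G p y x)
    (l : IsLift G p q a x t) {t' : V} (l' : IsLift G p q a x t') : t = t' := by
  by_contra ne
  have e1 := l.rank
  have e2 := l'.rank
  have m1 := l.mem
  have m2 := l'.mem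
  have h1 := h.tri p x q
  have h2 := h.le_succ q l.adj
  rw [dist_swap G x q] at h1
  unfold OnGeod at m1 m2
  obtain ⟨m, a1, a2, e⟩ := h.exists_meet (p := q) l.adj l'.adj ne (by omega) (by omega)
  have h3 := h.tri p m q
  have h4 := h.le_succ p a1.symm
  rw [dist_swap G m q] at h3
  exact na (b.trans h (h.meet_le a1.symm a2.symm ne (by omega) (by omega) l.adj.symm
    l'.adj.symm (by omega) l.above l'.above))

lemma adj_of_adj (h : IsSwm G) (bqy : OnGeod G p q y) (na : ¬ OnGeod G p y a)
    (l : IsLift G p q a x t) {x' t' : V} (l' : IsLift G p q a x' t') (xx : G.Adj x x')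
    (r : G.dist p x' = G.dist p x + 1) (b : OnGeod G p y x') : G.Adj t t' := by
  obtain ⟨s, ls, ts⟩ := l.step h bqy na xx r b
  rwa [l'.eq_of_isLift h na b ls]

lemma base_unique (h : IsSwm G) (bqy : OnGeod G p q y) (na : ¬ OnGeod G p y a)
    (b : OnGeod G p y x) {x' : V} (b' : OnGeod G p y x')
    (l : IsLift G p q a x t) (l' : IsLift G p q a x' t) : x = x' := by
  by_contra ne
  have e1 := l.rank
  have e2 := l'.rank
  have m1 := l.mem
  have bx := bqy.trans h b
  have bx' := bqy.trans h b'
  obtain ⟨m, a1, a2, e⟩ := h.exists_meet (p := p) l.adj.symm l'.adj.symm ne (by omega)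
    (by omega)
  have h1 := h.tri p m q
  have h2 := h.le_succ q a1.symm
  rw [dist_swap G m q] at h1
  have key : OnGeod G q t y := by
    unfold OnGeod at m1 bx bx'
    exact h.meet_le a1.symm a2.symm ne (by omega) (by omega) l.adj l'.adj (by omega)
      (bqy.shift h b).symm (bqy.shift h b').symm
  refine na (OnGeod.trans h (y := t) ?_ l.above)
  unfold OnGeod at *
  rw [dist_swap G y t]
  omega

end IsLift

namespace RelCompl

variable {G : SimpleGraph V} {p q y : V}

lemma exists_compl_atom (h : IsSwm G) (r : RelCompl G p q) (qy : G.Adj q y)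
    (l : G.dist p q = G.dist p y + 1) :
    ∃ a, G.Adj p a ∧ OnGeod G p q a ∧ ¬ OnGeod G p y a := by
  induction hn : G.dist p y generalizing q y with
  | zero =>
    obtain rfl := h.eq_of_dist hn
    refine ⟨q, qy.symm, ?_, fun b => ?_⟩
    · unfold OnGeod
      simp
    · unfold OnGeod at b
      rw [SimpleGraph.dist_eq_one_iff_adj.2 qy.symm] at b
      simp at b
  | succ n ih =>
    obtain ⟨v, yv, lv⟩ := h.exists_pred hn
    obtain ⟨y', ne, vy', qy', ly'⟩ := r.exists_ne h qy yv (by omega)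
    obtain ⟨a, pa, ba, na⟩ := ih (r.pred h qy' (by omega)) vy'.symm ly' lv
    exact ⟨a, pa, (OnGeod.of_adj qy' (by omega)).trans h ba, fun hy =>
      na (h.meet_le qy qy' ne.symm (by omega) l yv vy'.symm (by omega) hy ba)⟩

lemma exists_isLatticeCube (h : IsSwm G) {n : ℕ} (r : RelCompl G p q) (hn : G.dist p q = n) :
    ∃ f, IsLatticeCube G p q n f := by
  induction n generalizing q with
  | zero =>
    obtain rfl := h.eq_of_dist hn
    refine ⟨fun _ => p, ⟨fun A _ => ?_, fun A hA => ?_, fun A _ i hi => ?_, fun A _ i hi => ?_⟩⟩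
    · unfold OnGeod
      simp
    · rw [Finset.range_zero, Finset.subset_empty] at hA
      simp [hA]
    · omega
    · omega
  | succ n ih =>
    obtain ⟨y, qy, ly⟩ := h.exists_pred hn
    obtain ⟨a, pa, qa, na⟩ := r.exists_compl_atom h qy (by omega)
    have bqy : OnGeod G p q y := OnGeod.of_adj qy (by omega)
    obtain ⟨f, c⟩ := ih (r.pred h qy (by omega)) ly
    have hJ : ∀ x, ∃ t, OnGeod G p y x → IsLift G p q a x t := fun x => by
      by_cases b : OnGeod G p y x
      · obtain ⟨t, ht⟩ := IsLift.exists_of_onGeod h bqy pa qa na b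
        exact ⟨t, fun _ => ht⟩
      · exact ⟨x, fun b' => absurd b' b⟩
    choose J hJ using hJ
    have er : ∀ {A : Finset ℕ}, A ⊆ Finset.range (n + 1) → A.erase n ⊆ Finset.range n := by
      intro A hA i hi
      have := Finset.mem_range.1 (hA (Finset.mem_of_mem_erase hi))
      have := Finset.ne_of_mem_erase hi
      exact Finset.mem_range.2 (by omega)
    have er' : ∀ {A : Finset ℕ}, A ⊆ Finset.range (n + 1) → n ∉ A → A ⊆ Finset.range n := by
      intro A hA hn
      have := er hA
      rwa [Finset.erase_eq_of_notMem hn] at this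
    have lift : ∀ {A : Finset ℕ}, A ⊆ Finset.range n → IsLift G p q a (f A) (J (f A)) :=
      fun hA => hJ _ (c.mem _ hA)
    refine ⟨fun A => if n ∈ A then J (f (A.erase n)) else f A, ⟨fun A hA => ?_, fun A hA => ?_,
      fun A hA i hi hiA => ?_, fun A hA i hi j hj hij hiA hjA => ?_⟩⟩
    · by_cases hnA : n ∈ A
      · simp only [hnA, if_true]
        exact (lift (er hA)).mem
      · simp only [hnA, if_false]
        exact bqy.trans h (c.mem _ (er' hA hnA))
    · by_cases hnA : n ∈ A
      · simp only [hnA, if_true]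
        rw [(lift (er hA)).rank, c.rank _ (er hA), Finset.card_erase_add_one hnA]
      · simp only [hnA, if_false]
        exact c.rank _ (er' hA hnA)
    · by_cases hnA : n ∈ A
      · have hin : i ≠ n := by rintro rfl; exact hiA hnA
        have hiA' : i ∉ A.erase n := fun b => hiA (Finset.mem_of_mem_erase b)
        have hi' : i < n := by omega
        have hs := Finset.insert_subset (Finset.mem_range.2 hi') (er hA)
        simp only [hnA, if_true, Finset.mem_insert_of_mem hnA]
        rw [Finset.erase_insert_of_ne hin]
        refine (lift (er hA)).adj_of_adj h bqy na (lift hs) (c.adj _ (er hA) i hi' hiA') ?_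
          (c.mem _ hs)
        rw [c.rank _ hs, c.rank _ (er hA), Finset.card_insert_of_notMem hiA']
      · by_cases hin : i = n
        · subst hin
          simp only [hnA, if_false, Finset.mem_insert_self, if_true]
          rw [Finset.erase_insert hnA]
          exact (lift (er' hA hnA)).adj
        · simp only [hnA, if_false, Finset.mem_insert, or_false, Ne.symm hin]
          exact c.adj _ (er' hA hnA) i (by omega) hiA
    · have mixed : ∀ i, i < n → i ∉ A → n ∉ A → f (insert i A) ≠ J (f A) := by
        intro i hi hiA hnA e
        have hA' := er' hA hnA
        exact na ((c.mem _ (Finset.insert_subset (Finset.mem_range.2 hi) hA')).trans h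
          (e ▸ (lift hA').above))
      by_cases hnA : n ∈ A
      · have hin : i ≠ n := by rintro rfl; exact hiA hnA
        have hjn : j ≠ n := by rintro rfl; exact hjA hnA
        simp only [if_true, Finset.mem_insert_of_mem hnA]
        rw [Finset.erase_insert_of_ne hin, Finset.erase_insert_of_ne hjn]
        have hsi := Finset.insert_subset (Finset.mem_range.2 (by omega : i < n)) (er hA)
        have hsj := Finset.insert_subset (Finset.mem_range.2 (by omega : j < n)) (er hA)
        intro e
        refine c.ne _ (er hA) i (by omega) j (by omega) hij
          (fun b => hiA (Finset.mem_of_mem_erase b)) (fun b => hjA (Finset.mem_of_mem_erase b)) ?_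
        exact (lift hsi).base_unique h bqy na (c.mem _ hsi) (c.mem _ hsj) (e ▸ lift hsj)
      · by_cases hin : i = n
        · subst hin
          simp only [hnA, if_false, Finset.mem_insert, or_false, if_true, hij]
          rw [Finset.erase_insert hnA]
          exact (mixed j (by omega) hjA hnA).symm
        · by_cases hjn : j = n
          · subst hjn
            simp only [hnA, if_false, Finset.mem_insert, or_false, if_true, hij.symm]
            rw [Finset.erase_insert hnA]
            exact mixed i (by omega) hiA hnA
          · simp only [hnA, if_false, Finset.mem_insert, or_false, Ne.symm hin, Ne.symm hjn]
            exact c.ne _ (er' hA hnA) i (by omega) j (by omega) hij hiA hjA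

end RelCompl

lemma IsLatticeCube.booleanPair {G : SimpleGraph V} {p q : V} (h : IsSwm G)
    {f : Finset ℕ → V} (c : IsLatticeCube G p q (G.dist p q) f) : BooleanPair G p q := by
  have sub : ∀ A : Fin (G.dist p q) → Bool,
      (Finset.univ.filter fun i => A i).map Fin.valEmbedding ⊆ Finset.range (G.dist p q) := by
    intro A i hi
    obtain ⟨j, -, rfl⟩ := Finset.mem_map.1 hi
    exact Finset.mem_range.2 j.2
  refine ⟨fun A => f ((Finset.univ.filter fun i => A i).map Fin.valEmbedding), fun A => ?_,
    fun A B => ?_⟩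
  · have := c.mem _ (sub A)
    unfold OnGeod at this
    rwa [dist_swap G q] at this
  · simp only
    rw [c.dist_eq h (sub A) (sub B), ← Finset.map_sdiff, ← Finset.map_sdiff, Finset.card_map,
      Finset.card_map, ← Finset.card_union_of_disjoint disjoint_sdiff_sdiff]
    congr 1
    ext i
    simp only [Finset.mem_union, Finset.mem_sdiff, Finset.mem_filter, Finset.mem_univ, true_and]
    cases A i <;> cases B i <;> simp

section Hamming

variable {ι : Type*} [Fintype ι]

lemma hammingDist_update_not [DecidableEq ι] {A B : ι → Bool} {i : ι} (hi : A i ≠ B i) :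
    hammingDist A (Function.update B i (!B i)) + 1 = hammingDist A B := by
  unfold hammingDist
  rw [← Finset.card_erase_add_one (s := Finset.univ.filter fun j => A j ≠ B j) (a := i)
    (by simpa using hi)]
  congr 2
  ext j
  by_cases hj : j = i
  · subst hj
    have : A j = !B j := by
      revert hi
      cases A j <;> cases B j <;> simp
    simp [this]
  · simp [hj]

lemma exists_ne_of_hammingDist_pos {A B : ι → Bool} (l : 0 < hammingDist A B) :
    ∃ i, A i ≠ B i := by
  obtain ⟨i, hi⟩ := Finset.card_pos.1 l
  exact ⟨i, (Finset.mem_filter.1 hi).2⟩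

end Hamming

namespace BooleanPair

variable {G : SimpleGraph V} {p q : V} {k : ℕ} {f : (Fin k → Bool) → V}

lemma adj_update (hd : ∀ A B, G.dist (f A) (f B) = hammingDist A B) (B : Fin k → Bool)
    (i : Fin k) : G.Adj (f B) (f (Function.update B i (!B i))) := by
  rw [SimpleGraph.adj_comm, ← SimpleGraph.dist_eq_one_iff_adj, hd,
    ← hammingDist_update_not (i := i) (by simp), hammingDist_self]

lemma injective (hd : ∀ A B, G.dist (f A) (f B) = hammingDist A B) {A B : Fin k → Bool}
    (e : f A = f B) : A = B := by
  rw [← hammingDist_eq_zero, ← hd, e, SimpleGraph.dist_self]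

lemma dist_eq_of_minimal (h : IsSwm G) (hm : ∀ A, OnGeod G p q (f A))
    (hd : ∀ A B, G.dist (f A) (f B) = hammingDist A B) {A₀ : Fin k → Bool}
    (h0 : ∀ A, G.dist p (f A₀) ≤ G.dist p (f A)) (B : Fin k → Bool) :
    G.dist p (f B) = G.dist p (f A₀) + hammingDist A₀ B := by
  induction hn : hammingDist A₀ B using Nat.strong_induction_on generalizing B with
  | _ n ih =>
  by_cases hz : n = 0
  · subst hz
    rw [hammingDist_eq_zero.1 hn, Nat.add_zero]
  obtain ⟨i, hi⟩ := exists_ne_of_hammingDist_pos (A := A₀) (B := B) (by omega)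
  set B₁ := Function.update B i (!B i) with hB₁
  have e1 := hammingDist_update_not hi
  rw [← hB₁] at e1
  have l1 := ih _ (by omega) B₁ rfl
  have a1 := adj_update hd B i
  rw [← hB₁] at a1
  have u1 := h.le_succ p a1
  have u2 := h.le_succ p a1.symm
  have n1 : G.dist p (f B) ≠ G.dist p (f B₁) := fun e => h.not_adj_of_onGeod (hm B) (hm B₁) e a1
  by_contra hne
  have l : G.dist p (f B) + 1 = G.dist p (f B₁) := by omega
  have hmin := h0 B
  obtain ⟨j, hj⟩ := exists_ne_of_hammingDist_pos (A := A₀) (B := B₁) (by omega)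
  have hij : j ≠ i := by
    rintro rfl
    rw [hB₁, Function.update_self] at hj
    revert hi hj
    cases A₀ j <;> cases B j <;> simp
  have hj' : A₀ j ≠ B j := by rwa [hB₁, Function.update_of_ne hij] at hj
  set B₂ := Function.update B j (!B j) with hB₂
  set B₃ := Function.update B₁ j (!B₁ j) with hB₃
  have e2 := hammingDist_update_not hj'
  have e3 := hammingDist_update_not hj
  rw [← hB₂] at e2
  rw [← hB₃] at e3
  have l2 := ih _ (by omega) B₂ rfl
  have l3 := ih _ (by omega) B₃ rfl
  have a2 := adj_update hd B j
  have a3 := adj_update hd B₁ j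
  have a4 := adj_update hd B₂ i
  have c : Function.update B₂ i (!B₂ i) = B₃ := by
    rw [hB₂, hB₃, hB₁, Function.update_of_ne hij.symm, Function.update_of_ne hij,
      Function.update_comm hij]
  rw [c] at a4
  rw [← hB₂] at a2
  rw [← hB₃] at a3
  have n12 : f B₁ ≠ f B₂ := by
    intro e
    have := congrFun (injective hd e) i
    rw [hB₁, hB₂, Function.update_self, Function.update_of_ne hij.symm] at this
    simp at this
  have n03 : f B ≠ f B₃ := by
    intro e
    have := congrFun (injective hd e) j
    rw [hB₃, Function.update_self, hB₁, Function.update_of_ne hij] at this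
    simp at this
  have m0 := hm B
  have m1 := hm B₁
  have m2 := hm B₂
  unfold OnGeod at m0 m1 m2
  obtain ⟨m, b1, b2, em⟩ := h.exists_meet (p := q) a1 a2 n12 (by omega) (by omega)
  have t1 := h.tri p m q
  have t2 := h.le_succ p b1.symm
  rw [dist_swap G m q] at t1
  exact n03 (h.meet_unique (p := p) b1.symm b2.symm n12 (by omega) (by omega) a1.symm a2.symm
    (by omega) a3 a4 (by omega))

lemma relCompl (h : IsSwm G) (b : BooleanPair G p q) : RelCompl G p q := by
  obtain ⟨f, hm, hd⟩ := b
  have hm' : ∀ A, OnGeod G p q (f A) := fun A => by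
    have : G.dist p (f A) + G.dist (f A) q = G.dist p q := hm A
    unfold OnGeod
    rwa [dist_swap G q]
  obtain ⟨A₀, h0⟩ := Finite.exists_min fun A => G.dist p (f A)
  have lev := dist_eq_of_minimal h hm' hd h0
  have top : hammingDist A₀ (fun i => !A₀ i) = G.dist p q := by
    simp [hammingDist]
  have l1 := lev fun i => !A₀ i
  have m1 := hm' fun i => !A₀ i
  unfold OnGeod at m1
  have e : q = f fun i => !A₀ i := h.eq_of_dist (by omega)
  have main : ∀ n, ∀ B, hammingDist A₀ B = n → RelCompl G p (f B) := by
    intro n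
    induction n with
    | zero =>
      intro B hB
      have := lev B
      exact RelCompl.of_le_one (by omega)
    | succ n ih =>
      intro B hB
      obtain ⟨i, hi⟩ := exists_ne_of_hammingDist_pos (A := A₀) (B := B) (by omega)
      have e1 := hammingDist_update_not hi
      have k1 := lev B
      have k2 := lev (Function.update B i (!B i))
      by_cases hn : n = 0
      · exact RelCompl.of_le_one (by omega)
      obtain ⟨j, hj⟩ := exists_ne_of_hammingDist_pos (A := A₀)
        (B := Function.update B i (!B i)) (by omega)
      have hij : j ≠ i := by
        rintro rfl
        rw [Function.update_self] at hj
        revert hi hj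
        cases A₀ j <;> cases B j <;> simp
      have hj' : A₀ j ≠ B j := by rwa [Function.update_of_ne hij] at hj
      have e2 := hammingDist_update_not hj'
      have k3 := lev (Function.update B j (!B j))
      refine RelCompl.of_preds h (adj_update hd B i) (adj_update hd B j) (fun e => ?_) (by omega)
        (by omega) (ih _ (by omega)) (ih _ (by omega))
      have := congrFun (injective hd e) i
      rw [Function.update_self, Function.update_of_ne hij.symm] at this
      simp at this
  rw [e]
  exact main _ _ rfl

end BooleanPair

lemma RelCompl.booleanPair {G : SimpleGraph V} {p q : V} (h : IsSwm G) (r : RelCompl G p q) :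
    BooleanPair G p q := by
  obtain ⟨f, c⟩ := r.exists_isLatticeCube h rfl
  exact c.booleanPair h

namespace IsSwm

variable {G : SimpleGraph V}

lemma thickening_adj (h : IsSwm G) {p q : V} :
    (thickening G).Adj p q ↔ p ≠ q ∧ RelCompl G p q := by
  rw [thickening, SimpleGraph.fromRel_adj]
  refine and_congr_right fun _ => ⟨?_, fun r => Or.inl (r.booleanPair h)⟩
  rintro (b | b)
  · exact b.relCompl h
  · exact (b.relCompl h).symm

lemma thickening_connected (h : IsSwm G) : (thickening G).Connected :=
  h.conn.mono fun _ _ e => h.thickening_adj.2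
    ⟨e.ne, RelCompl.of_le_one (SimpleGraph.dist_eq_one_iff_adj.2 e).le⟩

lemma thickening_ball_succ (h : IsSwm G) (x : V) (r : ℕ) :
    {z | (thickening G).dist x z ≤ r + 1} =
      {z | ∃ g ∈ {g | (thickening G).dist x g ≤ r}, RelCompl G g z} := by
  ext z
  simp only [Set.mem_ofPred_eq]
  constructor
  · intro l
    by_cases l' : (thickening G).dist x z ≤ r
    · exact ⟨z, l', RelCompl.of_le_one (by simp)⟩
    · obtain ⟨g, zg, lg, -⟩ := (h.thickening_connected.preconnected x z).exists_pred_dist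
        (n := r) (by omega)
      exact ⟨g, lg.le, (h.thickening_adj.1 zg).2.symm⟩
  · rintro ⟨g, lg, rg⟩
    by_cases e : g = z
    · subst e
      omega
    · have := (h.thickening_connected.preconnected x g).dist_le_succ
        (h.thickening_adj.2 ⟨e, rg⟩)
      omega

lemma thickening_ball_zero (h : IsSwm G) (x : V) :
    {z | (thickening G).dist x z ≤ 0} = {x} := by
  ext z
  simp only [Set.mem_ofPred_eq, Nat.le_zero, h.thickening_connected.dist_eq_zero_iff,
    Set.mem_singleton_iff]
  exact eq_comm

lemma isGated_thickening_ball (h : IsSwm G) (x : V) (r : ℕ) :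
    IsGated G {z | (thickening G).dist x z ≤ r} := by
  induction r with
  | zero =>
    rw [h.thickening_ball_zero]
    exact IsGated.singleton x
  | succ r ih =>
    rw [h.thickening_ball_succ]
    exact IsGated.relCompl_nhd h ih

lemma finite_ball (h : IsSwm G) (hf : ∀ v, (G.neighborSet v).Finite) (x : V) (n : ℕ) :
    {z | G.dist x z ≤ n}.Finite := by
  induction n with
  | zero =>
    refine (Set.finite_singleton x).subset fun z hz => ?_
    exact (h.eq_of_dist (Nat.le_zero.1 hz)).symm
  | succ n ih =>
    refine (ih.union (ih.biUnion fun y _ => hf y)).subset fun z (hz : G.dist x z ≤ n + 1) => ?_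
    by_cases l : G.dist x z ≤ n
    · exact Or.inl l
    · obtain ⟨y, zy, ly⟩ := h.exists_pred (p := x) (q := z) (n := n) (by omega)
      exact Or.inr (Set.mem_biUnion (x := y) ly.le zy.symm)

lemma dist_le_of_relCompl (h : IsSwm G) {g z : V} (hf : (G.neighborSet g).Finite)
    (r : RelCompl G g z) : G.dist g z ≤ (G.neighborSet g).ncard := by
  obtain ⟨f, c⟩ := r.exists_isLatticeCube h rfl
  have e0 : f ∅ = g := (h.eq_of_dist (by simpa using c.rank ∅ (by simp))).symm
  have := Set.ncard_le_ncard_of_injOn (s := (Finset.range (G.dist g z) : Set ℕ))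
    (t := G.neighborSet g) (fun i => f {i}) (fun i hi => ?_) (fun i hi j hj e => ?_) hf
  · rwa [Set.ncard_coe_finset, Finset.card_range] at this
  · have := c.adj ∅ (by simp) i (by simpa using hi) (by simp)
    rwa [e0] at this
  · by_contra ne
    exact c.ne ∅ (by simp) i (by simpa using hi) j (by simpa using hj) ne (by simp) (by simp) e

lemma finite_thickening_ball (h : IsSwm G) (hf : ∀ v, (G.neighborSet v).Finite) (x : V)
    (r : ℕ) : {z | (thickening G).dist x z ≤ r}.Finite := by
  induction r with
  | zero =>
    rw [h.thickening_ball_zero]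
    exact Set.finite_singleton x
  | succ r ih =>
    rw [h.thickening_ball_succ]
    refine (ih.biUnion fun g _ => h.finite_ball hf g (G.neighborSet g).ncard).subset ?_
    rintro z ⟨g, hg, rg⟩
    exact Set.mem_biUnion hg (h.dist_le_of_relCompl (hf g) rg)

lemma finite_helly (h : IsSwm G) {ι : Type*} (s : Finset ι) (c : ι → V) (r : ι → ℕ)
    (hp : ∀ i ∈ s, ∀ j ∈ s, ∃ x,
      (thickening G).dist (c i) x ≤ r i ∧ (thickening G).dist (c j) x ≤ r j) :
    ∃ x, ∀ i ∈ s, (thickening G).dist (c i) x ≤ r i := by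
  obtain ⟨x, -, hx⟩ := IsGated.helly h.conn (fun i => {z | (thickening G).dist (c i) z ≤ r i})
    (fun i => h.isGated_thickening_ball _ _) s hp Set.univ IsGated.univ fun i hi => by
      obtain ⟨x, hx, -⟩ := hp i hi i hi
      exact ⟨x, trivial, hx⟩
  exact ⟨x, hx⟩

lemma helly (h : IsSwm G) (hf : ∀ v, (G.neighborSet v).Finite) {ι : Type*} (c : ι → V)
    (r : ι → ℕ) (hp : ∀ i j, ∃ x,
      (thickening G).dist (c i) x ≤ r i ∧ (thickening G).dist (c j) x ≤ r j) :
    ∃ x, ∀ i, (thickening G).dist (c i) x ≤ r i := by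
  classical
  rcases isEmpty_or_nonempty ι with hι | ⟨⟨i₀⟩⟩
  · obtain ⟨v⟩ := h.conn.nonempty
    exact ⟨v, fun i => hι.elim i⟩
  by_contra! hne
  choose k hk using hne
  obtain ⟨x, hx⟩ := h.finite_helly
    (insert i₀ ((h.finite_thickening_ball hf (c i₀) (r i₀)).toFinset.image k)) c r
    fun i _ j _ => hp i j
  refine (hk x).not_ge (hx _ (Finset.mem_insert_of_mem (Finset.mem_image_of_mem k ?_)))
  exact (Set.Finite.mem_toFinset _).2 (hx i₀ (Finset.mem_insert_self _ _))

end IsSwm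

theorem statement3 (G : SimpleGraph V) (hconn : G.Connected) (hwm : WeaklyModular G)
    (h4 : ¬ HasInducedK4minus G) (h33 : ¬ HasIsometricK33minus G) :
    (∀ s : Finset (V × ℕ),
      (∀ b₁ ∈ s, ∀ b₂ ∈ s, ∃ x : V,
        (thickening G).dist b₁.1 x ≤ b₁.2 ∧ (thickening G).dist b₂.1 x ≤ b₂.2) →
      ∃ x : V, ∀ b ∈ s, (thickening G).dist b.1 x ≤ b.2) ∧
    ((∀ v : V, (G.neighborSet v).Finite) →
      ∀ (ι : Type u) (c : ι → V) (r : ι → ℕ),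
        (∀ i j : ι, ∃ x : V,
          (thickening G).dist (c i) x ≤ r i ∧ (thickening G).dist (c j) x ≤ r j) →
        ∃ x : V, ∀ i : ι, (thickening G).dist (c i) x ≤ r i) := by
  have h : IsSwm G := ⟨hconn, hwm.1, hwm.2, h4, h33⟩
  exact ⟨fun s hs => h.finite_helly s Prod.fst Prod.snd hs, fun hf ι c r hp => h.helly hf c r hp⟩
end

section
/- Let G be a connected swm-graph and let G^Δ be its thickening. Then for every vertex p and every natural number k, the ball B_k(p) = {v : d_{G^Δ}(p,v) ≤ k} of G^Δ is a gated set of G. -/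
variable {V : Type*}

/-- A set of vertices is gated if every vertex has a gate in it. -/
def Gated (G : SimpleGraph V) (A : Set V) : Prop :=
  ∀ x : V, ∃ g ∈ A, ∀ y ∈ A, G.dist x y = G.dist x g + G.dist g y

section SwmGraphs

theorem hammingDist_cons {n : ℕ} (a b : Bool) (A B : Fin n → Bool) :
    hammingDist (Fin.cons a A : Fin (n + 1) → Bool) (Fin.cons b B) =
      (if a = b then 0 else 1) + hammingDist A B := by
  simp only [hammingDist, Finset.card_filter, Fin.sum_univ_succ, Fin.cons_zero, Fin.cons_succ]
  by_cases h : a = b <;> simp [h]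

theorem hammingDist_update {n : ℕ} {A B : Fin n → Bool} {i : Fin n} (h : A i ≠ B i) :
    hammingDist (Function.update A i (B i)) B + 1 = hammingDist A B := by
  have : (Finset.univ.filter fun j => A j ≠ B j) =
      insert i (Finset.univ.filter fun j => Function.update A i (B i) j ≠ B j) := by
    ext j
    rcases eq_or_ne j i with rfl | hj
    · simp [h]
    · simp [hj]
  simp only [hammingDist]
  rw [this, Finset.card_insert_of_notMem (by simp)]

theorem hammingDist_update_self {n : ℕ} {A B : Fin n → Bool} {i : Fin n} (h : A i ≠ B i) :
    hammingDist A (Function.update A i (B i)) = 1 := by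
  have : (Finset.univ.filter fun j => A j ≠ Function.update A i (B i) j) = {i} := by
    ext j
    rcases eq_or_ne j i with rfl | hj
    · simp [h]
    · simp [hj]
  simp only [hammingDist]
  rw [this, Finset.card_singleton]

theorem hammingDist_add_not {n : ℕ} (A B : Fin n → Bool) :
    hammingDist A B + hammingDist B (fun i => !A i) = n := by
  have h : (Finset.univ.filter fun i => B i ≠ !A i) =
      Finset.univ.filter fun i => ¬ A i ≠ B i := by
    ext i
    simp only [Finset.mem_filter, Finset.mem_univ, true_and]
    cases A i <;> cases B i <;> simp
  simp only [hammingDist]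
  rw [h, Finset.card_filter_add_card_filter_not]
  simp

/-- The bundled hypotheses defining an swm-graph. -/
structure SwmGraph (G : SimpleGraph V) : Prop where
  connected : G.Connected
  weaklyModular : WeaklyModular G
  no_K4minus : ¬ HasInducedK4minus G
  no_K33minus : ¬ HasIsometricK33minus G

variable {G : SimpleGraph V}

theorem SimpleGraph.Connected.dist_adj_right (hc : G.Connected) (u : V) {v w : V}
    (h : G.Adj v w) : G.dist u v ≤ G.dist u w + 1 ∧ G.dist u w ≤ G.dist u v + 1 := by
  have h1 := hc.dist_triangle (u := u) (v := w) (w := v)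
  have h2 := hc.dist_triangle (u := u) (v := v) (w := w)
  have h3 : G.dist v w = 1 := SimpleGraph.dist_eq_one_iff_adj.2 h
  have h4 : G.dist w v = 1 := SimpleGraph.dist_eq_one_iff_adj.2 h.symm
  omega

theorem SimpleGraph.Connected.dist_adj_left (hc : G.Connected) (u : V) {v w : V}
    (h : G.Adj v w) : G.dist v u ≤ G.dist w u + 1 ∧ G.dist w u ≤ G.dist v u + 1 := by
  rw [G.dist_comm (u := v), G.dist_comm (u := w)]
  exact hc.dist_adj_right u h

theorem SimpleGraph.Connected.dist_eq_two (hc : G.Connected) {a b c : V} (hab : G.Adj a b)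
    (hbc : G.Adj b c) (hne : a ≠ c) (hadj : ¬ G.Adj a c) : G.dist a c = 2 := by
  have h1 := (hc.dist_adj_right a hbc).2
  have h2 : G.dist a b = 1 := SimpleGraph.dist_eq_one_iff_adj.2 hab
  have h3 : G.dist a c ≠ 0 := fun h => hne (hc.dist_eq_zero_iff.1 h)
  have h4 : G.dist a c ≠ 1 := fun h => hadj (SimpleGraph.dist_eq_one_iff_adj.1 h)
  omega

theorem SimpleGraph.Connected.exists_adj_dist_succ (hc : G.Connected) {u v : V} (h : u ≠ v) :
    ∃ w, G.Adj u w ∧ G.dist w v + 1 = G.dist u v := by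
  obtain ⟨p, hp⟩ := hc.exists_walk_length_eq_dist u v
  cases p with
  | nil => exact absurd rfl h
  | @cons _ w _ huw q =>
    refine ⟨w, huw, ?_⟩
    have h1 := SimpleGraph.dist_le q
    have h2 := hc.dist_adj_left v huw
    simp only [SimpleGraph.Walk.length_cons] at hp
    omega

namespace SwmGraph

theorem no_edge_below (hG : SwmGraph G) {q a b c : V} (hab : G.Adj a b) (hac : G.Adj a c)
    (hbc : G.Adj b c) (hd : G.dist q b = G.dist q c) (ha : G.dist q a = G.dist q b + 1) :
    False := by
  have hpos : 1 ≤ G.dist q b := by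
    by_contra h
    have hb : q = b := hG.connected.dist_eq_zero_iff.1 (by omega)
    have hc : q = c := hG.connected.dist_eq_zero_iff.1 (by omega)
    exact hbc.ne (hb.symm.trans hc)
  obtain ⟨x, hbx, hcx, hx⟩ := hG.weaklyModular.1 q b c hbc hd hpos
  refine hG.no_K4minus ⟨b, c, x, a, hbc, hbx, hab.symm, hcx, hac.symm, ?_, ?_⟩
  · rintro rfl
    omega
  · intro hxa
    have := hG.connected.dist_adj_right q hxa
    omega

theorem quadrangle (hG : SwmGraph G) {u v w z : V} (hzv : G.Adj z v) (hzw : G.Adj z w)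
    (hne : v ≠ w) (hd : G.dist u v = G.dist u w) (hz : G.dist u z = G.dist u v + 1) :
    ∃ x, G.Adj v x ∧ G.Adj w x ∧ G.dist u x + 1 = G.dist u v :=
  hG.weaklyModular.2 u v w z hzv hzw
    (hG.connected.dist_eq_two hzv.symm hzw hne fun h => hG.no_edge_below hzv hzw h hd hz) hd hz

/-- Two vertices with a common upper neighbor, with respect to the distance from `q`, have at
most one common lower neighbor. -/
theorem meet_unique (hG : SwmGraph G) {q a b c x y : V} (hab : G.Adj a b) (hac : G.Adj a c)
    (hne : b ≠ c) (hbx : G.Adj b x) (hcx : G.Adj c x) (hby : G.Adj b y) (hcy : G.Adj c y)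
    (hbc : G.dist q b = G.dist q c) (ha : G.dist q a = G.dist q b + 1)
    (hx : G.dist q x + 1 = G.dist q b) (hy : G.dist q y + 1 = G.dist q b) : x = y := by
  by_contra hxy
  have hbc' : ¬ G.Adj b c := fun h => hG.no_edge_below hab hac h hbc ha
  have hxy' : ¬ G.Adj x y := fun h =>
    hG.no_K4minus ⟨x, y, b, c, h, hbx.symm, hcx.symm, hby.symm, hcy.symm, hne, hbc'⟩
  obtain ⟨t, hxt, hyt, ht⟩ := hG.quadrangle (u := q) hbx hby hxy (by omega) (by omega)
  have hc := hG.connected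
  have far : ∀ {s s' : V}, G.dist q s + 2 = G.dist q s' → s ≠ s' ∧ ¬ G.Adj s s' := by
    refine fun {s s'} h => ⟨?_, fun h' => ?_⟩
    · rintro rfl
      omega
    · have := hc.dist_adj_right q h'
      omega
  have two : ∀ {s m s' : V}, G.Adj s m → G.Adj m s' → G.dist q s + 2 = G.dist q s' →
      G.dist s s' = 2 := fun h1 h2 h => hc.dist_eq_two h1 h2 (far h).1 (far h).2
  refine hG.no_K33minus ⟨b, c, t, x, y, a, hbx, hby, hab.symm, hcx, hcy, hac.symm, hxt.symm,
    hyt.symm, hc.dist_eq_two hbx hcx.symm hne hbc', ?_, ?_,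
    hc.dist_eq_two hbx.symm hby hxy hxy', two hbx.symm hab.symm (by omega),
    two hby.symm hab.symm (by omega), ?_⟩
  · rw [G.dist_comm]
    exact two hxt.symm hbx.symm (by omega)
  · rw [G.dist_comm]
    exact two hxt.symm hcx.symm (by omega)
  · have h1 := two hxt.symm hbx.symm (by omega)
    have h2 := (hc.dist_adj_right t hab).1
    have h3 := hc.dist_triangle (u := q) (v := t) (w := a)
    omega

theorem dist_of_opposite_edges (hG : SwmGraph G) {h w x z : V} (hw : G.Adj h w)
    (hxz : G.Adj x z) (hx : G.dist h x = G.dist h z + 1) (hwx : G.dist w x = G.dist h z) :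
    G.dist w z + 1 = G.dist h z ∨ G.dist w z = G.dist h z + 1 := by
  have hc := hG.connected
  have h1 := hc.dist_adj_left z hw
  by_contra hcon
  have hwz : G.dist w z = G.dist h z := by omega
  have hpos : 1 ≤ G.dist w x := by
    by_contra h0
    have ha : w = x := hc.dist_eq_zero_iff.1 (by omega)
    have hb : w = z := hc.dist_eq_zero_iff.1 (by omega)
    exact hxz.ne (ha.symm.trans hb)
  obtain ⟨s, hxs, hzs, hs⟩ := hG.weaklyModular.1 w x z hxz (by omega) hpos
  have h2 := hc.dist_adj_left s hw
  have h3 := hc.dist_adj_right h hxs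
  exact hG.no_edge_below (q := h) hxz hxs hzs (by omega) (by omega)

theorem dist_of_edge_square (hG : SwmGraph G) {h w x x' z z' : V} (hw : G.Adj h w)
    (hxx' : G.Adj x x') (hxz' : G.Adj x' z') (hzz' : G.Adj z' z) (hzx : G.Adj z x) (hne : x ≠ z')
    (h1 : G.dist h x' = G.dist h x + 1) (h2 : G.dist h z + 1 = G.dist h x)
    (h3 : G.dist h z' = G.dist h x) (h4 : G.dist w x + 1 = G.dist h x)
    (h5 : G.dist w z = G.dist h x) (h6 : G.dist w x' = G.dist h x) :
    G.dist w z' = G.dist h x + 1 := by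
  have hc := hG.connected
  rcases hG.dist_of_opposite_edges hw hxz' (by omega) (by omega) with h0 | h0
  · obtain ⟨s, hxs, hzs, hs⟩ := hG.quadrangle (u := w) hzx hzz'.symm hne (by omega) (by omega)
    have h7 := hc.dist_adj_left s hw
    have h8 := hc.dist_adj_right h hxs
    have := hG.meet_unique (q := h) hxx'.symm hxz' hne hzx.symm hzz' hxs hzs (by omega)
      (by omega) (by omega) (by omega)
    subst this
    omega
  · omega

end SwmGraph

/-- `CubePair G h x` says that `x` is obtained from `h` by successively adding independent
directions, that is, that `h` and `x` are opposite corners of an isometric cube. -/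
inductive CubePair (G : SimpleGraph V) (h : V) : V → Prop
  | refl : CubePair G h h
  | step {z x w : V} (hz : CubePair G h z) (hzx : G.Adj z x) (hw : G.Adj h w)
      (hx : G.dist h x = G.dist h z + 1) (hwz : G.dist w z = G.dist h z + 1)
      (hwx : G.dist w x = G.dist h z) : CubePair G h x

namespace SwmGraph

set_option maxHeartbeats 1000000 in
/-- Cube pairs can be moved along parallel edges. -/
theorem cubePair_translate (hG : SwmGraph G) {h x : V} (hx : CubePair G h x) :
    ∀ {h' x' : V}, G.Adj h h' → G.Adj x x' → G.dist h' x' = G.dist h x →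
      G.dist h x' = G.dist h x + 1 → G.dist h' x = G.dist h x + 1 → CubePair G h' x' := by
  have hc := hG.connected
  induction hx with
  | refl =>
    intro h' x' _ _ h1 _ _
    rw [SimpleGraph.dist_self] at h1
    rw [hc.dist_eq_zero_iff.1 h1]
    exact .refl
  | @step z x w hz hzx hw hx hwz hwx ih =>
    intro h' x' hh hxx h1 h2 h3
    have e1 := hc.dist_adj_right h' hzx
    have e2 := hc.dist_adj_left z hh
    have e3 := hc.dist_adj_right w hxx
    have e4 := hc.dist_adj_left x' hw
    obtain ⟨z', hzz', hxz', hz'⟩ := hG.quadrangle (u := h') hzx.symm hxx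
      (by rintro rfl; omega) (by omega) (by omega)
    have e5 := hc.dist_adj_left z' hh
    have e6 := hc.dist_adj_right h hxz'
    have c1 := G.dist_comm (u := x') (v := h')
    have c2 := G.dist_comm (u := x') (v := w)
    have c3 := G.dist_comm (u := x') (v := h)
    obtain ⟨w', hww', hhw', hw'⟩ := hG.quadrangle (u := x') hw hh
      (by rintro rfl; omega) (by omega) (by omega)
    have c4 := G.dist_comm (u := x') (v := w')
    have e7 := hG.dist_of_edge_square hw hxx hxz' hzz'.symm hzx (by rintro rfl; omega)
      (by omega) (by omega) (by omega) (by omega) (by omega) (by omega)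
    have e8 := hc.dist_adj_left z' hww'
    have e9 := hc.dist_adj_left z' hhw'
    exact .step (ih hh hzz' (by omega) (by omega) (by omega)) hxz'.symm hhw' (by omega)
      (by omega) (by omega)

/-- Every lower neighbor of `x` in a cube pair forms a cube pair, and has a complementary atom. -/
theorem cubePair_lower (hG : SwmGraph G) {h x : V} (hx : CubePair G h x) :
    ∀ {v : V}, G.Adj v x → G.dist h x = G.dist h v + 1 → CubePair G h v ∧
      ∃ w, G.Adj h w ∧ G.dist w v = G.dist h v + 1 ∧ G.dist w x = G.dist h v := by
  have hc := hG.connected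
  induction hx with
  | refl =>
    intro v _ h1
    rw [SimpleGraph.dist_self] at h1
    omega
  | @step z x w hz hzx hw hx hwz hwx ih =>
    intro v hvx hv
    rcases hG.dist_of_opposite_edges hw hvx.symm hv (by omega) with h1 | h1
    · have hne : z ≠ v := by rintro rfl; omega
      obtain ⟨t, hzt, hvt, ht⟩ := hG.quadrangle (u := h) hzx.symm hvx.symm hne (by omega)
        (by omega)
      obtain ⟨hgt, w₂, hw₂, h2, h3⟩ := ih hzt.symm (by omega)
      have e1 := hc.dist_adj_right w hzt
      have e2 := hc.dist_adj_left t hw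
      refine ⟨.step hgt hvt.symm hw (by omega) (by omega) (by omega), w₂, hw₂, ?_⟩
      have e3 := hc.dist_adj_right w₂ hzx
      have e4 := hc.dist_adj_left x hw₂
      rcases hG.dist_of_opposite_edges hw₂ hvx.symm hv (by omega) with h4 | h4
      · obtain ⟨r, hzr, hvr, hr⟩ := hG.quadrangle (u := w₂) hzx.symm hvx.symm hne (by omega)
          (by omega)
        have e5 := hc.dist_adj_left r hw₂
        have e6 := hc.dist_adj_right h hzr
        have := hG.meet_unique (q := h) hzx.symm hvx.symm hne hzt hvt hzr hvr (by omega)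
          (by omega) (by omega) (by omega)
        subst this
        omega
      · omega
    · refine ⟨?_, w, hw, h1, by omega⟩
      have hwx' := hG.cubePair_translate hz hw hzx (by omega) (by omega) (by omega)
      exact hG.cubePair_translate hwx' hw.symm hvx.symm (by omega) (by omega) (by omega)

theorem cubePair_upper (hG : SwmGraph G) {h x : V} (hx : CubePair G h x) :
    ∀ {w : V}, G.Adj h w → G.dist h x = G.dist w x + 1 → CubePair G w x := by
  have hc := hG.connected
  induction hx with
  | refl =>
    intro v _ h1
    rw [SimpleGraph.dist_self] at h1
    omega
  | @step z x w₀ hz hzx hw₀ hx hwz hwx ih =>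
    intro w hw h1
    rcases hG.dist_of_opposite_edges hw hzx.symm hx (by omega) with h2 | h2
    · have c1 := G.dist_comm (u := x) (v := w)
      have c2 := G.dist_comm (u := x) (v := w₀)
      have c3 := G.dist_comm (u := x) (v := h)
      obtain ⟨w', hww', hw₀w', hw'⟩ := hG.quadrangle (u := x) hw hw₀ (by rintro rfl; omega)
        (by omega) (by omega)
      have c4 := G.dist_comm (u := x) (v := w')
      have e1 := hc.dist_adj_left z hww'
      have e2 := hc.dist_adj_left z hw₀w'
      exact .step (ih hw (by omega)) hzx hww' (by omega) (by omega) (by omega)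
    · exact hG.cubePair_translate hz hw hzx (by omega) (by omega) (by omega)

theorem cubePair_of_mem_interval (hG : SwmGraph G) {h x u : V} (hx : CubePair G h x)
    (hu : G.dist h u + G.dist u x = G.dist h x) : CubePair G u x := by
  have hc := hG.connected
  induction hn : G.dist h u generalizing h with
  | zero => rwa [← hc.dist_eq_zero_iff.1 hn]
  | succ n ih =>
    have hne : h ≠ u := by
      rintro rfl
      simp at hn
    obtain ⟨w, hhw, hw⟩ := hc.exists_adj_dist_succ hne
    have e1 := hc.dist_triangle (u := w) (v := u) (w := x)
    have e2 := hc.dist_adj_left x hhw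
    exact ih (hG.cubePair_upper hx hhw (by omega)) (by omega) (by omega)

theorem cubePair_level (hG : SwmGraph G) {h x v : V} (hx : CubePair G h x) (hxv : G.Adj x v)
    (hd : G.dist h v = G.dist h x) : CubePair G h v := by
  have hc := hG.connected
  have hpos : 1 ≤ G.dist h x := by
    by_contra h0
    have ha : h = x := hc.dist_eq_zero_iff.1 (by omega)
    have hb : h = v := hc.dist_eq_zero_iff.1 (by omega)
    exact hxv.ne (ha.symm.trans hb)
  obtain ⟨s, hxs, hvs, hs⟩ := hG.weaklyModular.1 h x v hxv hd.symm hpos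
  obtain ⟨hgs, w, hw, h1, h2⟩ := hG.cubePair_lower hx hxs.symm (by omega)
  have e1 := hc.dist_adj_right w hxv
  have e2 := hc.dist_adj_left v hw
  have h3 : G.dist w v = G.dist h v := by
    by_contra h3
    have h4 : G.dist w x = G.dist w v := by omega
    have hpos' : 1 ≤ G.dist w x := by
      by_contra h0
      have ha : w = x := hc.dist_eq_zero_iff.1 (by omega)
      have hb : w = v := hc.dist_eq_zero_iff.1 (by omega)
      exact hxv.ne (ha.symm.trans hb)
    obtain ⟨r, hxr, hvr, hr⟩ := hG.weaklyModular.1 w x v hxv h4 hpos'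
    refine hG.no_K4minus ⟨x, v, r, s, hxv, hxr, hxs, hvr, hvs, ?_, ?_⟩
    · rintro rfl
      omega
    · intro hrs
      have := hc.dist_adj_right w hrs
      omega
  have c1 := G.dist_comm (u := v) (v := h)
  have c2 := G.dist_comm (u := v) (v := w)
  obtain ⟨u, hhu, hwu, hu⟩ := hG.weaklyModular.1 v h w hw (by omega) (by omega)
  have c3 := G.dist_comm (u := v) (v := u)
  have e3 := hc.dist_adj_left s hwu
  rcases hG.dist_of_opposite_edges hhu hvs (by omega) (by omega) with h5 | h5
  · omega
  · exact .step hgs hvs.symm hhu (by omega) (by omega) (by omega)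

theorem cubePair_join (hG : SwmGraph G) {h x y v : V} (hx : CubePair G h x)
    (hy : CubePair G h y) (hvx : G.Adj v x) (hvy : G.Adj v y) (hne : x ≠ y)
    (h1 : G.dist h v = G.dist h x + 1) (h2 : G.dist h v = G.dist h y + 1) : CubePair G h v := by
  have hc := hG.connected
  obtain ⟨t, hxt, hyt, ht⟩ := hG.quadrangle (u := h) hvx hvy hne (by omega) (by omega)
  obtain ⟨-, w, hw, h3, h4⟩ := hG.cubePair_lower hy hyt.symm (by omega)
  have e1 := hc.dist_adj_right w hvy
  have e2 := hc.dist_adj_left v hw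
  rcases hG.dist_of_opposite_edges hw hvx (by omega) (by omega) with h5 | h5
  · obtain ⟨r, hxr, hyr, hr⟩ := hG.quadrangle (u := w) hvx hvy hne (by omega) (by omega)
    have e3 := hc.dist_adj_left r hw
    have e4 := hc.dist_adj_right h hxr
    have := hG.meet_unique (q := h) hvx hvy hne hxt hyt hxr hyr (by omega)
      (by omega) (by omega) (by omega)
    subst this
    omega
  · exact .step hx hvx.symm hw (by omega) (by omega) (by omega)

/-- In a weakly modular graph, a nonempty connected set is gated as soon as it contains every
vertex adjacent to two of its members. -/
theorem gated_of_closed (hG : SwmGraph G) {S : Set V} (hS : (G.induce S).Connected)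
    (hcl : ∀ v x y, x ∈ S → y ∈ S → x ≠ y → G.Adj v x → G.Adj v y → v ∈ S) : Gated G S := by
  have hc := hG.connected
  intro x
  obtain ⟨⟨g, hgS⟩, hmin⟩ : ∃ g : S, ∀ y : S, G.dist x g ≤ G.dist x y := by
    have : Nonempty S := hS.nonempty
    exact ⟨_, fun y => Function.argmin_le (fun y : S => G.dist x y) y⟩
  set g' : S := ⟨g, hgS⟩ with hg'
  have key : ∀ n, ∀ y : S, (G.induce S).dist y g' = n → G.dist x y = G.dist x g + n := by
    intro n
    induction n using Nat.strong_induction_on with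
    | _ n ih =>
      intro y hy
      rcases Nat.eq_zero_or_pos n with rfl | hn
      · rw [hS.dist_eq_zero_iff.1 hy]
        rfl
      obtain ⟨y₁, hyy₁, hy₁⟩ := hS.exists_adj_dist_succ (u := y) (v := g') (by
        rintro rfl
        simp at hy
        omega)
      have h1 := ih (n - 1) (by omega) y₁ (by omega)
      have hadj : G.Adj y y₁ := hyy₁
      -- a member at distance `n` from the gate candidate cannot be nearer to `x` than `y₁`
      have low : ∀ s : S, G.Adj s y₁ → (G.induce S).dist s g' = n →
          G.dist x s + 1 ≠ G.dist x y₁ := by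
        intro s hsy hsn hd
        have hm : G.dist x g ≤ G.dist x s := hmin s
        obtain ⟨y₂, hyy₂, hy₂⟩ := hS.exists_adj_dist_succ (u := y₁) (v := g') (by
          rintro rfl
          simp at hy₁
          simp only [g'] at hd
          omega)
        have h2 := ih (n - 2) (by omega) y₂ (by omega)
        have hadj₂ : G.Adj y₁ y₂ := hyy₂
        obtain ⟨t, hst, hyt, ht⟩ := hG.quadrangle (u := x) hsy.symm hadj₂ (by
          intro h
          have := Subtype.ext h
          subst this
          omega) (by omega) (by omega)
        have htS : t ∈ S := hcl t s y₂ s.2 y₂.2 (by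
          intro h
          have := Subtype.ext h
          subst this
          omega) hst.symm hyt.symm
        have a1 : (G.induce S).Adj s ⟨t, htS⟩ := hst
        have a2 : (G.induce S).Adj y₂ ⟨t, htS⟩ := hyt
        have e1 := hS.dist_adj_left g' a1
        have e2 := hS.dist_adj_left g' a2
        have := ih (n - 1) (by omega) ⟨t, htS⟩ (by omega)
        simp only at this
        omega
      have e1 := hc.dist_adj_right x hadj
      have h2 := low y hadj hy
      have h3 : G.dist x y ≠ G.dist x y₁ := by
        intro heq
        rcases Nat.eq_zero_or_pos (G.dist x y) with h0 | h0
        · have ha : x = y := hc.dist_eq_zero_iff.1 h0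
          have hb : x = y₁ := hc.dist_eq_zero_iff.1 (by omega)
          exact hadj.ne (ha.symm.trans hb)
        obtain ⟨s, hys, hy₁s, hs⟩ := hG.weaklyModular.1 x y y₁ hadj heq h0
        have hsS : s ∈ S := hcl s y y₁ y.2 y₁.2 hadj.ne hys.symm hy₁s.symm
        have a1 : (G.induce S).Adj y ⟨s, hsS⟩ := hys
        have a2 : (G.induce S).Adj y₁ ⟨s, hsS⟩ := hy₁s
        have e1 := hS.dist_adj_left g' a1
        have e2 := hS.dist_adj_left g' a2
        by_cases hsn : (G.induce S).dist ⟨s, hsS⟩ g' = n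
        · exact low ⟨s, hsS⟩ hy₁s.symm hsn (by simp only; omega)
        · have := ih (n - 1) (by omega) ⟨s, hsS⟩ (by omega)
          simp only at this
          omega
      omega
  refine ⟨g, hgS, fun y hy => ?_⟩
  have h1 := key _ ⟨y, hy⟩ rfl
  simp only at h1
  have h2 := hc.dist_triangle (u := x) (v := g) (w := y)
  have h3 : G.dist g y ≤ (G.induce S).dist ⟨y, hy⟩ g' := by
    obtain ⟨p, hp⟩ := hS.exists_walk_length_eq_dist ⟨y, hy⟩ g'
    rw [← hp, G.dist_comm, ← SimpleGraph.Walk.length_map (SimpleGraph.Embedding.induce S).toHom p]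
    exact SimpleGraph.dist_le _
  omega

/-- The vertices forming a cube pair with some member of a set. -/
def cubeNeighborhood (G : SimpleGraph V) (H : Set V) : Set V := {v | ∃ u ∈ H, CubePair G u v}

theorem cubeNeighborhood_connected {H : Set V} (hH : (G.induce H).Connected) :
    (G.induce (cubeNeighborhood G H)).Connected := by
  obtain ⟨⟨p, hp⟩⟩ := hH.nonempty
  have hsub : H ⊆ cubeNeighborhood G H := fun v hv => ⟨v, hv, .refl⟩
  have reach : ∀ v (hv : v ∈ cubeNeighborhood G H),
      (G.induce (cubeNeighborhood G H)).Reachable ⟨p, hsub hp⟩ ⟨v, hv⟩ := by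
    rintro v ⟨u, hu, huv⟩
    induction huv with
    | refl => exact (hH.preconnected ⟨p, hp⟩ ⟨u, hu⟩).map (SimpleGraph.induceHomOfLE G hsub).toHom
    | @step z x w hz hzx hw hx hwz hwx ih =>
      have a : (G.induce (cubeNeighborhood G H)).Adj ⟨z, u, hu, hz⟩
        ⟨x, u, hu, .step hz hzx hw hx hwz hwx⟩ := hzx
      exact ih.trans a.reachable
  have : Nonempty (cubeNeighborhood G H) := ⟨⟨p, hsub hp⟩⟩
  exact ⟨fun a b => (reach a a.2).symm.trans (reach b b.2)⟩

theorem gated_cubeNeighborhood (hG : SwmGraph G) {H : Set V} (hH : (G.induce H).Connected)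
    (hgate : Gated G H) : Gated G (cubeNeighborhood G H) := by
  have hc := hG.connected
  refine hG.gated_of_closed (cubeNeighborhood_connected hH) ?_
  have cube_gate : ∀ x ∈ cubeNeighborhood G H, ∀ g ∈ H,
      (∀ y ∈ H, G.dist x y = G.dist x g + G.dist g y) → CubePair G g x := by
    rintro x ⟨u, hu, hux⟩ g hg hgx
    refine hG.cubePair_of_mem_interval hux ?_
    rw [G.dist_comm (u := u) (v := g), G.dist_comm (u := u) (v := x), hgx u hu,
      G.dist_comm (u := g) (v := x), add_comm]
  have move : ∀ v v' x, v' ∈ H → (∀ y ∈ H, G.dist v y = G.dist v v' + G.dist v' y) →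
      x ∈ cubeNeighborhood G H → G.Adj v x →
      CubePair G v' v ∨ CubePair G v' x ∧ G.dist v' v = G.dist v' x + 1 := by
    intro v v' x hv' hgv hx hvx
    obtain ⟨x', hx', hgx⟩ := hgate x
    have hcube := cube_gate x hx x' hx' hgx
    have e1 := hgx v' hv'
    have e2 := hgv x' hx'
    have c1 := G.dist_comm (u := x') (v := v')
    have c2 := G.dist_comm (u := x) (v := v')
    have c3 := G.dist_comm (u := x) (v := x')
    have c4 := G.dist_comm (u := v) (v := v')
    have c5 := G.dist_comm (u := v) (v := x')
    have e3 := hc.dist_adj_right x' hvx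
    have e4 := hc.dist_adj_right v' hvx
    rcases eq_or_ne x' v' with rfl | hne
    · rcases lt_trichotomy (G.dist x' v) (G.dist x' x) with h | h | h
      · exact .inl (hG.cubePair_lower hcube hvx (by omega)).1
      · exact .inl (hG.cubePair_level hcube hvx.symm h)
      · exact .inr ⟨hcube, by omega⟩
    · have h0 : G.dist x' v' ≠ 0 := fun h => hne (hc.dist_eq_zero_iff.1 h)
      exact .inl (hG.cubePair_translate hcube
        (SimpleGraph.dist_eq_one_iff_adj.1 (by omega)) hvx.symm (by omega) (by omega) (by omega))
  intro v x y hx hy hne hvx hvy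
  obtain ⟨v', hv', hgv⟩ := hgate v
  refine ⟨v', hv', ?_⟩
  rcases move v v' x hv' hgv hx hvx with h | ⟨h1, h2⟩
  · exact h
  rcases move v v' y hv' hgv hy hvy with h | ⟨h3, h4⟩
  · exact h
  exact hG.cubePair_join h1 h3 hvx hvy hne h2 h4

theorem adj_of_isometry {n : ℕ} {f : (Fin n → Bool) → V}
    (hf : ∀ A B, G.dist (f A) (f B) = hammingDist A B) {A B : Fin n → Bool}
    (h : hammingDist A B = 1) : G.Adj (f A) (f B) :=
  SimpleGraph.dist_eq_one_iff_adj.1 ((hf A B).trans h)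

theorem cubePair_of_isometry {n : ℕ} {f : (Fin n → Bool) → V}
    (hf : ∀ A B, G.dist (f A) (f B) = hammingDist A B) :
    CubePair G (f fun _ => false) (f fun _ => true) := by
  induction n with
  | zero =>
    have : (fun _ => false : Fin 0 → Bool) = fun _ => true := Subsingleton.elim _ _
    rw [this]
    exact .refl
  | succ n ih =>
    have h0 : (fun _ => false : Fin (n + 1) → Bool) = Fin.cons false fun _ => false := by
      ext i
      cases i using Fin.cases <;> rfl
    have h1 : (fun _ => true : Fin (n + 1) → Bool) = Fin.cons true fun _ => true := by
      ext i
      cases i using Fin.cases <;> rfl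
    have h2 := ih (f := fun A => f (Fin.cons false A)) (fun A B => by
      rw [hf, hammingDist_cons]
      simp)
    rw [h0, h1]
    refine .step (w := f (Fin.cons true fun _ => false)) h2 ?_ ?_ ?_ ?_ ?_
    · exact adj_of_isometry hf (by rw [hammingDist_cons]; simp)
    · exact adj_of_isometry hf (by rw [hammingDist_cons]; simp)
    all_goals simp [hf, hammingDist_cons, add_comm]

theorem not_level_of_interval (hG : SwmGraph G) {p q a b : V} (hab : G.Adj a b)
    (ha : G.dist p a + G.dist a q = G.dist p q) (hb : G.dist p b + G.dist b q = G.dist p q) :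
    G.dist p a ≠ G.dist p b := by
  have hc := hG.connected
  intro h
  have c1 := G.dist_comm (u := a) (v := q)
  have c2 := G.dist_comm (u := b) (v := q)
  have hpos : 1 ≤ G.dist q a := by
    by_contra h0
    have ha : q = a := hc.dist_eq_zero_iff.1 (by omega)
    have hb : q = b := hc.dist_eq_zero_iff.1 (by omega)
    exact hab.ne (ha.symm.trans hb)
  obtain ⟨x, hax, hbx, hx⟩ := hG.weaklyModular.1 q a b hab (by omega) hpos
  have c3 := G.dist_comm (u := x) (v := q)
  have e1 := hc.dist_triangle (u := p) (v := x) (w := q)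
  have e2 := hc.dist_adj_right p hax
  exact hG.no_edge_below (q := p) hax.symm hbx.symm hab h (by omega)

/-- An isometric cube of full dimension inside an interval spans the interval. -/
theorem cubePair_of_booleanPair (hG : SwmGraph G) {p q : V} (h : BooleanPair G p q) :
    CubePair G p q := by
  have hc := hG.connected
  obtain ⟨f, hI, hf⟩ := h
  generalize hn : G.dist p q = n at f
  replace hf : ∀ A B, G.dist (f A) (f B) = hammingDist A B := hf
  replace hI : ∀ A, G.dist p (f A) + G.dist (f A) q = n := fun A => hn ▸ hI A
  obtain ⟨A₀, hmin⟩ := Finite.exists_min fun A => G.dist p (f A)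
  set F : (Fin n → Bool) → V := fun B => f fun i => xor (A₀ i) (B i) with hFdef
  have hF : ∀ A B, G.dist (F A) (F B) = hammingDist A B := by
    intro A B
    rw [hFdef, hf]
    simp [hammingDist]
  have hFI : ∀ A, G.dist p (F A) + G.dist (F A) q = n := fun A => hI _
  have hF0 : F (fun _ => false) = f A₀ := by simp [hFdef]
  have hFmin : ∀ A, G.dist p (F fun _ => false) ≤ G.dist p (F A) := fun A => by
    rw [hF0]
    exact hmin _
  have level : ∀ A B, G.Adj (F A) (F B) → G.dist p (F A) ≠ G.dist p (F B) := fun A B hab =>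
    hG.not_level_of_interval hab (by rw [hFI, hn]) (by rw [hFI, hn])
  have key : ∀ j, ∀ B, hammingDist B (fun _ => false) = j →
      G.dist p (F B) = G.dist p (F fun _ => false) + j := by
    intro j
    induction j using Nat.strong_induction_on with
    | _ j ih =>
      intro B hB
      by_cases hB0 : B = fun _ => false
      · subst hB0
        simp at hB
        omega
      obtain ⟨i, hi⟩ := Function.ne_iff.1 hB0
      have u1 := hammingDist_update (B := fun _ => false) hi
      have u2 := hammingDist_update_self (B := fun _ => false) hi
      set B₁ := Function.update B i false with hB₁
      have a1 : G.Adj (F B) (F B₁) := adj_of_isometry hF u2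
      have h1 := ih (j - 1) (by omega) B₁ (by omega)
      have e1 := hc.dist_adj_right p a1
      have e2 := level _ _ a1
      by_cases hB1 : B₁ = fun _ => false
      · have := hFmin B
        rw [hB1] at e1 e2 u1
        simp at u1
        omega
      obtain ⟨i', hi'⟩ := Function.ne_iff.1 hB1
      have hne : i' ≠ i := by
        rintro rfl
        simp [hB₁] at hi'
      have hi'' : B i' ≠ false := by simpa [hB₁, hne] using hi'
      have v1 := hammingDist_update (B := fun _ => false) hi''
      have v2 := hammingDist_update_self (B := fun _ => false) hi''
      have w1 := hammingDist_update (B := fun _ => false) hi'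
      have w2 := hammingDist_update_self (B := fun _ => false) hi'
      set B₂ := Function.update B i' false with hB₂
      set B₁₂ := Function.update B₁ i' false with hB₁₂
      have hcomm : B₁₂ = Function.update B₂ i false := Function.update_comm hne.symm _ _ _
      have hi₂ : B₂ i ≠ false := by simpa [hB₂, hne.symm] using hi
      have x2 := hammingDist_update_self (B := fun _ => false) hi₂
      rw [← hcomm] at x2
      have a2 : G.Adj (F B) (F B₂) := adj_of_isometry hF v2
      have a3 : G.Adj (F B₁) (F B₁₂) := adj_of_isometry hF w2
      have a4 : G.Adj (F B₂) (F B₁₂) := adj_of_isometry hF x2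
      have h2 := ih (j - 1) (by omega) B₂ (by omega)
      have h3 := ih (j - 2) (by omega) B₁₂ (by omega)
      by_contra hcon
      have h4 : G.dist p (F B) + 1 = G.dist p (F B₁) := by omega
      have hne₁₂ : F B₁ ≠ F B₂ := by
        intro h
        have h5 := hF B₁ B₂
        rw [h, SimpleGraph.dist_self] at h5
        have h6 := congrFun (hammingDist_eq_zero.1 h5.symm) i
        simp only [hB₁, Function.update_self] at h6
        exact hi₂ h6.symm
      have c1 := G.dist_comm (u := F B) (v := q)
      have c2 := G.dist_comm (u := F B₁) (v := q)
      have c3 := G.dist_comm (u := F B₂) (v := q)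
      have i1 := hFI B
      have i2 := hFI B₁
      have i3 := hFI B₂
      obtain ⟨s, hs1, hs2, hs⟩ := hG.quadrangle (u := q) a1 a2 hne₁₂ (by omega) (by omega)
      have e3 := hc.dist_triangle (u := p) (v := s) (w := q)
      have c4 := G.dist_comm (u := s) (v := q)
      have e4 := hc.dist_adj_right p hs1
      have h5 := hG.meet_unique (q := p) hs1.symm hs2.symm hne₁₂ a1.symm a2.symm a3 a4
        (by omega) (by omega) (by omega) (by omega)
      rw [h5] at h4
      have h7 := hF B B₁₂
      rw [h5, SimpleGraph.dist_self] at h7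
      have h8 := congrFun (hammingDist_eq_zero.1 h7.symm) i
      rw [hcomm, Function.update_self] at h8
      exact hi h8
  have h1 := key n (fun _ => true) (by
    have := hammingDist_add_not (fun _ : Fin n => false) (fun _ => false)
    rw [hammingDist_comm]
    simpa using this)
  have h2 := hFI fun _ => true
  have h3 : p = F fun _ => false := hc.dist_eq_zero_iff.1 (by omega)
  have h4 : F (fun _ => true) = q := hc.dist_eq_zero_iff.1 (by omega)
  have h5 := cubePair_of_isometry hF
  rwa [← h3, h4] at h5

theorem exists_parallel (hG : SwmGraph G) {h z w x : V} (hzx : G.Adj z x)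
    (hx : G.dist h x = G.dist h z + 1) (hwz : G.dist w z = G.dist h z + 1) (hw : G.Adj h w)
    (hwx : G.dist w x = G.dist h z) {y : V} (hy : G.dist h y + G.dist y z = G.dist h z) :
    ∃ y', G.Adj y y' ∧ G.dist w y' = G.dist h y ∧ G.dist y' x = G.dist y z := by
  have hc := hG.connected
  induction hn : G.dist y z generalizing y with
  | zero =>
    rw [hc.dist_eq_zero_iff.1 hn]
    exact ⟨x, hzx, hwx, by simp⟩
  | succ n ih =>
    obtain ⟨y₁, hyy₁, hy₁⟩ := hc.exists_adj_dist_succ (u := y) (v := z) (by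
      rintro rfl
      simp at hn)
    have e1 := hc.dist_triangle (u := h) (v := y₁) (w := z)
    have e2 := hc.dist_adj_right h hyy₁
    obtain ⟨y₁', h1, h2, h3⟩ := ih (y := y₁) (by omega) (by omega)
    have e3 := hc.dist_triangle (u := h) (v := y₁') (w := x)
    have e4 := hc.dist_triangle (u := w) (v := y₁) (w := z)
    have e5 := hc.dist_triangle (u := w) (v := y) (w := z)
    have e6 := hc.dist_adj_left y hw
    have e7 := hc.dist_adj_left y₁ hw
    obtain ⟨y', h4, h5, h6⟩ := hG.quadrangle (u := w) h1 hyy₁.symm (by rintro rfl; omega)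
      (by omega) (by omega)
    have e8 := hc.dist_adj_left x h4
    have e9 := hc.dist_triangle (u := w) (v := y') (w := x)
    exact ⟨y', h5, by omega, by omega⟩

theorem parallel_unique (hG : SwmGraph G) {h z w x : V}
    (hx : G.dist h x = G.dist h z + 1) (hwz : G.dist w z = G.dist h z + 1) (hw : G.Adj h w)
    {y y' y'' : V} (hy : G.dist h y + G.dist y z = G.dist h z) (hyy' : G.Adj y y')
    (hyy'' : G.Adj y y'') (h1 : G.dist w y' = G.dist h y) (h2 : G.dist y' x = G.dist y z)
    (h3 : G.dist w y'' = G.dist h y) (h4 : G.dist y'' x = G.dist y z) : y' = y'' := by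
  have hc := hG.connected
  by_contra hne
  have e1 := hc.dist_triangle (u := w) (v := y) (w := z)
  have e2 := hc.dist_adj_left y hw
  have e3 := hc.dist_triangle (u := h) (v := y) (w := x)
  have e4 := hc.dist_adj_left x hyy'
  have c1 := G.dist_comm (u := x) (v := y)
  have c2 := G.dist_comm (u := x) (v := y')
  have c3 := G.dist_comm (u := x) (v := y'')
  have e5 := hc.dist_triangle (u := h) (v := y') (w := x)
  have e6 := hc.dist_triangle (u := h) (v := y'') (w := x)
  have e7 := hc.dist_adj_right h hyy'
  have e8 := hc.dist_adj_right h hyy''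
  obtain ⟨r, hr1, hr2, hr⟩ := hG.quadrangle (u := w) hyy' hyy'' hne (by omega) (by omega)
  obtain ⟨s, hs1, hs2, hs⟩ := hG.quadrangle (u := x) hyy' hyy'' hne (by omega) (by omega)
  have c4 := G.dist_comm (u := x) (v := s)
  have e9 := hc.dist_triangle (u := h) (v := s) (w := x)
  have e10 := hc.dist_adj_right h hs1
  have e11 := hc.dist_adj_left r hw
  have e12 := hc.dist_adj_right h hr1
  have := hG.meet_unique (q := h) hs1.symm hs2.symm hne hyy'.symm hyy''.symm hr1 hr2
    (by omega) (by omega) (by omega) (by omega)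
  subst this
  omega

theorem parallel_adj (hG : SwmGraph G) {h z w x : V} (hwz : G.dist w z = G.dist h z + 1)
    (hx : G.dist h x = G.dist h z + 1) (hw : G.Adj h w) {y y₁ y' y₁' : V}
    (hyy₁ : G.Adj y y₁) (hlev : G.dist h y₁ = G.dist h y + 1)
    (hy : G.dist h y + G.dist y z = G.dist h z) (hy₁ : G.dist h y₁ + G.dist y₁ z = G.dist h z)
    (hyy' : G.Adj y y') (h1 : G.dist w y' = G.dist h y) (h2 : G.dist y' x = G.dist y z)
    (hyy₁' : G.Adj y₁ y₁') (h3 : G.dist w y₁' = G.dist h y₁) (h4 : G.dist y₁' x = G.dist y₁ z) :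
    G.Adj y' y₁' := by
  have hc := hG.connected
  have e3 := hc.dist_triangle (u := h) (v := y₁') (w := x)
  have e4 := hc.dist_triangle (u := w) (v := y₁) (w := z)
  have e5 := hc.dist_triangle (u := w) (v := y) (w := z)
  have e6 := hc.dist_adj_left y hw
  have e7 := hc.dist_adj_left y₁ hw
  obtain ⟨t, h5, h6, h7⟩ := hG.quadrangle (u := w) hyy₁' hyy₁.symm (by rintro rfl; omega)
    (by omega) (by omega)
  have e8 := hc.dist_adj_left x h5
  have e10 := hc.dist_adj_left t hw
  have e9 := hc.dist_triangle (u := h) (v := t) (w := x)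
  have := hG.parallel_unique hx hwz hw hy hyy' h6 h1 h2 (by omega) (by omega)
  subst this
  exact h5.symm

/-- Every cube pair spans an isometric cube. -/
theorem exists_isometry_of_cubePair (hG : SwmGraph G) {h x : V} (hx : CubePair G h x) :
    ∀ n, G.dist h x = n → ∃ f : (Fin n → Bool) → V,
      (∀ A B, G.dist (f A) (f B) = hammingDist A B) ∧
      f (fun _ => false) = h ∧ f (fun _ => true) = x := by
  have hc := hG.connected
  induction hx with
  | refl =>
    intro n hn
    rw [SimpleGraph.dist_self] at hn
    subst hn
    exact ⟨fun _ => h, fun A B => by simp [Subsingleton.elim A B], rfl, rfl⟩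
  | @step z x w hz hzx hw hx hwz hwx ih =>
    intro n' hn'
    obtain ⟨n, rfl⟩ : ∃ n, n' = n + 1 := ⟨n' - 1, by omega⟩
    obtain ⟨f, hf, hf0, hf1⟩ := ih n (by omega)
    have hhz : G.dist h z = n := by omega
    have hfh : ∀ A, G.dist h (f A) = hammingDist (fun _ => false) A := fun A => by
      rw [← hf0, hf]
    have hnot : (fun i => !(fun _ => false : Fin n → Bool) i) = fun _ => true := rfl
    have hfI : ∀ A, G.dist h (f A) + G.dist (f A) z = G.dist h z := fun A => by
      rw [hfh, hhz, ← hf1, hf, ← hnot, hammingDist_add_not]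
    choose g hg1 hg2 hg3 using fun A => hG.exists_parallel hzx hx hwz hw hwx (hfI A)
    have hg0 : g (fun _ => false) = w := by
      refine (hc.dist_eq_zero_iff.1 ?_).symm
      rw [hg2, hf0, SimpleGraph.dist_self]
    have hgt : g (fun _ => true) = x := by
      refine hc.dist_eq_zero_iff.1 ?_
      rw [hg3, hf1, SimpleGraph.dist_self]
    have hgadj : ∀ A i, G.Adj (g A) (g (Function.update A i !A i)) := by
      have up : ∀ A i, A i = false → G.Adj (g A) (g (Function.update A i true)) := by
        intro A i hi
        have h1 := hammingDist_update_self (A := A) (B := fun _ => true) (i := i) (by simp [hi])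
        have h2 := hammingDist_update (A := Function.update A i true) (B := fun _ => false)
          (i := i) (by simp)
        have h3 : Function.update (Function.update A i true) i false = A := by
          rw [Function.update_idem, ← hi, Function.update_eq_self]
        rw [h3, hammingDist_comm, hammingDist_comm _ fun _ => false] at h2
        refine hG.parallel_adj hwz hx hw (adj_of_isometry hf h1) ?_ (hfI _) (hfI _)
          (hg1 _) (hg2 _) (hg3 _) (hg1 _) (hg2 _) (hg3 _)
        rw [hfh, hfh, h2]
      intro A i
      cases hi : A i with
      | false => exact up A i hi
      | true =>
        have h1 := up (Function.update A i false) i (by simp)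
        rw [Function.update_idem, ← hi, Function.update_eq_self] at h1
        simpa using h1.symm
    have anti : ∀ k, ∀ A : Fin n → Bool, hammingDist (fun _ => false) A = k →
        G.dist (f fun i => !A i) (g A) = n + 1 := by
      intro k
      induction k with
      | zero =>
        intro A hA
        rw [← hammingDist_eq_zero.1 hA, hg0, hnot, hf1, G.dist_comm, hwz, hhz]
      | succ k ihk =>
        intro B hB
        obtain ⟨i, hi⟩ : ∃ i, (fun _ => false : Fin n → Bool) i ≠ B i := by
          apply Function.ne_iff.1
          rintro rfl
          simp at hB
        have hBi : B i = true := by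
          cases h : B i
          · simp [h] at hi
          · rfl
        set A := Function.update B i false with hA
        have hBA : B = Function.update A i (!A i) := by
          simp [hA, ← hBi]
        have h1 := hammingDist_update (A := B) (B := fun _ => false) (i := i) (by simp [hBi])
        have hAk : hammingDist (fun _ => false) A = k := by
          rw [hammingDist_comm] at hB
          rw [hammingDist_comm]
          simp only [← hA] at h1
          omega
        have h2 := ihk A hAk
        have d1 := hammingDist_add_not A A
        have d2 := hammingDist_add_not B B
        have d3 := hammingDist_update (A := A) (B := fun i => !A i) (i := i) (by simp)
        have d4 := hammingDist_update_self (A := A) (B := fun i => !A i) (i := i) (by simp)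
        have d5 := hammingDist_update (A := B) (B := fun i => !B i) (i := i) (by simp)
        have d6 := hammingDist_update_self (A := fun i => !A i) (B := A) (i := i) (by simp)
        have hAB : A = Function.update B i (!B i) := by rw [hA, hBi]; rfl
        have hnn : Function.update (fun i => !A i) i (A i) = fun i => !B i := by
          ext j
          rcases eq_or_ne j i with rfl | hj
          · simp [hBA]
          · simp [hBA, hj]
        simp only [← hBA] at d3 d4
        simp only [← hAB] at d5
        rw [hnn] at d6
        simp only [hammingDist_self, zero_add] at d1 d2
        have hx1 : G.dist (f fun i => !A i) (f A) = n := by rw [hf, hammingDist_comm, d1]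
        have hx2 : G.dist (f fun i => !A i) (f B) + 1 = n := by
          rw [hf, hammingDist_comm]; omega
        have hx3 : G.dist (f fun i => !B i) (f B) = n := by rw [hf, hammingDist_comm, d2]
        have hx4 : G.dist (f fun i => !B i) (f A) + 1 = n := by
          rw [hf, hammingDist_comm]; omega
        have aw : G.Adj (f fun i => !A i) (f fun i => !B i) := adj_of_isometry hf d6
        have aAB : G.Adj (f A) (f B) := adj_of_isometry hf d4
        have agAB : G.Adj (g A) (g B) := by
          have := hgadj A i
          rwa [← hBA] at this
        have e1 := hc.dist_adj_right (f fun i => !A i) agAB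
        have e2 := hc.dist_adj_right (f fun i => !A i) (hg1 B)
        have e3 := hc.dist_adj_left (g A) aw
        have e4 := hc.dist_adj_right (f fun i => !B i) (hg1 A)
        have hne : f A ≠ g B := by
          intro hfg
          have e5 := hg2 B
          have e6 := hc.dist_adj_left (f A) hw
          have e7 := hg3 B
          have e8 := hc.dist_triangle (u := h) (v := g B) (w := x)
          have e9 := hfI B
          rw [← hfg] at e8 e7
          rw [hfh] at e8 e9
          omega
        have := hG.dist_of_edge_square aw (hg1 A) agAB (hg1 B).symm aAB.symm hne (by omega)
          (by omega) (by omega) (by omega) (by omega) (by omega)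
        omega
    have cross : ∀ A B, G.dist (g A) (f B) = hammingDist A B + 1 := by
      intro A B
      have h1 := anti _ A rfl
      have h2 := hammingDist_add_not A B
      have h3 := hc.dist_triangle (u := g A) (v := f B) (w := f fun i => !A i)
      have h4 := hc.dist_adj_left (f B) (hg1 A)
      rw [hf] at h3 h4
      rw [G.dist_comm] at h1
      omega
    have upper : ∀ k, ∀ A B, hammingDist A B = k → G.dist (g A) (g B) ≤ k := by
      intro k
      induction k with
      | zero =>
        intro A B h
        simp [hammingDist_eq_zero.1 h]
      | succ k ihk =>
        intro A B h
        obtain ⟨i, hi⟩ : ∃ i, A i ≠ B i := by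
          apply Function.ne_iff.1
          rintro rfl
          simp at h
        have h1 := hammingDist_update hi
        have h2 := hgadj A i
        have h3 : (!A i) = B i := by
          cases hA : A i <;> cases hB : B i <;> simp_all
        rw [h3] at h2
        have h4 := ihk _ B (by omega : hammingDist (Function.update A i (B i)) B = k)
        have h5 := hc.dist_adj_left (g B) h2
        omega
    have hgg : ∀ A B, G.dist (g A) (g B) = hammingDist A B := by
      intro A B
      have h1 := upper _ A B rfl
      have h2 := cross A B
      have h3 := hc.dist_adj_right (g A) (hg1 B)
      omega
    refine ⟨fun C => if C 0 then g (Fin.tail C) else f (Fin.tail C), ?_, hf0, hgt⟩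
    intro A B
    cases A using Fin.consCases with
    | _ a A =>
    cases B using Fin.consCases with
    | _ b B =>
    simp only [Fin.cons_zero, Fin.tail_cons, hammingDist_cons]
    cases a <;> cases b
    · simp [hf]
    · rw [hammingDist_comm A B]
      simpa [add_comm, G.dist_comm] using cross B A
    · simp [cross, add_comm]
    · simp [hgg]

theorem booleanPair_iff (hG : SwmGraph G) {p q : V} : BooleanPair G p q ↔ CubePair G p q := by
  refine ⟨hG.cubePair_of_booleanPair, fun h => ?_⟩
  obtain ⟨f, hf, hf0, hf1⟩ := hG.exists_isometry_of_cubePair h _ rfl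
  refine ⟨f, fun A => ?_, hf⟩
  have h1 := hammingDist_add_not (fun _ => false) A
  have hnot : (fun i => !(fun _ => false : Fin (G.dist p q) → Bool) i) = fun _ => true := rfl
  rw [hnot, ← hf, ← hf, hf0, hf1] at h1
  exact h1

theorem thickening_connected (hG : SwmGraph G) : (thickening G).Connected := by
  refine hG.connected.mono fun u v huv => ?_
  have hd : G.dist u v = 1 := SimpleGraph.dist_eq_one_iff_adj.2 huv
  refine (SimpleGraph.fromRel_adj _ _ _).2 ⟨huv.ne, .inl (hG.booleanPair_iff.2 ?_)⟩
  exact .step .refl huv huv (by simp [hd]) (by simp [G.dist_comm, hd]) (by simp)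

theorem cubePair_symm (hG : SwmGraph G) {p q : V} (h : CubePair G p q) : CubePair G q p := by
  obtain ⟨f, hf, hf0, hf1⟩ := hG.exists_isometry_of_cubePair h _ rfl
  have := cubePair_of_isometry (G := G) (f := fun A => f fun i => !A i) (fun A B => by
    rw [hf]
    simp [hammingDist])
  simpa [hf0, hf1] using this

theorem thickening_adj_iff (hG : SwmGraph G) {p q : V} :
    (thickening G).Adj p q ↔ p ≠ q ∧ CubePair G p q := by
  refine (SimpleGraph.fromRel_adj _ _ _).trans (and_congr_right fun _ => ?_)
  rw [hG.booleanPair_iff, hG.booleanPair_iff]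
  exact ⟨fun h => h.elim id hG.cubePair_symm, .inl⟩

theorem thickening_ball_succ (hG : SwmGraph G) (p : V) (k : ℕ) :
    {v | (thickening G).dist p v ≤ k + 1} =
      cubeNeighborhood G {v | (thickening G).dist p v ≤ k} := by
  have hc := hG.thickening_connected
  ext v
  constructor
  · intro hv
    rcases eq_or_ne v p with rfl | hne
    · exact ⟨v, by simp, .refl⟩
    · obtain ⟨u, hvu, hu⟩ := hc.exists_adj_dist_succ hne
      rw [(thickening G).dist_comm (u := u), (thickening G).dist_comm (u := v)] at hu
      exact ⟨u, Nat.le_of_succ_le_succ (hu.trans_le hv), (hG.thickening_adj_iff.1 hvu.symm).2⟩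
  · rintro ⟨u, hu, huv⟩
    simp only [Set.mem_ofPred_eq] at hu ⊢
    rcases eq_or_ne u v with rfl | hne
    · omega
    · have := hc.dist_adj_right p (hG.thickening_adj_iff.2 ⟨hne, huv⟩)
      omega

theorem thickening_ball (hG : SwmGraph G) (p : V) (k : ℕ) :
    (G.induce {v | (thickening G).dist p v ≤ k}).Connected ∧
      Gated G {v | (thickening G).dist p v ≤ k} := by
  induction k with
  | zero =>
    have h : {v | (thickening G).dist p v ≤ 0} = {p} := by
      ext v
      simp only [Set.mem_ofPred_eq, Nat.le_zero, hG.thickening_connected.dist_eq_zero_iff,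
        Set.mem_singleton_iff]
      exact eq_comm
    rw [h]
    refine ⟨?_, fun x => ⟨p, rfl, ?_⟩⟩
    · have : Subsingleton ({p} : Set V) := Set.subsingleton_singleton.coe_sort
      have : Nonempty ({p} : Set V) := ⟨⟨p, rfl⟩⟩
      exact ⟨fun a b => Subsingleton.elim a b ▸ .refl _⟩
    · rintro y rfl
      simp
  | succ k ih =>
    rw [hG.thickening_ball_succ]
    exact ⟨cubeNeighborhood_connected ih.1, hG.gated_cubeNeighborhood ih.1 ih.2⟩

end SwmGraph

end SwmGraphs

theorem statement4 (G : SimpleGraph V) (hconn : G.Connected) (hwm : WeaklyModular G)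
    (h4 : ¬ HasInducedK4minus G) (h33 : ¬ HasIsometricK33minus G)
    (p : V) (k : ℕ) :
    Gated G {v : V | (thickening G).dist p v ≤ k} := by
  exact (SwmGraph.thickening_ball ⟨hconn, hwm, h4, h33⟩ p k).2
end

section
/- A connected weakly modular graph G is Helly if and only if G is 1-Helly; likewise, G is finitely Helly if and only if G is finitely 1-Helly. -/
variable {V : Type*}

/-- Every family of pairwise intersecting balls of `G` has a common vertex. -/
def IsHelly (G : SimpleGraph V) : Prop :=
  ∀ F : Set (V × ℕ),
    (∀ b₁ ∈ F, ∀ b₂ ∈ F, ∃ x : V, G.dist b₁.1 x ≤ b₁.2 ∧ G.dist b₂.1 x ≤ b₂.2) →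
    ∃ x : V, ∀ b ∈ F, G.dist b.1 x ≤ b.2

/-- Every finite family of pairwise intersecting balls of `G` has a common vertex. -/
def IsFinitelyHelly (G : SimpleGraph V) : Prop :=
  ∀ F : Finset (V × ℕ),
    (∀ b₁ ∈ F, ∀ b₂ ∈ F, ∃ x : V, G.dist b₁.1 x ≤ b₁.2 ∧ G.dist b₂.1 x ≤ b₂.2) →
    ∃ x : V, ∀ b ∈ F, G.dist b.1 x ≤ b.2

/-- Every family of pairwise intersecting balls of radius 1 has a common vertex. -/
def IsOneHelly (G : SimpleGraph V) : Prop :=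
  ∀ S : Set V,
    (∀ u ∈ S, ∀ v ∈ S, ∃ x : V, G.dist u x ≤ 1 ∧ G.dist v x ≤ 1) →
    ∃ x : V, ∀ u ∈ S, G.dist u x ≤ 1

/-- Every finite family of pairwise intersecting balls of radius 1 has a common vertex. -/
def IsFinitelyOneHelly (G : SimpleGraph V) : Prop :=
  ∀ S : Finset V,
    (∀ u ∈ S, ∀ v ∈ S, ∃ x : V, G.dist u x ≤ 1 ∧ G.dist v x ≤ 1) →
    ∃ x : V, ∀ u ∈ S, G.dist u x ≤ 1

/-- Families of pairwise intersecting balls of radius 1 indexed by `ι` have a common vertex. -/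
def OneHellyFor (G : SimpleGraph V) (ι : Type*) : Prop :=
  ∀ c : ι → V, (∀ i j, ∃ x, G.dist (c i) x ≤ 1 ∧ G.dist (c j) x ≤ 1) →
    ∃ x, ∀ i, G.dist (c i) x ≤ 1

namespace WeaklyModular

variable {G : SimpleGraph V} {ι : Type*}

lemma exists_adj_dist_eq (hconn : G.Connected) {u v : V} {k : ℕ} (h : G.dist v u = k + 1) :
    ∃ y, G.Adj u y ∧ G.dist v y = k := by
  obtain ⟨p, hp⟩ := hconn.exists_walk_length_eq_dist u v
  rw [SimpleGraph.dist_comm, h] at hp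
  cases p with
  | nil => simp at hp
  | cons hadj q =>
    rename_i y
    refine ⟨y, hadj, ?_⟩
    have h₁ : G.dist y v ≤ q.length := SimpleGraph.dist_le q
    have h₂ := hconn.dist_triangle (u := v) (v := y) (w := u)
    have h₃ : G.dist y u = 1 := SimpleGraph.dist_eq_one_iff_adj.2 hadj.symm
    simp only [SimpleGraph.Walk.length_cons] at hp
    rw [SimpleGraph.dist_comm] at h₁
    omega

/-- Two neighbours of `u` one step closer to `v` have a common neighbour two steps closer. -/
lemma exists_common_closer (hconn : G.Connected) (hwm : WeaklyModular G) {u v x y : V} {k : ℕ}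
    (hu : G.dist v u = k + 2) (hx : G.Adj u x) (hy : G.Adj u y)
    (hvx : G.dist v x = k + 1) (hvy : G.dist v y = k + 1) :
    ∃ z, G.Adj x z ∧ G.Adj y z ∧ G.dist v z = k := by
  by_cases hxy : x = y
  · subst hxy
    obtain ⟨z, hz, hd⟩ := exists_adj_dist_eq hconn hvx
    exact ⟨z, hz, hz, hd⟩
  by_cases hadj : G.Adj x y
  · obtain ⟨z, h₁, h₂, h₃⟩ := hwm.1 v x y hadj (by omega) (by omega)
    exact ⟨z, h₁, h₂, by omega⟩
  · have h₁ := hconn.dist_triangle (u := x) (v := u) (w := y)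
    have h₂ : G.dist x u = 1 := SimpleGraph.dist_eq_one_iff_adj.2 hx.symm
    have h₃ : G.dist u y = 1 := SimpleGraph.dist_eq_one_iff_adj.2 hy
    have h₄ : G.dist x y ≠ 0 := fun h => hxy (hconn.dist_eq_zero_iff.1 h)
    have h₅ : G.dist x y ≠ 1 := fun h => hadj (SimpleGraph.dist_eq_one_iff_adj.1 h)
    obtain ⟨z, h₆, h₇, h₈⟩ := hwm.2 v x y u hx hy (by omega) (by omega) (by omega)
    exact ⟨z, h₆, h₇, by omega⟩

lemma exists_near_of_adj (hconn : G.Connected) (hwm : WeaklyModular G)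
    (hH : OneHellyFor G (ι ⊕ ι)) (v : V) (k : ℕ) (u : V) (x : ι → V)
    (hu : G.dist v u = k + 2) (hx : ∀ i, G.Adj u (x i)) (hv : ∀ i, G.dist v (x i) = k + 1) :
    ∃ w, G.dist v w ≤ k ∧ ∀ i, G.dist (x i) w ≤ 1 := by
  induction k generalizing u x with
  | zero => exact ⟨v, by simp, fun i => by rw [SimpleGraph.dist_comm, hv i]⟩
  | succ k ih =>
    rcases isEmpty_or_nonempty ι with hι | ⟨⟨i₀⟩⟩
    · exact ⟨v, by simp, fun i => isEmptyElim i⟩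
    have hpair : ∀ s : Sym2 ι, ∃ y, G.dist v y = k + 1 ∧ ∀ i ∈ s, G.Adj (x i) y := by
      refine Sym2.ind fun i j => ?_
      obtain ⟨y, h₁, h₂, h₃⟩ := exists_common_closer hconn hwm hu (hx i) (hx j) (hv i) (hv j)
      refine ⟨y, h₃, fun l hl => ?_⟩
      rcases Sym2.mem_iff.1 hl with rfl | rfl <;> assumption
    choose f hf hfadj using hpair
    have hw : ∀ i, ∃ w, G.dist v w ≤ k ∧ ∀ j, G.dist (f s(i, j)) w ≤ 1 := fun i =>
      ih (x i) (fun j => f s(i, j)) (hv i) (fun j => hfadj _ i (Sym2.mem_mk_left i j))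
        fun j => hf _
    choose w hvw hfw using hw
    have hadj : ∀ i j, G.dist (x i) (f s(i, j)) ≤ 1 := fun i j =>
      (SimpleGraph.dist_eq_one_iff_adj.2 (hfadj _ i (Sym2.mem_mk_left i j))).le
    have hux : ∀ i, G.dist (x i) u ≤ 1 := fun i =>
      (SimpleGraph.dist_eq_one_iff_adj.2 (hx i).symm).le
    obtain ⟨p, hp⟩ := hH (Sum.elim x w) (by
      rintro (i | i) (j | j)
      · exact ⟨u, hux i, hux j⟩
      · refine ⟨f s(i, j), hadj i j, ?_⟩
        rw [SimpleGraph.dist_comm, Sym2.eq_swap]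
        exact hfw j i
      · refine ⟨f s(i, j), ?_, ?_⟩
        · rw [SimpleGraph.dist_comm]
          exact hfw i j
        · rw [Sym2.eq_swap]
          exact hadj j i
      · refine ⟨f s(i, j), ?_, ?_⟩
        · rw [SimpleGraph.dist_comm]
          exact hfw i j
        · rw [SimpleGraph.dist_comm, Sym2.eq_swap]
          exact hfw j i)
    refine ⟨p, ?_, fun i => hp (Sum.inl i)⟩
    have h₁ : G.dist (w i₀) p ≤ 1 := hp (Sum.inr i₀)
    have h₂ := hconn.dist_triangle (u := v) (v := w i₀) (w := p)
    have h₃ := hvw i₀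
    omega

/-- Vertices of `B_1(u) ∩ B_{R+1}(v)` are simultaneously within distance 1 of some vertex of
`B_R(v)`. -/
lemma exists_near (hconn : G.Connected) (hwm : WeaklyModular G)
    (hH : OneHellyFor G (ι ⊕ ι)) (u v : V) (R : ℕ) (x : ι → V)
    (hx : ∀ i, G.dist u (x i) ≤ 1) (hv : ∀ i, G.dist v (x i) ≤ R + 1) :
    ∃ w, G.dist v w ≤ R ∧ ∀ i, G.dist (x i) w ≤ 1 := by
  rcases isEmpty_or_nonempty ι with hι | ⟨⟨i₀⟩⟩
  · exact ⟨v, by simp, fun i => isEmptyElim i⟩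
  have hx' : ∀ i, G.dist (x i) u ≤ 1 := fun i => by
    rw [SimpleGraph.dist_comm]
    exact hx i
  have htri : ∀ i, G.dist v u ≤ G.dist v (x i) + 1 := fun i =>
    hconn.dist_triangle.trans (Nat.add_le_add_left (hx' i) _)
  have hcases : ∀ i, x i = u ∨ G.Adj u (x i) := fun i => by
    rcases Nat.le_one_iff_eq_zero_or_eq_one.1 (hx i) with h | h
    · exact Or.inl (hconn.dist_eq_zero_iff.1 h).symm
    · exact Or.inr (SimpleGraph.dist_eq_one_iff_adj.1 h)
  rcases Nat.lt_trichotomy (G.dist v u) (R + 1) with hu | hu | hu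
  · exact ⟨u, by omega, hx'⟩
  · rcases R with _ | S
    · exact ⟨v, by simp, fun i => by
        rw [SimpleGraph.dist_comm]
        exact hv i⟩
    have hy : ∀ i, ∃ y, G.Adj u y ∧ G.dist v y = S + 1 ∧ G.dist (x i) y ≤ 1 := by
      intro i
      rcases hcases i with h | h
      · obtain ⟨y, h₁, h₂⟩ := exists_adj_dist_eq hconn hu
        exact ⟨y, h₁, h₂, by rw [h, SimpleGraph.dist_eq_one_iff_adj.2 h₁]⟩
      · have h₁ := htri i
        have h₂ := hv i
        by_cases h₃ : G.dist v (x i) = S + 1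
        · exact ⟨x i, h, h₃, by simp⟩
        · obtain ⟨y, h₄, h₅, h₆⟩ := hwm.1 v u (x i) h (by omega) (by omega)
          exact ⟨y, h₄, by omega, (SimpleGraph.dist_eq_one_iff_adj.2 h₅).le⟩
    choose y hy₁ hy₂ hy₃ using hy
    obtain ⟨z, hz, hyz⟩ := exists_near_of_adj hconn hwm hH v S u y hu hy₁ hy₂
    have hzy : ∀ i, G.dist z (y i) ≤ 1 := fun i => by
      rw [SimpleGraph.dist_comm]
      exact hyz i
    obtain ⟨p, hp⟩ := hH (Sum.elim x fun _ => z) (by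
      rintro (i | i) (j | j)
      · exact ⟨u, hx' i, hx' j⟩
      · exact ⟨y i, hy₃ i, hzy i⟩
      · exact ⟨y j, hzy j, hy₃ j⟩
      · exact ⟨z, by simp, by simp⟩)
    refine ⟨p, ?_, fun i => hp (Sum.inl i)⟩
    have h₁ : G.dist z p ≤ 1 := hp (Sum.inr i₀)
    have h₂ := hconn.dist_triangle (u := v) (v := z) (w := p)
    omega
  · have hdist : ∀ i, G.dist v (x i) = R + 1 := fun i => by
      have h₁ := htri i
      have h₂ := hv i
      omega
    have h₀ := htri i₀
    rw [hdist i₀] at h₀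
    refine exists_near_of_adj hconn hwm hH v R u x (by omega) (fun i => ?_) hdist
    rcases hcases i with h | h
    · have h₁ := hdist i
      rw [h] at h₁
      omega
    · exact h

/-- A sequence without weak local maxima in the interior of `[0, α + β]` is bounded at `α` by `r`
when its end values are at most `α + r` and `β + r`. -/
lemma le_of_no_local_max {h : ℕ → ℕ} {α β r : ℕ} (h₀ : h 0 ≤ α + r) (h₁ : h (α + β) ≤ β + r)
    (hmax : ∀ i, i + 1 < α + β → 1 ≤ h (i + 1) → h (i + 1) < h i ∨ h (i + 1) < h (i + 2)) :
    h α ≤ r := by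
  by_contra! hr
  rcases α with _ | α
  · omega
  rcases β with _ | β
  · simp only [add_zero] at h₁
    omega
  rcases hmax α (by omega) (by omega) with hlt | hlt
  · have key : ∀ k, k ≤ α → h (α - k + 1) < h (α - k) ∧ r + k + 2 ≤ h (α - k) := by
      intro k
      induction k with
      | zero => exact fun _ => ⟨by simpa using hlt, by simp only [tsub_zero]; omega⟩
      | succ k ih =>
        intro hk
        obtain ⟨ih₁, ih₂⟩ := ih (by omega)
        have e : α - k = α - (k + 1) + 1 := by omega
        rw [e] at ih₁ ih₂
        rcases hmax (α - (k + 1)) (by omega) (by omega) with h₂ | h₂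
        · exact ⟨h₂, by omega⟩
        · exact absurd h₂ (by simpa [add_assoc] using ih₁.le)
    have := (key α le_rfl).2
    simp only [tsub_self] at this
    omega
  · have key : ∀ k, k ≤ β →
        h (α + 1 + k) < h (α + 1 + k + 1) ∧ r + k + 2 ≤ h (α + 1 + k + 1) := by
      intro k
      induction k with
      | zero => exact fun _ => ⟨hlt, by have : h (α + 1) < h (α + 1 + 0 + 1) := hlt; omega⟩
      | succ k ih =>
        intro hk
        obtain ⟨ih₁, ih₂⟩ := ih (by omega)
        rcases hmax (α + 1 + k) (by omega) (by omega) with h₂ | h₂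
        · omega
        · have h₃ : h (α + 1 + (k + 1)) < h (α + 1 + (k + 1) + 1) := h₂
          have h₄ : r + k + 2 ≤ h (α + 1 + (k + 1)) := ih₂
          exact ⟨h₃, by omega⟩
    have h₂ := (key β le_rfl).2
    have e : α + 1 + β + 1 = α + 1 + (β + 1) := by omega
    rw [e] at h₂
    omega

lemma dist_le_of_steps (hconn : G.Connected) {c : ℕ → V} {n : ℕ}
    (hc : ∀ i < n, G.dist (c i) (c (i + 1)) ≤ 1) (m k : ℕ) (h : m + k ≤ n) :
    G.dist (c m) (c (m + k)) ≤ k := by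
  induction k with
  | zero => simp
  | succ k ih =>
    have h₁ := ih (by omega)
    have h₂ := hc (m + k) (by omega)
    have h₃ := hconn.dist_triangle (u := c m) (v := c (m + k)) (w := c (m + k + 1))
    rw [← add_assoc]
    omega

lemma exists_steps (hconn : G.Connected) {a b : V} {n : ℕ} (h : G.dist a b ≤ n) :
    ∃ c : ℕ → V, c 0 = a ∧ c n = b ∧ ∀ i < n, G.dist (c i) (c (i + 1)) ≤ 1 := by
  obtain ⟨p, hp⟩ := hconn.exists_walk_length_eq_dist a b
  refine ⟨p.getVert, p.getVert_zero, p.getVert_of_length_le (by omega), fun i _ => ?_⟩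
  by_cases hi : i < p.length
  · exact (SimpleGraph.dist_eq_one_iff_adj.2 (p.adj_getVert_succ hi)).le
  · rw [p.getVert_of_length_le (by omega), p.getVert_of_length_le (by omega)]
    simp

/-- Three pairwise intersecting balls have a common vertex. -/
lemma exists_mem_three_balls (hconn : G.Connected) (hwm : WeaklyModular G)
    (hH : OneHellyFor G (Bool ⊕ Bool)) {a b u : V} {α β r : ℕ}
    (hab : G.dist a b ≤ α + β) (hua : G.dist u a ≤ α + r) (hub : G.dist u b ≤ β + r) :
    ∃ x, G.dist a x ≤ α ∧ G.dist b x ≤ β ∧ G.dist u x ≤ r := by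
  let P : (ℕ → V) → Prop := fun c =>
    c 0 = a ∧ c (α + β) = b ∧ ∀ i < α + β, G.dist (c i) (c (i + 1)) ≤ 1
  let μ : (ℕ → V) → ℕ := fun c => ∑ i ∈ Finset.range (α + β), G.dist u (c i)
  obtain ⟨c, ⟨hc₀, hc₁, hc⟩, hmin⟩ : ∃ c, P c ∧ ∀ c', P c' → μ c ≤ μ c' := by
    have hne : {c | P c}.Nonempty := exists_steps hconn hab
    exact ⟨Function.argminOn μ {c | P c} hne, Function.argminOn_mem μ {c | P c} hne,
      fun c' hc' => Function.argminOn_le μ {c | P c} hc'⟩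
  refine ⟨c α, ?_, ?_, ?_⟩
  · simpa [hc₀] using dist_le_of_steps hconn hc 0 α (by omega)
  · simpa [hc₁, SimpleGraph.dist_comm] using dist_le_of_steps hconn hc α β le_rfl
  refine le_of_no_local_max (h := fun i => G.dist u (c i)) (β := β) (by simpa [hc₀] using hua)
    (by simpa [hc₁] using hub) fun i hi hpos => ?_
  by_contra! hcon
  obtain ⟨hl, hr⟩ := hcon
  obtain ⟨m, hm⟩ : ∃ m, G.dist u (c (i + 1)) = m + 1 := ⟨_, (Nat.sub_add_cancel hpos).symm⟩
  have hleft : G.dist (c i) (c (i + 1)) ≤ 1 := hc i (by omega)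
  obtain ⟨w, hw, hwx⟩ := exists_near (ι := Bool) hconn hwm hH (c (i + 1)) u m
    (fun t => if t then c i else c (i + 2))
    (by
      rintro (_ | _)
      · simpa using hc (i + 1) hi
      · simpa [SimpleGraph.dist_comm] using hleft)
    (by
      rintro (_ | _)
      · simpa [← hm] using hr
      · simpa [← hm] using hl)
  have hwl : G.dist (c i) w ≤ 1 := by simpa using hwx true
  have hwr : G.dist (c (i + 2)) w ≤ 1 := by simpa using hwx false
  have hle := hmin (Function.update c (i + 1) w) (by
    refine ⟨by simp [hc₀], by simp [Function.update_of_ne hi.ne', hc₁], fun j hj => ?_⟩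
    by_cases h₁ : j = i
    · subst h₁
      simpa using hwl
    by_cases h₂ : j = i + 1
    · subst h₂
      simpa [SimpleGraph.dist_comm] using hwr
    · rw [Function.update_of_ne h₂, Function.update_of_ne (by omega)]
      exact hc j hj)
  refine hle.not_gt (Finset.sum_lt_sum (fun j _ => ?_) ⟨i + 1, Finset.mem_range.2 hi, ?_⟩)
  · by_cases h₁ : j = i + 1
    · subst h₁
      simp only [Function.update_self]
      omega
    · rw [Function.update_of_ne h₁]
  · simp only [Function.update_self]
    omega

/-- A vertex whose distance to each ball of a pairwise intersecting family is at most `r + 1` can be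
moved by at most one step so that these distances become at most `r`. -/
lemma exists_step_closer (hconn : G.Connected) (hwm : WeaklyModular G)
    (hB : OneHellyFor G (Bool ⊕ Bool)) (hH : OneHellyFor G (ι ⊕ ι))
    {b : ι → V} {ρ : ι → ℕ} (hρ : ∀ i, 1 ≤ ρ i) (hb : ∀ i j, G.dist (b i) (b j) ≤ ρ i + ρ j)
    {u : V} {r : ℕ} (hu : ∀ i, G.dist u (b i) ≤ ρ i + (r + 1)) :
    ∃ u', ∀ i, G.dist u' (b i) ≤ ρ i + r := by
  have hpair : ∀ s : Sym2 ι, ∃ x, G.dist u x ≤ 1 ∧ ∀ i ∈ s, G.dist (b i) x ≤ ρ i + r := by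
    refine Sym2.ind fun i j => ?_
    obtain ⟨x, h₁, h₂, h₃⟩ := exists_mem_three_balls (α := ρ i + r) (β := ρ j + r) (r := 1)
      hconn hwm hB (by have := hb i j; omega) (hu i) (hu j)
    refine ⟨x, h₃, fun l hl => ?_⟩
    rcases Sym2.mem_iff.1 hl with rfl | rfl <;> assumption
  choose f hf hfb using hpair
  have hw : ∀ i, ∃ w, G.dist (b i) w ≤ ρ i + r - 1 ∧ ∀ j, G.dist (f s(i, j)) w ≤ 1 := by
    intro i
    refine exists_near hconn hwm hH u (b i) (ρ i + r - 1) (fun j => f s(i, j))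
      (fun j => hf _) fun j => (hfb _ i (Sym2.mem_mk_left i j)).trans ?_
    omega
  choose w hbw hfw using hw
  have hwf : ∀ i j, G.dist (w i) (f s(i, j)) ≤ 1 := fun i j => by
    rw [SimpleGraph.dist_comm]
    exact hfw i j
  obtain ⟨p, hp⟩ := hH (Sum.elim w w) (by
    have key : ∀ i j, ∃ x, G.dist (w i) x ≤ 1 ∧ G.dist (w j) x ≤ 1 := fun i j =>
      ⟨f s(i, j), hwf i j, by
        rw [Sym2.eq_swap]
        exact hwf j i⟩
    rintro (i | i) (j | j) <;> exact key i j)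
  refine ⟨p, fun i => ?_⟩
  have h₁ : G.dist (w i) p ≤ 1 := hp (Sum.inl i)
  have h₂ := hconn.dist_triangle (u := b i) (v := w i) (w := p)
  have h₃ := hbw i
  have h₄ := hρ i
  rw [SimpleGraph.dist_comm]
  omega

lemma exists_mem_balls (hconn : G.Connected) (hwm : WeaklyModular G)
    (hB : OneHellyFor G (Bool ⊕ Bool)) (hH : OneHellyFor G (ι ⊕ ι))
    {b : ι → V} {ρ : ι → ℕ} (hb : ∀ i j, G.dist (b i) (b j) ≤ ρ i + ρ j) :
    ∃ x, ∀ i, G.dist (b i) x ≤ ρ i := by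
  by_cases hρ : ∀ i, 1 ≤ ρ i
  · have key : ∀ r u, (∀ i, G.dist u (b i) ≤ ρ i + r) → ∃ x, ∀ i, G.dist (b i) x ≤ ρ i := by
      intro r
      induction r with
      | zero => exact fun u hu => ⟨u, fun i => by
          rw [SimpleGraph.dist_comm]
          exact hu i⟩
      | succ r ih =>
        intro u hu
        obtain ⟨u', hu'⟩ := exists_step_closer hconn hwm hB hH hρ hb hu
        exact ih u' hu'
    rcases isEmpty_or_nonempty ι with hι | ⟨⟨i₀⟩⟩
    · exact ⟨hconn.nonempty.some, fun i => isEmptyElim i⟩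
    · exact key (ρ i₀) (b i₀) fun i => by
        rw [add_comm]
        exact hb i₀ i
  · push Not at hρ
    obtain ⟨i, hi⟩ := hρ
    exact ⟨b i, fun j => by have := hb j i; omega⟩

end WeaklyModular

lemma IsOneHelly.oneHellyFor {G : SimpleGraph V} (h : IsOneHelly G) (ι : Type*) :
    OneHellyFor G ι := by
  intro c hc
  obtain ⟨x, hx⟩ := h (Set.range c) (by
    rintro _ ⟨i, rfl⟩ _ ⟨j, rfl⟩
    exact hc i j)
  exact ⟨x, fun i => hx _ ⟨i, rfl⟩⟩

lemma IsFinitelyOneHelly.oneHellyFor {G : SimpleGraph V} (h : IsFinitelyOneHelly G) (ι : Type*)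
    [Finite ι] : OneHellyFor G ι := by
  intro c hc
  obtain ⟨x, hx⟩ := h (Set.finite_range c).toFinset (by
    simp only [Set.Finite.mem_toFinset]
    rintro _ ⟨i, rfl⟩ _ ⟨j, rfl⟩
    exact hc i j)
  exact ⟨x, fun i => hx _ (by simp)⟩

lemma SimpleGraph.Connected.dist_le_add_of_common {G : SimpleGraph V} (hconn : G.Connected)
    {a b : V} {r s : ℕ} (h : ∃ x, G.dist a x ≤ r ∧ G.dist b x ≤ s) : G.dist a b ≤ r + s := by
  obtain ⟨x, h₁, h₂⟩ := h
  rw [SimpleGraph.dist_comm] at h₂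
  exact hconn.dist_triangle.trans (add_le_add h₁ h₂)

theorem statement6 (G : SimpleGraph V) (hconn : G.Connected)
    (hwm : WeaklyModular G) :
    (IsHelly G ↔ IsOneHelly G) ∧ (IsFinitelyHelly G ↔ IsFinitelyOneHelly G) := by
  classical
  refine ⟨⟨fun h S hS => ?_, fun h F hF => ?_⟩, ⟨fun h S hS => ?_, fun h F hF => ?_⟩⟩
  · obtain ⟨x, hx⟩ := h ((fun v => (v, 1)) '' S) (by
      rintro _ ⟨u, hu, rfl⟩ _ ⟨v, hv, rfl⟩
      exact hS u hu v hv)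
    exact ⟨x, fun u hu => hx (u, 1) ⟨u, hu, rfl⟩⟩
  · obtain ⟨x, hx⟩ := hwm.exists_mem_balls hconn (h.oneHellyFor _) (h.oneHellyFor _)
      (b := fun i : F => i.1.1) (ρ := fun i => i.1.2)
      fun i j => hconn.dist_le_add_of_common (hF i i.2 j j.2)
    exact ⟨x, fun b hb => hx ⟨b, hb⟩⟩
  · obtain ⟨x, hx⟩ := h (S.image fun v => (v, 1)) (by
      intro b₁ h₁ b₂ h₂
      obtain ⟨u, hu, rfl⟩ := Finset.mem_image.1 h₁
      obtain ⟨v, hv, rfl⟩ := Finset.mem_image.1 h₂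
      exact hS u hu v hv)
    exact ⟨x, fun u hu => hx (u, 1) (Finset.mem_image_of_mem _ hu)⟩
  · obtain ⟨x, hx⟩ := hwm.exists_mem_balls hconn (h.oneHellyFor _) (h.oneHellyFor _)
      (b := fun i : F => i.1.1) (ρ := fun i => i.1.2)
      fun i j => hconn.dist_le_add_of_common (hF i i.2 j j.2)
    exact ⟨x, fun b hb => hx ⟨b, hb⟩⟩
end

section
/- Let G be a connected finitely clique-Helly weakly modular graph satisfying the (C4,W4)-condition. Then for any vertices u,v with d(u,v) = k+1 ≥ 1 and any finite set W ⊆ B_1(v) ∩ B_{k+1}(u), there exists a vertex y ∈ B_1(v) ∩ B_k(u) that is adjacent to every vertex of W ∖ {y}. -/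
variable {V : Type*}

/-- Induced 4-cycle `(a,b,c,d)`. -/
def InducedSquare (G : SimpleGraph V) (a b c d : V) : Prop :=
  G.Adj a b ∧ G.Adj b c ∧ G.Adj c d ∧ G.Adj d a ∧
    a ≠ c ∧ b ≠ d ∧ ¬ G.Adj a c ∧ ¬ G.Adj b d

/-- The `(C4,W4)`-condition: every induced 4-cycle has a vertex adjacent to all
its four vertices. -/
def C4W4Condition (G : SimpleGraph V) : Prop :=
  ∀ a b c d : V, InducedSquare G a b c d →
    ∃ x : V, G.Adj x a ∧ G.Adj x b ∧ G.Adj x c ∧ G.Adj x d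

/-- `C` is a maximal clique of `G`. -/
def IsMaxClique (G : SimpleGraph V) (C : Set V) : Prop :=
  G.IsClique C ∧ ∀ D : Set V, G.IsClique D → C ⊆ D → C = D

/-- Every finite family of pairwise intersecting maximal cliques has a common vertex. -/
def IsFinitelyCliqueHelly (G : SimpleGraph V) : Prop :=
  ∀ 𝒞 : Finset (Set V), (∀ C ∈ 𝒞, IsMaxClique G C) →
    (∀ C ∈ 𝒞, ∀ C' ∈ 𝒞, ∃ x : V, x ∈ C ∧ x ∈ C') →
    ∃ x : V, ∀ C ∈ 𝒞, x ∈ C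

namespace SimpleGraph

theorem IsClique.exists_isMaxClique_superset {G : SimpleGraph V} {S : Set V} (hS : G.IsClique S) :
    ∃ C : Set V, IsMaxClique G C ∧ S ⊆ C := by
  obtain ⟨C, hSC, hC⟩ := zorn_subset_nonempty {C : Set V | G.IsClique C} (fun c hc hchain _ =>
    ⟨⋃₀ c, (Set.pairwise_sUnion hchain.directedOn).2 hc,
      fun s hs => Set.subset_sUnion_of_mem hs⟩) S hS
  exact ⟨C, ⟨hC.prop, fun D hD hCD => hC.eq_of_subset hD hCD⟩, hSC⟩

/-- In a finitely clique-Helly graph, finitely many pairwise intersecting cliques (not necessarily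
maximal) have a vertex equal or adjacent to each of their vertices. -/
theorem exists_forall_eq_or_adj_of_isClique {G : SimpleGraph V} (hch : IsFinitelyCliqueHelly G)
    (𝒮 : Finset (Set V)) (hcl : ∀ S ∈ 𝒮, G.IsClique S)
    (hint : ∀ S ∈ 𝒮, ∀ T ∈ 𝒮, ∃ x, x ∈ S ∧ x ∈ T) :
    ∃ p, ∀ S ∈ 𝒮, ∀ s ∈ S, p = s ∨ G.Adj p s := by
  classical
  have hext : ∀ S : Set V, ∃ C : Set V, S ∈ 𝒮 → IsMaxClique G C ∧ S ⊆ C := fun S => by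
    by_cases hS : S ∈ 𝒮
    · obtain ⟨C, hC⟩ := (hcl S hS).exists_isMaxClique_superset
      exact ⟨C, fun _ => hC⟩
    · exact ⟨∅, fun h => absurd h hS⟩
  choose f hf using hext
  obtain ⟨p, hp⟩ := hch (𝒮.image f)
    (Finset.forall_mem_image.2 fun S hS => (hf S hS).1)
    (Finset.forall_mem_image.2 fun S hS => Finset.forall_mem_image.2 fun T hT => by
      obtain ⟨x, hxS, hxT⟩ := hint S hS T hT
      exact ⟨x, (hf S hS).2 hxS, (hf T hT).2 hxT⟩)
  refine ⟨p, fun S hS s hs => or_iff_not_imp_left.2 fun hne => ?_⟩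
  exact (hf S hS).1.1 (hp _ (Finset.mem_image_of_mem f hS)) ((hf S hS).2 hs) hne

theorem isClique_triple {G : SimpleGraph V} {a b c : V} (hab : a = b ∨ G.Adj a b)
    (hac : a = c ∨ G.Adj a c) (hbc : b = c ∨ G.Adj b c) : G.IsClique {a, b, c} := by
  intro x hx y hy hxy
  simp only [Set.mem_insert_iff, Set.mem_singleton_iff] at hx hy
  have := G.adj_comm
  grind

/-- The clique-Helly property applied around the triangle `v, y, z`. -/
theorem exists_eq_or_adj_of_triangle {G : SimpleGraph V} (hch : IsFinitelyCliqueHelly G)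
    {v y z x w : V} {W : Finset V} (hvy : G.Adj v y) (hvz : G.Adj v z) (hyz : G.Adj y z)
    (hyx : G.Adj y x) (hzx : G.Adj z x) (hvW : ∀ a ∈ W, v = a ∨ G.Adj v a)
    (hyW : ∀ a ∈ W, y = a ∨ G.Adj y a) (hvw : v = w ∨ G.Adj v w) (hzw : z = w ∨ G.Adj z w) :
    ∃ p, (p = v ∨ G.Adj p v) ∧ (p = x ∨ G.Adj p x) ∧ (p = w ∨ G.Adj p w) ∧
      ∀ a ∈ W, p = a ∨ G.Adj p a := by
  classical
  obtain ⟨p, hp⟩ := exists_forall_eq_or_adj_of_isClique hch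
    (insert {v, z, w} (insert {y, z, x} (W.image fun a => ({v, y, a} : Set V)))) (by
      simp only [Finset.forall_mem_insert, Finset.forall_mem_image]
      exact ⟨isClique_triple (.inr hvz) hvw hzw, isClique_triple (.inr hyz) (.inr hyx) (.inr hzx),
        fun a ha => isClique_triple (.inr hvy) (hvW a ha) (hyW a ha)⟩) (by
      simp only [Finset.forall_mem_insert, Finset.forall_mem_image]
      exact ⟨⟨⟨v, by simp⟩, ⟨z, by simp⟩, fun _ _ => ⟨v, by simp⟩⟩,
        ⟨⟨z, by simp⟩, ⟨z, by simp⟩, fun _ _ => ⟨y, by simp⟩⟩,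
        fun _ _ => ⟨⟨v, by simp⟩, ⟨y, by simp⟩, fun _ _ => ⟨v, by simp⟩⟩⟩)
  simp only [Finset.forall_mem_insert, Finset.forall_mem_image] at hp
  exact ⟨p, hp.1 v (by simp), hp.2.1 x (by simp), hp.1 w (by simp),
    fun a ha => hp.2.2 ha a (by simp)⟩

theorem Connected.dist_le_one_iff {G : SimpleGraph V} (hconn : G.Connected) {a b : V} :
    G.dist a b ≤ 1 ↔ a = b ∨ G.Adj a b := by
  rw [Nat.le_one_iff_eq_zero_or_eq_one, hconn.dist_eq_zero_iff, dist_eq_one_iff_adj]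

theorem Connected.dist_le_succ_of_eq_or_adj {G : SimpleGraph V} (hconn : G.Connected) {a b : V}
    (u : V) (h : a = b ∨ G.Adj a b) : G.dist u a ≤ G.dist u b + 1 := by
  have h₁ := hconn.dist_triangle (u := u) (v := b) (w := a)
  have h₂ := hconn.dist_le_one_iff.2 h
  rw [dist_comm] at h₂
  omega

section LowerNeighbors

variable {G : SimpleGraph V} {u v : V} {k : ℕ}

/-- Two neighbors of `v` closer to `u` than `v` have a common neighbor of the same kind, up to
equality. -/
theorem exists_lower_neighbor_of_lower (hconn : G.Connected) (hqc : QuadrangleCondition G)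
    (hc4 : C4W4Condition G) (hd : G.dist u v = k + 1) {a b : V} (hva : G.Adj v a)
    (hvb : G.Adj v b) (ha : G.dist u a = k) (hb : G.dist u b = k) :
    ∃ z, G.Adj v z ∧ G.dist u z = k ∧ (z = a ∨ G.Adj z a) ∧ (z = b ∨ G.Adj z b) := by
  by_cases hab : a = b ∨ G.Adj a b
  · exact ⟨a, hva, ha, .inl rfl, hab⟩
  have hdist : G.dist a b = 2 := by
    have h₁ := hconn.dist_le_one_iff.not.2 hab
    have h₂ := hconn.dist_triangle (u := a) (v := v) (w := b)
    rw [dist_eq_one_iff_adj.2 hvb, dist_comm (u := a) (v := v), dist_eq_one_iff_adj.2 hva] at h₂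
    omega
  push Not at hab
  obtain ⟨x, hax, hbx, hx⟩ := hqc u a b v hva hvb hdist (by omega) (by omega)
  have hvx : ¬ (v = x ∨ G.Adj v x) := fun h => by
    have := hconn.dist_le_succ_of_eq_or_adj u h
    omega
  push Not at hvx
  obtain ⟨z, hzv, hza, hzx, hzb⟩ :=
    hc4 v a x b ⟨hva, hax, hbx.symm, hvb.symm, hvx.1, hab.1, hvx.2, hab.2⟩
  have h₁ := hconn.dist_le_succ_of_eq_or_adj u (.inr hzx)
  have h₂ := hconn.dist_le_succ_of_eq_or_adj u (.inr hzv.symm)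
  exact ⟨z, hzv.symm, by omega, .inr hza, .inr hzb⟩

/-- From a lower neighbor `y` serving `W` and a lower neighbor `z` of `y` serving `w`, get one
serving both. -/
theorem exists_lower_neighbor_merge (hconn : G.Connected) (htc : TriangleCondition G)
    (hch : IsFinitelyCliqueHelly G) (hk : 1 ≤ k) (hd : G.dist u v = k + 1) {y z w : V}
    {W : Finset V} (hvy : G.Adj v y) (hvz : G.Adj v z) (hy : G.dist u y = k)
    (hz : G.dist u z = k) (hzy : z = y ∨ G.Adj z y) (hvW : ∀ a ∈ W, v = a ∨ G.Adj v a)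
    (hyW : ∀ a ∈ W, y = a ∨ G.Adj y a) (hvw : v = w ∨ G.Adj v w) (hzw : z = w ∨ G.Adj z w) :
    ∃ p, G.Adj v p ∧ G.dist u p = k ∧ (p = w ∨ G.Adj p w) ∧ ∀ a ∈ W, p = a ∨ G.Adj p a := by
  obtain rfl | hzy := hzy
  · exact ⟨z, hvz, hz, hzw, hyW⟩
  obtain ⟨x, hyx, hzx, hx⟩ := htc u y z hzy.symm (by omega) (by omega)
  obtain ⟨p, hpv, hpx, hpw, hpW⟩ :=
    exists_eq_or_adj_of_triangle hch hvy hvz hzy.symm hyx hzx hvW hyW hvw hzw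
  have h₁ := hconn.dist_le_succ_of_eq_or_adj u hpx
  have hpv : G.Adj p v := hpv.resolve_left fun h => by subst h; omega
  have h₂ := hconn.dist_le_succ_of_eq_or_adj u (.inr hpv.symm)
  exact ⟨p, hpv.symm, by omega, hpw, hpW⟩

theorem exists_lower_neighbor_of_lower_of_le (hconn : G.Connected) (hwm : WeaklyModular G)
    (hch : IsFinitelyCliqueHelly G) (hc4 : C4W4Condition G) (hk : 1 ≤ k)
    (hd : G.dist u v = k + 1) {y w : V} (hvy : G.Adj v y) (hy : G.dist u y = k)
    (hvw : v = w ∨ G.Adj v w) (hw : G.dist u w ≤ k + 1) :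
    ∃ z, G.Adj v z ∧ G.dist u z = k ∧ (z = y ∨ G.Adj z y) ∧ (z = w ∨ G.Adj z w) := by
  obtain rfl | hadj := hvw
  · exact ⟨y, hvy, hy, .inl rfl, .inr hvy.symm⟩
  have hle := hconn.dist_le_succ_of_eq_or_adj u (.inr hadj)
  obtain hw | hw : G.dist u w = k ∨ G.dist u w = k + 1 := by omega
  · exact exists_lower_neighbor_of_lower hconn hwm.2 hc4 hd hvy hadj hy hw
  obtain ⟨t, hvt, hwt, ht⟩ := hwm.1 u v w hadj (by omega) (by omega)
  obtain ⟨z, hvz, hz, hzt, hzy⟩ :=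
    exists_lower_neighbor_of_lower hconn hwm.2 hc4 hd hvt hvy (by omega) hy
  obtain ⟨p, hvp, hp, hpy, hpw⟩ := exists_lower_neighbor_merge (W := {w}) hconn hwm.1 hch hk hd
    hvt hvz (by omega) hz hzt (by simp [hadj]) (by simp [hwt.symm]) (.inr hvy) hzy
  exact ⟨p, hvp, hp, hpy, hpw w (by simp)⟩

end LowerNeighbors

end SimpleGraph

theorem statement8 (G : SimpleGraph V) (hconn : G.Connected)
    (hwm : WeaklyModular G) (hch : IsFinitelyCliqueHelly G)
    (hc4 : C4W4Condition G) (u v : V) (k : ℕ) (hd : G.dist u v = k + 1)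
    (W : Finset V) (hW : ∀ w ∈ W, G.dist v w ≤ 1 ∧ G.dist u w ≤ k + 1) :
    ∃ y : V, G.dist v y ≤ 1 ∧ G.dist u y ≤ k ∧ ∀ w ∈ W, w ≠ y → G.Adj y w := by
  obtain rfl | hk : k = 0 ∨ 1 ≤ k := by omega
  · exact ⟨u, by rw [SimpleGraph.dist_comm]; omega, by simp, fun w hw hne =>
      (hconn.dist_le_one_iff.1 (hW w hw).2).resolve_left hne.symm⟩
  suffices h : ∃ y, G.Adj v y ∧ G.dist u y = k ∧ ∀ w ∈ W, y = w ∨ G.Adj y w by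
    obtain ⟨y, hvy, hy, hyW⟩ := h
    exact ⟨y, hconn.dist_le_one_iff.2 (.inr hvy), hy.le,
      fun w hw hne => (hyW w hw).resolve_left hne.symm⟩
  classical
  induction W using Finset.induction_on with
  | empty =>
    obtain ⟨p, hp⟩ := hconn.exists_walk_length_eq_dist v u
    cases p with
    | nil => simp at hd
    | @cons _ y _ hvy q =>
      have h₁ := SimpleGraph.dist_le q
      have h₂ := hconn.dist_le_succ_of_eq_or_adj u (.inr hvy)
      rw [SimpleGraph.Walk.length_cons, SimpleGraph.dist_comm] at hp
      rw [SimpleGraph.dist_comm] at h₁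
      exact ⟨y, hvy, by omega, by simp⟩
  | insert w W _ ih =>
    rw [Finset.forall_mem_insert] at hW
    obtain ⟨⟨hvw, hw⟩, hW⟩ := hW
    obtain ⟨y, hvy, hy, hyW⟩ := ih hW
    rw [hconn.dist_le_one_iff] at hvw
    obtain ⟨z, hvz, hz, hzy, hzw⟩ :=
      SimpleGraph.exists_lower_neighbor_of_lower_of_le hconn hwm hch hc4 hk hd hvy hy hvw hw
    obtain ⟨p, hvp, hp, hpw, hpW⟩ :=
      SimpleGraph.exists_lower_neighbor_merge hconn hwm.1 hch hk hd hvy hvz hy hz hzy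
        (fun a ha => hconn.dist_le_one_iff.1 (hW a ha).1) hyW hvw hzw
    exact ⟨p, hvp, hp, Finset.forall_mem_insert _ _ _ |>.2 ⟨hpw, hpW⟩⟩
end

section
/- Every connected weakly modular 1-Helly graph is dismantlable. -/
variable {V : Type*}

/-- `G` is dismantlable: there is a well-order of the vertices such that every
vertex `v` other than the least element has a neighbor `w ≺ v` dominating `v`
in the subgraph induced by `{u : u ⪯ v}`. -/
def Dismantlable (G : SimpleGraph V) : Prop :=
  ∃ lt : V → V → Prop, IsWellOrder V lt ∧
    ∀ v : V, (∃ u : V, lt u v) →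
      ∃ w : V, lt w v ∧ G.Adj v w ∧
        ∀ u : V, (lt u v ∨ u = v) → G.Adj v u → u = w ∨ G.Adj w u

theorem SimpleGraph.Connected.dist_le_one_iff_s9 {G : SimpleGraph V} (hconn : G.Connected) {u v : V} :
    G.dist u v ≤ 1 ↔ u = v ∨ G.Adj u v := by
  rw [Nat.le_one_iff_eq_zero_or_eq_one, hconn.dist_eq_zero_iff, SimpleGraph.dist_eq_one_iff_adj]

/-- Two neighbors of `v` that are closer to `b` than `v` lie in a common unit ball centered at a
vertex that is still closer to `b` than `v`. -/
theorem QuadrangleCondition.exists_dist_le_one {G : SimpleGraph V} (hqc : QuadrangleCondition G)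
    (hconn : G.Connected) {b v p q : V} {n : ℕ} (hv : G.dist b v = n + 1)
    (hp : G.dist b p = n) (hvp : G.Adj v p) (hq : G.dist b q = n) (hvq : G.Adj v q) :
    ∃ x, G.dist b x ≤ n ∧ G.dist p x ≤ 1 ∧ G.dist q x ≤ 1 := by
  by_cases hpq : G.dist p q ≤ 1
  · exact ⟨q, hq.le, hpq, by simp⟩
  · have h2 : G.dist p q = 2 := by
      have := hconn.dist_triangle (u := p) (v := v) (w := q)
      rw [SimpleGraph.dist_eq_one_iff_adj.2 hvp.symm, SimpleGraph.dist_eq_one_iff_adj.2 hvq] at this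
      omega
    obtain ⟨x, hpx, hqx, hx⟩ := hqc b p q v hvp hvq h2 (by omega) (by omega)
    exact ⟨x, by omega, (SimpleGraph.dist_eq_one_iff_adj.2 hpx).le,
      (SimpleGraph.dist_eq_one_iff_adj.2 hqx).le⟩

/-- In a weakly modular 1-Helly graph, each vertex `v` at distance `n + 1` from `b` has a neighbor
at distance `n` from `b` that dominates `v` in the ball of radius `n + 1` around `b`. -/
theorem WeaklyModular.exists_dominating {G : SimpleGraph V} (hwm : WeaklyModular G)
    (hconn : G.Connected) (h1 : IsOneHelly G) (b : V) (n : ℕ) :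
    ∀ v, G.dist b v = n + 1 → ∃ w, G.dist b w = n ∧
      ∀ u, G.dist b u ≤ n + 1 → G.dist v u ≤ 1 → G.dist w u ≤ 1 := by
  induction n with
  | zero => exact fun v _ => ⟨b, by simp, fun u hu _ => by simpa using hu⟩
  | succ n ih =>
    intro v hv
    have hf : ∀ p, ∃ w, G.dist b p = n + 1 → G.dist b w = n ∧
        ∀ u, G.dist b u ≤ n + 1 → G.dist p u ≤ 1 → G.dist w u ≤ 1 := fun p => by
      by_cases h : G.dist b p = n + 1
      · obtain ⟨w, hw⟩ := ih p h
        exact ⟨w, fun _ => hw⟩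
      · exact ⟨p, fun h' => absurd h' h⟩
    choose f hf using hf
    let A : Set V := {p | G.dist b p = n + 1 ∧ G.Adj v p}
    have hparent : ∀ u, G.dist b u = n + 2 → G.dist v u ≤ 1 → ∃ p ∈ A, G.dist u p ≤ 1 := by
      intro u hu hvu
      rcases hconn.dist_le_one_iff_s9.1 hvu with rfl | hadj
      · obtain ⟨p, hp, hbp⟩ : ∃ p, G.Adj v p ∧ G.dist b p = n + 1 := by
          obtain ⟨q, hq⟩ := hconn.exists_walk_length_eq_dist v b
          rw [SimpleGraph.dist_comm, hv] at hq
          cases q with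
          | nil => simp at hq
          | @cons _ p _ hp q =>
            have hpb := SimpleGraph.dist_le q
            have htri := hconn.dist_triangle (u := b) (v := p) (w := v)
            rw [SimpleGraph.dist_eq_one_iff_adj.2 hp.symm] at htri
            rw [SimpleGraph.dist_comm] at hpb
            rw [SimpleGraph.Walk.length_cons] at hq
            exact ⟨p, hp, by omega⟩
        exact ⟨p, ⟨hbp, hp⟩, (SimpleGraph.dist_eq_one_iff_adj.2 hp).le⟩
      · obtain ⟨p, hvp, hup, hp⟩ := hwm.1 b v u hadj (by omega) (by omega)
        exact ⟨p, ⟨by omega, hvp⟩, (SimpleGraph.dist_eq_one_iff_adj.2 hup).le⟩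
    have hcommon : ∀ p ∈ A, ∀ q ∈ A,
        ∃ x, G.dist p x ≤ 1 ∧ G.dist q x ≤ 1 ∧ G.dist (f p) x ≤ 1 ∧ G.dist (f q) x ≤ 1 := by
      intro p hp q hq
      obtain ⟨x, hx, hpx, hqx⟩ := hwm.2.exists_dist_le_one hconn hv hp.1 hp.2 hq.1 hq.2
      exact ⟨x, hpx, hqx, (hf p hp.1).2 x hx hpx, (hf q hq.1).2 x hx hqx⟩
    obtain ⟨p₀, hp₀, -⟩ := hparent v hv (by simp)
    obtain ⟨y, hy⟩ : ∃ y, ∀ u ∈ A ∪ f '' A, G.dist u y ≤ 1 := by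
      apply h1
      rintro _ (hp | ⟨p, hp, rfl⟩) _ (hq | ⟨q, hq, rfl⟩) <;>
        obtain ⟨x, h₁, h₂, h₃, h₄⟩ := hcommon _ hp _ hq <;> exact ⟨x, ‹_›, ‹_›⟩
    have hyA : ∀ p ∈ A, G.dist y p ≤ 1 := fun p hp => by
      rw [SimpleGraph.dist_comm]; exact hy p (.inl hp)
    obtain ⟨z, hbz, hz⟩ : ∃ z, G.dist b z ≤ n ∧ ∀ p ∈ A, G.dist z p ≤ 1 := by
      have hyf := hy (f p₀) (.inr ⟨p₀, hp₀, rfl⟩)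
      have htri := hconn.dist_triangle (u := b) (v := f p₀) (w := y)
      have hfp := (hf p₀ hp₀.1).1
      by_cases hby : G.dist b y = n + 1
      · exact ⟨f y, (hf y hby).1.le, fun p hp => (hf y hby).2 p hp.1.le (hyA p hp)⟩
      · exact ⟨y, by omega, hyA⟩
    let N : Set V := {u | G.dist b u ≤ n + 2 ∧ G.dist v u ≤ 1}
    have hzN : ∀ u ∈ N, ∃ x, G.dist z x ≤ 1 ∧ G.dist u x ≤ 1 := by
      rintro u ⟨hu, hvu⟩
      by_cases hbu : G.dist b u = n + 2
      · obtain ⟨p, hp, hup⟩ := hparent u hbu hvu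
        exact ⟨p, hz p hp, hup⟩
      · have htri := hconn.dist_triangle (u := b) (v := u) (w := v)
        rw [SimpleGraph.dist_comm (u := u)] at htri
        rcases hconn.dist_le_one_iff_s9.1 hvu with rfl | hadj
        · exact absurd hv hbu
        · exact ⟨u, hz u ⟨by omega, hadj⟩, by simp⟩
    obtain ⟨w, hw⟩ : ∃ w, ∀ u ∈ insert z N, G.dist u w ≤ 1 := by
      apply h1
      rintro u (rfl | hu) u' (rfl | hu')
      · exact ⟨u', by simp, by simp⟩
      · exact hzN u' hu'
      · exact (hzN u hu).imp fun x hx => hx.symm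
      · exact ⟨v, by rw [SimpleGraph.dist_comm]; exact hu.2,
          by rw [SimpleGraph.dist_comm]; exact hu'.2⟩
    refine ⟨w, ?_, fun u hu hvu => by
      rw [SimpleGraph.dist_comm]; exact hw u (.inr ⟨hu, hvu⟩)⟩
    have hzw := hw z (.inl rfl)
    have hvw := hw v (.inr ⟨hv.le, by simp⟩)
    have htri := hconn.dist_triangle (u := b) (v := z) (w := w)
    have htri' := hconn.dist_triangle (u := b) (v := w) (w := v)
    rw [SimpleGraph.dist_comm (u := w)] at htri'
    omega

theorem statement9 (G : SimpleGraph V) (hconn : G.Connected)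
    (hwm : WeaklyModular G) (h1 : IsOneHelly G) :
    Dismantlable G := by
  obtain ⟨b⟩ := hconn.nonempty
  let key : V → ℕ × V := fun v => (G.dist b v, v)
  have hkey : Function.Injective key := fun _ _ h => congrArg Prod.snd h
  refine ⟨Order.Preimage key (Prod.Lex (· < ·) WellOrderingRel),
    (RelEmbedding.preimage ⟨key, hkey⟩ _).isWellOrder, ?_⟩
  rintro v ⟨u₀, hu₀⟩
  have hle : ∀ u, Prod.Lex (· < ·) WellOrderingRel (key u) (key v) →
      G.dist b u ≤ G.dist b v := fun u hu => by
    rcases Prod.lex_def.1 hu with h | h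
    exacts [h.le, h.1.le]
  obtain ⟨n, hn⟩ : ∃ n, G.dist b v = n + 1 := by
    refine Nat.exists_eq_succ_of_ne_zero fun h0 => ?_
    have hbu := Nat.le_zero.1 ((hle u₀ hu₀).trans h0.le)
    obtain rfl := hconn.dist_eq_zero_iff.1 h0
    obtain rfl := hconn.dist_eq_zero_iff.1 hbu
    exact irrefl _ hu₀
  obtain ⟨w, hw, hdom⟩ := hwm.exists_dominating hconn h1 b n v hn
  refine ⟨w, Prod.Lex.left _ _ (by omega), ?_, fun u hu hvu => ?_⟩
  · rcases hconn.dist_le_one_iff_s9.1 (hdom v hn.le (by simp)) with rfl | h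
    · omega
    · exact h.symm
  · have hbu : G.dist b u ≤ n + 1 := by
      rcases hu with hu | rfl
      · exact hn ▸ hle u hu
      · exact hn.le
    rcases hconn.dist_le_one_iff_s9.1
      (hdom u hbu (SimpleGraph.dist_eq_one_iff_adj.2 hvu).le) with h | h
    exacts [.inl h.symm, .inr h]
end

section
/- Let G be a connected thick weakly modular graph containing no induced K_4^- and no isometric K_{3,3}^-. Then for every pair of vertices u,v with d(u,v) ≥ 2 and every neighbor x of u with x ∈ I(u,v), there exists a neighbor y of v with y ∈ I(u,v) such that d(x,y) = d(u,v), d(u,y) = d(u,v) − 1 and d(x,v) = d(u,v) − 1. -/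
variable {V : Type*}

/-- A graph is thick if every interval between vertices at distance 2 contains
four vertices inducing a 4-cycle. -/
def Thick (G : SimpleGraph V) : Prop :=
  ∀ u v : V, G.dist u v = 2 →
    ∃ a b c d : V, a ∈ gInterval G u v ∧ b ∈ gInterval G u v ∧
      c ∈ gInterval G u v ∧ d ∈ gInterval G u v ∧ InducedSquare G a b c d

namespace SimpleGraph

variable {G : SimpleGraph V}

theorem Connected.dist_le_dist_add_one (hconn : G.Connected) (a : V) {b c : V}
    (h : G.Adj b c) : G.dist a c ≤ G.dist a b + 1 := by
  have := hconn.dist_triangle (u := a) (v := b) (w := c)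
  rwa [dist_eq_one_iff_adj.mpr h] at this

theorem Connected.exists_adj_dist_eq (hconn : G.Connected) {a b : V} {n : ℕ}
    (h : G.dist a b = n + 1) : ∃ c, G.Adj b c ∧ G.dist a c = n := by
  obtain ⟨p, hp⟩ := hconn.exists_walk_length_eq_dist b a
  rw [dist_comm, h] at hp
  cases p with
  | nil => simp at hp
  | @cons _ c _ hbc q =>
    refine ⟨c, hbc, ?_⟩
    have hq := dist_le q
    have hle := hconn.dist_le_dist_add_one a hbc.symm
    rw [dist_comm] at hq
    simp only [Walk.length_cons] at hp
    omega

theorem dist_eq_two_of_common_neighbor {a b c : V} (hca : G.Adj c a) (hcb : G.Adj c b)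
    (hne : a ≠ b) (hab : ¬ G.Adj a b) : G.dist a b = 2 := by
  have hle : G.dist a b ≤ 2 := dist_le (Walk.cons hca.symm (Walk.cons hcb Walk.nil))
  have h0 : G.dist a b ≠ 0 := fun h =>
    hne ((Reachable.dist_eq_zero_iff ⟨Walk.cons hca.symm (Walk.cons hcb Walk.nil)⟩).mp h)
  have h1 : G.dist a b ≠ 1 := fun h => hab (dist_eq_one_iff_adj.mp h)
  omega

theorem eq_or_adj_of_common_edge (h4 : ¬ HasInducedK4minus G) {a b c d : V} (hab : G.Adj a b)
    (hac : G.Adj a c) (had : G.Adj a d) (hbc : G.Adj b c) (hbd : G.Adj b d) :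
    c = d ∨ G.Adj c d := by
  by_contra! h
  exact h4 ⟨a, b, c, d, hab, hac, had, hbc, hbd, h.1, h.2⟩

theorem not_adj_of_dist_eq_two (h4 : ¬ HasInducedK4minus G) {p q a b : V}
    (hpq : G.dist p q = 2) (hpa : G.Adj p a) (hqa : G.Adj q a) (hpb : G.Adj p b)
    (hqb : G.Adj q b) : ¬ G.Adj a b := by
  intro hab
  rcases eq_or_adj_of_common_edge h4 hab hpa.symm hqa.symm hpb.symm hqb.symm with rfl | h
  · simp at hpq
  · rw [dist_eq_one_iff_adj.mpr h] at hpq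
    omega

theorem dist_eq_two_of_dist_eq_two (h4 : ¬ HasInducedK4minus G) {p q a b : V}
    (hpq : G.dist p q = 2) (hpa : G.Adj p a) (hqa : G.Adj q a) (hpb : G.Adj p b)
    (hqb : G.Adj q b) (hne : a ≠ b) : G.dist a b = 2 :=
  dist_eq_two_of_common_neighbor hpa hpb hne (not_adj_of_dist_eq_two h4 hpq hpa hqa hpb hqb)

theorem adj_of_mem_gInterval (hconn : G.Connected) {p q c : V} (hpq : G.dist p q = 2)
    (hc : c ∈ gInterval G p q) (hcp : c ≠ p) (hcq : c ≠ q) : G.Adj p c ∧ G.Adj q c := by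
  have h : G.dist p c + G.dist c q = 2 := hpq ▸ hc
  have h1 := hconn.pos_dist_of_ne hcp.symm
  have h2 := hconn.pos_dist_of_ne hcq
  exact ⟨dist_eq_one_iff_adj.mp (by omega), (dist_eq_one_iff_adj.mp (by omega)).symm⟩

theorem exists_common_neighbor_ne (hconn : G.Connected) (hthick : Thick G) {p q a : V}
    (hpq : G.dist p q = 2) : ∃ b, G.Adj p b ∧ G.Adj q b ∧ b ≠ a := by
  obtain ⟨c₁, c₂, c₃, c₄, h₁, h₂, h₃, h₄, e₁₂, e₂₃, e₃₄, e₄₁, n₁₃, n₂₄, m₁₃, m₂₄⟩ := hthick p q hpq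
  have key : ∀ {c c' : V}, c ∈ gInterval G p q → c' ∈ gInterval G p q → c ≠ c' →
      c ≠ p → c ≠ q → c' ≠ p → c' ≠ q → ∃ b, G.Adj p b ∧ G.Adj q b ∧ b ≠ a := by
    intro c c' hc hc' hne hcp hcq hcp' hcq'
    by_cases hca : c = a
    · have := adj_of_mem_gInterval hconn hpq hc' hcp' hcq'
      exact ⟨c', this.1, this.2, fun h => hne (hca.trans h.symm)⟩
    · have := adj_of_mem_gInterval hconn hpq hc hcp hcq
      exact ⟨c, this.1, this.2, hca⟩
  have hnadj : ¬ G.Adj p q := fun h => by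
    rw [dist_eq_one_iff_adj.mpr h] at hpq
    omega
  have hend : ∀ {c c' : V}, G.Adj c c' → c = p ∨ c = q → c' ≠ p ∧ c' ≠ q := by
    rintro c c' h (rfl | rfl)
    · exact ⟨h.ne', fun hc => hnadj (hc ▸ h)⟩
    · exact ⟨fun hc => hnadj (hc ▸ h.symm), h.ne'⟩
  by_cases hc₂ : c₂ = p ∨ c₂ = q
  · have hc₁ := hend e₁₂.symm hc₂
    have hc₃ := hend e₂₃ hc₂
    exact key h₁ h₃ n₁₃ hc₁.1 hc₁.2 hc₃.1 hc₃.2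
  · by_cases hc₄ : c₄ = p ∨ c₄ = q
    · have hc₁ := hend e₄₁ hc₄
      have hc₃ := hend e₃₄.symm hc₄
      exact key h₁ h₃ n₁₃ hc₁.1 hc₁.2 hc₃.1 hc₃.2
    · push Not at hc₂ hc₄
      exact key h₂ h₄ n₂₄ hc₂.1 hc₂.2 hc₄.1 hc₄.2

theorem exists_opposite_neighbor (hconn : G.Connected) (hwm : WeaklyModular G)
    (hthick : Thick G) (h4 : ¬ HasInducedK4minus G) (h33 : ¬ HasIsometricK33minus G)
    (k : ℕ) {u v x : V} (hd : G.dist u v = k + 2) (hux : G.Adj u x)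
    (hxv : G.dist x v = k + 1) :
    ∃ y, G.Adj v y ∧ G.dist u y = k + 1 ∧ G.dist x y = k + 2 := by
  obtain ⟨hTC, hQC⟩ := hwm
  induction k generalizing u v x with
  | zero =>
    have hvx := (dist_eq_one_iff_adj.mp hxv).symm
    obtain ⟨y, huy, hvy, hne⟩ := exists_common_neighbor_ne hconn hthick (a := x) hd
    exact ⟨y, hvy, dist_eq_one_iff_adj.mpr huy,
      dist_eq_two_of_dist_eq_two h4 hd hux hvx huy hvy hne.symm⟩
  | succ k ih =>
    have hstep : ∀ a {b c : V}, G.Adj b c →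
        G.dist a c ≤ G.dist a b + 1 ∧ G.dist a b ≤ G.dist a c + 1 := fun a b c h =>
      ⟨hconn.dist_le_dist_add_one a h, hconn.dist_le_dist_add_one a h.symm⟩
    have hux' : ∀ a, G.dist u a ≤ G.dist x a + 1 := fun a => by
      rw [dist_comm (u := u), dist_comm (u := x)]
      exact (hstep a hux).2
    obtain ⟨v', hvv', hxv'⟩ := hconn.exists_adj_dist_eq hxv
    have huv' : G.dist u v' = k + 2 := by
      have := hux' v'
      have := hstep u hvv'
      omega
    obtain ⟨y', hv'y', huy', hxy'⟩ := ih huv' hux hxv'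
    have hnvy' : v ≠ y' := by
      rintro rfl
      omega
    have hvy' : ¬ G.Adj v y' := fun h => by
      have := hstep u h
      omega
    have h2 : G.dist v y' = 2 := dist_eq_two_of_common_neighbor hvv'.symm hv'y' hnvy' hvy'
    obtain ⟨y, hvy, hy'y, hyne⟩ := exists_common_neighbor_ne hconn hthick (a := v') h2
    have huy : G.dist u y = k + 2 := by
      have := hstep u hvy
      have := hstep u hy'y
      omega
    refine ⟨y, hvy, huy, ?_⟩
    have hv'y : G.dist v' y = 2 :=
      dist_eq_two_of_dist_eq_two h4 h2 hvv' hv'y'.symm hvy hy'y hyne.symm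
    have hxy_ne : G.dist x y ≠ k + 2 := by
      intro hxy
      obtain ⟨s, hys, hvs, hxs⟩ := hTC x y v hvy.symm (by omega) (by omega)
      have hus : G.dist u s = k + 2 := by
        have := hux' s
        have := hstep u hvs
        omega
      obtain ⟨r, hyr, hsr, hur⟩ := hTC u y s hys (by omega) (by omega)
      rcases eq_or_adj_of_common_edge h4 hys hvy.symm hyr hvs.symm hsr with rfl | h
      · omega
      · have := hstep u h
        omega
    have hxy_ne' : G.dist x y ≠ k + 1 := by
      intro hxy
      obtain ⟨z, hv'z, hyz, hxz⟩ :=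
        hQC x v' y y' hv'y'.symm hy'y hv'y (by omega) (by omega)
      have huz : G.dist u z = k + 1 := by
        have := hux' z
        have := hstep u hyz
        omega
      have hy'z : G.dist y' z = 2 :=
        dist_eq_two_of_dist_eq_two h4 hv'y hv'y' hy'y.symm hv'z hyz (by rintro rfl; omega)
      have hvz : G.dist v z = 2 :=
        dist_eq_two_of_dist_eq_two h4 hv'y hvv'.symm hvy.symm hv'z hyz (by rintro rfl; omega)
      obtain ⟨t, hy't, hzt, hut⟩ :=
        hQC u y' z y hy'y.symm hyz hy'z (by omega) (by omega)
      have hyt : G.dist y t = 2 :=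
        dist_eq_two_of_dist_eq_two h4 hy'z hy'y hyz.symm hy't hzt (by rintro rfl; omega)
      have hv't : G.dist v' t = 2 :=
        dist_eq_two_of_dist_eq_two h4 hy'z hv'y'.symm hv'z.symm hy't hzt (by rintro rfl; omega)
      have hvt : G.dist v t = 3 := by
        have := hstep v hzt
        have := hconn.dist_triangle (u := u) (v := t) (w := v)
        rw [dist_comm (u := t)] at this
        omega
      exact h33 ⟨y', z, v, y, v', t, hy'y, hv'y'.symm, hy't, hyz.symm, hv'z.symm, hzt, hvy, hvv',
        hy'z, by rwa [dist_comm], by rwa [dist_comm], by rwa [dist_comm], hyt, hv't, hvt⟩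
    have := hstep x hvy
    have := hstep x hy'y
    have := hux' y
    omega

end SimpleGraph

theorem statement10 (G : SimpleGraph V) (hconn : G.Connected)
    (hwm : WeaklyModular G) (hthick : Thick G)
    (h4 : ¬ HasInducedK4minus G) (h33 : ¬ HasIsometricK33minus G)
    (u v x : V) (hd : 2 ≤ G.dist u v) (hx : G.Adj u x)
    (hxI : x ∈ gInterval G u v) :
    ∃ y : V, G.Adj v y ∧ y ∈ gInterval G u v ∧ G.dist x y = G.dist u v ∧
      G.dist u y + 1 = G.dist u v ∧ G.dist x v + 1 = G.dist u v := by
  have hx1 : G.dist u x = 1 := SimpleGraph.dist_eq_one_iff_adj.mpr hx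
  have hsum : G.dist u x + G.dist x v = G.dist u v := hxI
  obtain ⟨k, hk⟩ := Nat.exists_eq_add_of_le' hd
  obtain ⟨y, hvy, huy, hxy⟩ := SimpleGraph.exists_opposite_neighbor hconn hwm hthick h4 h33 k hk hx
    (by omega)
  have hyv : G.dist y v = 1 := SimpleGraph.dist_eq_one_iff_adj.mpr hvy.symm
  refine ⟨y, hvy, ?_, by omega, by omega, by omega⟩
  change G.dist u y + G.dist y v = G.dist u v
  omega
end
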